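/- The quotient of a torus by a free ℤ/3 action is a torus: if the group ℤ/3 acts by homeomorphisms on the 2-torus S¹ × S¹ such that γ • x ≠ x for every nonzero γ ∈ ℤ/3 and every x ∈ S¹ × S¹, then the orbit space (S¹ × S¹)/(ℤ/3) is homeomorphic to S¹ × S¹. -/

import Mathlib

/- STATEMENT 7: The quotient of the 2-torus S¹ × S¹ by a free ℤ/3 action by
homeomorphisms is homeomorphic to S¹ × S¹. -/

open Metric

noncomputable section

/-- The circle: the unit sphere in `EuclideanSpace ℝ (Fin 2)`. -/
abbrev Circle1 : Type := Metric.sphere (0 : EuclideanSpace ℝ (Fin 2)) 1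

/-- The 2-torus `S¹ × S¹`. -/
abbrev Torus2 : Type := Circle1 × Circle1

section

open Metric Set Filter Topology



/-! ## Part A: logarithms -/

lemma exp_eq_close {a b : ℂ} (h : Complex.exp a = Complex.exp b) (hd : ‖a - b‖ < 1) : a = b := by
  rw [Complex.exp_eq_exp_iff_exists_int] at h
  obtain ⟨n, hn⟩ := h
  by_cases h0 : n = 0
  · simpa [h0] using hn
  · exfalso
    have h1 : (1:ℝ) ≤ |(n:ℝ)| := by exact_mod_cast Int.one_le_abs h0
    have h2 : a - b = n * (2 * Real.pi * Complex.I) := by rw [hn]; ring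
    rw [h2] at hd
    simp [abs_of_pos Real.pi_pos] at hd
    nlinarith [Real.pi_gt_three]

lemma discrete_exp_one : DiscreteTopology {z : ℂ | Complex.exp z = 1} := by
  apply DiscreteTopology.of_forall_le_dist (r := 1) one_pos
  intro x y hxy
  by_contra h
  push Not at h
  apply hxy
  apply Subtype.ext
  apply exp_eq_close
  · rw [x.2, y.2]
  · rwa [Subtype.dist_eq, dist_eq_norm] at h

/-- two continuous logarithms of the same function on a preconnected set differ by a constant -/
lemma log_diff_const {X : Type*} [TopologicalSpace X] {S : Set X} (hS : IsPreconnected S)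
    {g h : X → ℂ} (hg : ContinuousOn g S) (hh : ContinuousOn h S)
    (he : ∀ x ∈ S, Complex.exp (g x) = Complex.exp (h x)) {x y : X} (hx : x ∈ S) (hy : y ∈ S) :
    g x - h x = g y - h y := by
  refine hS.constant_of_mapsTo (T := {z : ℂ | Complex.exp z = 1}) (f := fun x => g x - h x)
    (isDiscrete_iff_discreteTopology.mpr discrete_exp_one) ?_ ?_ hx hy
  · exact hg.sub hh
  · intro z hz
    simp [Complex.exp_sub, he z hz]

lemma exp_one_const {S : Set ℂ} (hS : IsPreconnected S)
    {g : ℂ → ℂ} (hg : ContinuousOn g S)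
    (he : ∀ x ∈ S, Complex.exp (g x) = 1) {x y : ℂ} (hx : x ∈ S) (hy : y ∈ S) :
    g x = g y := by
  have := log_diff_const hS hg (h := fun _ => 0) continuousOn_const (by simpa using he) hx hy
  simpa using this

lemma logC {u : ℂ → ℂ} (hu : Continuous u) (h0 : ∀ z, u z ≠ 0) :
    ∃ L : ℂ → ℂ, Continuous L ∧ ∀ z, Complex.exp (L z) = u z := by
  have hsc : IsSimplyConnected (univ : Set ℂ) := by
    have : SimplyConnectedSpace (univ : Set ℂ) := by
      have : ContractibleSpace (univ : Set ℂ) := (Homeomorph.Set.univ ℂ).contractibleSpace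
      infer_instance
    exact this
  obtain ⟨f, hf, hfe⟩ := Complex.exists_continuousOn_eqOn_exp_comp hsc isOpen_univ
    hu.continuousOn (by rintro ⟨z, -, hz⟩; exact h0 z hz)
  exact ⟨f, continuousOn_univ.mp hf, fun z => hfe (mem_univ z)⟩

/-! ## Part B: no fixed point free map of order three -/

lemma no_free_order_three (f : ℂ → ℂ) (hf : Continuous f) (h3 : ∀ z, f (f (f z)) = z)
    (hfix : ∀ z, f z ≠ z) : False := by
  obtain ⟨L, hL, hLe⟩ := logC (u := fun z => f z - z) (by fun_prop)
    (fun z => sub_ne_zero.mpr (hfix z))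
  set a : ℂ → ℝ := fun z => (L (f z) - L z).im with ha
  have hac : Continuous a := by fun_prop
  obtain ⟨ω, hω⟩ : ∃ ω : ℂ, ω = Complex.exp (2 * Real.pi * Complex.I / 3) := ⟨_, rfl⟩
  have hω3 : ω ^ 3 = 1 := by
    rw [hω, ← Complex.exp_nat_mul]
    convert Complex.exp_two_pi_mul_I using 2
    push_cast; ring
  have hωre : ω.re = -1/2 := by
    rw [hω, show (2 * Real.pi * Complex.I / 3 : ℂ) = ((Real.pi - Real.pi / 3 : ℝ) : ℂ) * Complex.I by
      push_cast; ring, Complex.exp_ofReal_mul_I_re, Real.cos_pi_sub, Real.cos_pi_div_three]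
    norm_num
  have hωim : ω.im = √3/2 := by
    rw [hω, show (2 * Real.pi * Complex.I / 3 : ℂ) = ((Real.pi - Real.pi / 3 : ℝ) : ℂ) * Complex.I by
      push_cast; ring, Complex.exp_ofReal_mul_I_im, Real.sin_pi_sub, Real.sin_pi_div_three]
  have hs3 : (√3:ℝ)^2 = 3 := Real.sq_sqrt (by norm_num)
  have hs3p : (0:ℝ) < √3 := by positivity
  have hsum : ∀ z, a z + a (f z) + a (f (f z)) = 0 := by
    intro z
    simp [ha, h3]
  set m : ℂ → ℂ := fun z => a z + ω ^ 2 * a (f z) + ω * a (f (f z)) with hm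
  have hmc : Continuous m := by fun_prop
  have hmf : ∀ z, m (f z) = ω * m z := by
    intro z
    simp only [hm, h3]
    linear_combination (-(a (f z) : ℂ)) * hω3
  -- nonvanishing
  have hm0 : ∀ z, m z ≠ 0 := by
    intro z hz
    have hre := congrArg Complex.re hz
    have him := congrArg Complex.im hz
    simp [hm, pow_two, hωre, hωim] at hre him
    have e1 : a (f z) = a (f (f z)) := by
      have : √3 * (a (f (f z)) - a (f z)) = 0 := by linarith
      rcases mul_eq_zero.mp this with h | h
      · exact absurd h hs3p.ne'
      · linarith
    have hs := hsum z
    have e2 : a z = a (f z) := by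
      nlinarith
    have a0 : a z = 0 := by linarith
    have a1 : a (f z) = 0 := by linarith
    -- d, d∘f, d∘f² are positive multiples of each other
    have key : ∀ y, a y = 0 → f (f y) - f y = (Real.exp ((L (f y) - L y).re) : ℂ) * (f y - y) := by
      intro y hy
      have h1 := hLe y
      have h2 := hLe (f y)
      rw [← h2, ← h1, Complex.ofReal_exp, ← Complex.exp_add]
      congr 1
      apply Complex.ext
      · simp
      · simp [ha] at hy
        simp; linarith
    have k1 := key z a0
    have k2 := key (f z) a1
    rw [h3] at k2
    rw [k1] at k2
    have hzero : (1 + (Real.exp ((L (f z) - L z).re) : ℂ) +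
      (Real.exp ((L (f (f z)) - L (f z)).re) : ℂ) * (Real.exp ((L (f z) - L z).re) : ℂ)) *
        (f z - z) = 0 := by
      linear_combination -k1 - k2
    rcases mul_eq_zero.mp hzero with h | h
    · have : (1 + (Real.exp ((L (f z) - L z).re)) +
        (Real.exp ((L (f (f z)) - L (f z)).re)) * (Real.exp ((L (f z) - L z).re)) : ℝ) = 0 := by
        exact_mod_cast h
      have p1 := Real.exp_pos ((L (f z) - L z).re)
      have p2 := Real.exp_pos ((L (f (f z)) - L (f z)).re)
      nlinarith [mul_pos p1 p2]
    · exact hfix z (sub_eq_zero.mp h)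
  obtain ⟨M, hM, hMe⟩ := logC hmc hm0
  have hconst : ∀ z, M (f z) - M z = M (f 0) - M 0 := by
    intro z
    have := log_diff_const (S := univ) isPreconnected_univ (g := fun z => M (f z))
      (h := fun z => M z + 2 * Real.pi * Complex.I / 3) (by fun_prop) (by fun_prop)
      (by intro x _; rw [Complex.exp_add, hMe, hMe, hmf, ← hω, mul_comm]) (mem_univ z) (mem_univ 0)
    linear_combination this
  have hz : M (f 0) - M 0 = 0 := by
    have h1 := hconst (f 0)
    have h2 := hconst (f (f 0))
    rw [h3] at h2
    linear_combination (-h1 - h2) / 3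
  have : m (f 0) = m 0 := by rw [← hMe, ← hMe, sub_eq_zero.mp hz]
  rw [hmf] at this
  have : ω = 1 := by
    have h2 : (ω - 1) * m 0 = 0 := by linear_combination this
    rcases mul_eq_zero.mp h2 with h | h
    · linear_combination h
    · exact absurd h (hm0 0)
  rw [this] at hωre
  norm_num at hωre



/-! ## Part C: logarithms on compact sets with connected complement -/

/-- `u` has a continuous logarithm on `S` -/
def HasLog (S : Set ℂ) (u : ℂ → ℂ) : Prop :=
  ∃ L : ℂ → ℂ, ContinuousOn L S ∧ ∀ z ∈ S, Complex.exp (L z) = u z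

def FullSet (K : Set ℂ) : Prop := ∀ p ∉ K, HasLog K (fun z => z - p)

lemma HasLog.mono {S S' : Set ℂ} {u : ℂ → ℂ} (h : HasLog S u) (hs : S' ⊆ S) : HasLog S' u := by
  obtain ⟨L, hL, he⟩ := h
  exact ⟨L, hL.mono hs, fun z hz => he z (hs hz)⟩

lemma HasLog.congr {S : Set ℂ} {u v : ℂ → ℂ} (h : HasLog S u) (hs : ∀ z ∈ S, v z = u z) :
    HasLog S v := by
  obtain ⟨L, hL, he⟩ := h
  exact ⟨L, hL, fun z hz => by rw [he z hz, hs z hz]⟩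

lemma HasLog.mul {S : Set ℂ} {u v : ℂ → ℂ} (h : HasLog S u) (h' : HasLog S v) :
    HasLog S (fun z => u z * v z) := by
  obtain ⟨L, hL, he⟩ := h
  obtain ⟨L', hL', he'⟩ := h'
  exact ⟨fun z => L z + L' z, hL.add hL', fun z hz => by rw [Complex.exp_add, he z hz, he' z hz]⟩

lemma hasLog_const (S : Set ℂ) {c : ℂ} (hc : c ≠ 0) : HasLog S (fun _ => c) :=
  ⟨fun _ => Complex.log c, continuousOn_const, fun _ _ => Complex.exp_log hc⟩

lemma hasLog_of_re_pos {S : Set ℂ} {u : ℂ → ℂ} (hu : ContinuousOn u S)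
    (h : ∀ z ∈ S, 0 < (u z).re) : HasLog S u := by
  refine ⟨fun z => Complex.log (u z), ?_, ?_⟩
  · intro z hz
    exact (hu z hz).clog (Or.inl (h z hz))
  · intro z hz
    apply Complex.exp_log
    intro h0
    have := h z hz
    simp [h0] at this

lemma hasLog_of_re_pos' {S : Set ℂ} {u : ℂ → ℂ} (c : ℂ) (hc : c ≠ 0) (hu : ContinuousOn u S)
    (h : ∀ z ∈ S, 0 < (u z * c).re) : HasLog S u := by
  have h1 : HasLog S (fun z => u z * c) := hasLog_of_re_pos (hu.mul continuousOn_const) h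
  refine (h1.mul (hasLog_const S (inv_ne_zero hc))).congr ?_
  intro z _
  field_simp

lemma FullSet.inter_aux {K C : Set ℂ} (hK : FullSet K) (c : ℂ) (hc : c ≠ 0)
    (h : ∀ p ∉ C, ∀ z ∈ C, 0 < ((z - p) * c).re) : FullSet (K ∩ C) := by
  intro p hp
  by_cases hpK : p ∈ K
  · have hpC : p ∉ C := fun h => hp ⟨hpK, h⟩
    exact hasLog_of_re_pos' c hc (by fun_prop) (fun z hz => h p hpC z hz.2)
  · exact (hK p hpK).mono inter_subset_left

lemma FullSet.re_le {K : Set ℂ} (hK : FullSet K) (a : ℝ) : FullSet (K ∩ {z | z.re ≤ a}) := by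
  apply hK.inter_aux (-1) (by norm_num)
  intro p hp z hz
  simp at *; linarith

lemma FullSet.le_re {K : Set ℂ} (hK : FullSet K) (a : ℝ) : FullSet (K ∩ {z | a ≤ z.re}) := by
  apply hK.inter_aux 1 (by norm_num)
  intro p hp z hz
  simp at *; linarith

lemma FullSet.im_le {K : Set ℂ} (hK : FullSet K) (a : ℝ) : FullSet (K ∩ {z | z.im ≤ a}) := by
  apply hK.inter_aux Complex.I (by simp)
  intro p hp z hz
  simp at *; linarith

lemma FullSet.le_im {K : Set ℂ} (hK : FullSet K) (a : ℝ) : FullSet (K ∩ {z | a ≤ z.im}) := by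
  apply hK.inter_aux (-Complex.I) (by simp)
  intro p hp z hz
  simp at *; linarith

/-- `n` on the line `Re = c` is a difference of integral functions on the two halves -/
def DiffOn (K : Set ℂ) (c : ℝ) (n : ℂ → ℂ) : Prop :=
  ∃ D1 D2 : ℂ → ℂ, ContinuousOn D1 (K ∩ {z | z.re ≤ c}) ∧ ContinuousOn D2 (K ∩ {z | c ≤ z.re}) ∧
    (∀ z ∈ K ∩ {z | z.re ≤ c}, Complex.exp (D1 z) = 1) ∧
    (∀ z ∈ K ∩ {z | c ≤ z.re}, Complex.exp (D2 z) = 1) ∧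
    ∀ z ∈ K, z.re = c → D1 z - D2 z = n z

lemma DiffOn.add {K : Set ℂ} {c : ℝ} {n m l : ℂ → ℂ} (hn : DiffOn K c n) (hm : DiffOn K c m)
    (hl : ∀ z ∈ K, z.re = c → l z = n z + m z) : DiffOn K c l := by
  obtain ⟨D1, D2, h1, h2, e1, e2, h⟩ := hn
  obtain ⟨D1', D2', h1', h2', e1', e2', h'⟩ := hm
  refine ⟨fun z => D1 z + D1' z, fun z => D2 z + D2' z, h1.add h1', h2.add h2', ?_, ?_, ?_⟩
  · intro z hz; rw [Complex.exp_add, e1 z hz, e1' z hz, one_mul]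
  · intro z hz; rw [Complex.exp_add, e2 z hz, e2' z hz, one_mul]
  · intro z hz hc
    rw [hl z hz hc, ← h z hz hc, ← h' z hz hc]; ring

lemma diffOn_jump {K : Set ℂ} {c t : ℝ} (hK : FullSet K) (hp : (⟨c, t⟩ : ℂ) ∉ K) {c0 : ℂ}
    (hc0 : Complex.exp c0 = 1) : DiffOn K c (fun z => if z.im < t then 0 else c0) := by
  obtain ⟨Λ, hΛ, hΛe⟩ := hK _ hp
  set p : ℂ := ⟨c, t⟩ with hpdef
  have hpre : p.re = c := rfl
  have hpim : p.im = t := rfl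
  obtain ⟨m, hm⟩ := Complex.exp_eq_one_iff.mp hc0
  have hne : ∀ z ∈ K, z - p ≠ 0 := fun z hz h => hp (by rw [← sub_eq_zero.mp h]; exact hz)
  have hslit : ∀ w : ℂ, w ≠ 0 → 0 ≤ w.re → w ∈ Complex.slitPlane := by
    intro w hw hre
    rcases hre.lt_or_eq with h | h
    · exact Or.inl h
    · right
      intro him
      exact hw (Complex.ext h.symm him)
  refine ⟨fun z => c0 - m * (Complex.log (-(z - p)) + Real.pi * Complex.I - Λ z),
    fun z => - m * (Complex.log (z - p) - Λ z), ?_, ?_, ?_, ?_, ?_⟩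
  · apply continuousOn_const.sub
    apply continuousOn_const.mul
    refine ContinuousOn.sub (ContinuousOn.add ?_ continuousOn_const) (hΛ.mono inter_subset_left)
    refine ContinuousOn.clog (by fun_prop) ?_
    intro z hz
    apply hslit _ (neg_ne_zero.mpr (hne z hz.1))
    have := hz.2
    simp at this ⊢; linarith
  · apply continuousOn_const.mul
    refine ContinuousOn.sub ?_ (hΛ.mono inter_subset_left)
    refine ContinuousOn.clog (by fun_prop) ?_
    intro z hz
    apply hslit _ (hne z hz.1)
    have := hz.2
    simp at this ⊢; linarith
  · intro z hz
    have : Complex.exp (Complex.log (-(z - p)) + Real.pi * Complex.I - Λ z) = 1 := by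
      rw [Complex.exp_sub, Complex.exp_add, Complex.exp_log (neg_ne_zero.mpr (hne z hz.1)),
        hΛe z hz.1, Complex.exp_pi_mul_I]
      have := hne z hz.1
      field_simp
    rw [Complex.exp_sub, hc0, Complex.exp_int_mul, this]; simp
  · intro z hz
    have : Complex.exp (Complex.log (z - p) - Λ z) = 1 := by
      rw [Complex.exp_sub, Complex.exp_log (hne z hz.1), hΛe z hz.1]
      exact div_self (hne z hz.1)
    have h2 : (-m : ℂ) = ((-m : ℤ) : ℂ) := by push_cast; rfl
    rw [h2, Complex.exp_int_mul, this]; simp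
  · intro z hz hzc
    have hz0 := hne z hz
    have hform : z - p = ((z.im - t : ℝ) : ℂ) * Complex.I := by
      apply Complex.ext <;> simp [hzc, hpre, hpim]
    have hne' : z.im - t ≠ 0 := by
      intro h
      rw [hform, h] at hz0; simp at hz0
    beta_reduce
    split_ifs with hlt
    · have hpos : 0 < t - z.im := by linarith
      have e1 : Complex.log (-(z - p)) = Real.log (t - z.im) + Real.pi / 2 * Complex.I := by
        rw [hform, show -(((z.im - t : ℝ) : ℂ) * Complex.I) = ((t - z.im : ℝ) : ℂ) * Complex.I by
          push_cast; ring, Complex.log_ofReal_mul hpos (by simp), Complex.log_I]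
      have e2 : Complex.log (z - p) = Real.log (t - z.im) - Real.pi / 2 * Complex.I := by
        rw [hform, show (((z.im - t : ℝ) : ℂ) * Complex.I) = ((t - z.im : ℝ) : ℂ) * -Complex.I by
          push_cast; ring, Complex.log_ofReal_mul hpos (by simp), Complex.log_neg_I]
        ring
      rw [e1, e2, hm]; ring
    · have hpos : 0 < z.im - t := by
        push Not at hlt
        exact lt_of_le_of_ne (by linarith) (Ne.symm hne')
      have e1 : Complex.log (-(z - p)) = Real.log (z.im - t) - Real.pi / 2 * Complex.I := by
        rw [hform, show -(((z.im - t : ℝ) : ℂ) * Complex.I) = ((z.im - t : ℝ) : ℂ) * -Complex.I by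
          push_cast; ring, Complex.log_ofReal_mul hpos (by simp), Complex.log_neg_I]
        ring
      have e2 : Complex.log (z - p) = Real.log (z.im - t) + Real.pi / 2 * Complex.I := by
        rw [hform, Complex.log_ofReal_mul hpos (by simp), Complex.log_I]
      rw [e1, e2, hm]; ring

lemma diffOn_of_unif {K : Set ℂ} {c δ a : ℝ} (hδ : 0 < δ) (hK : FullSet K)
    (ha : ∀ z ∈ K, a ≤ z.im) (k : ℕ) : ∀ n : ℂ → ℂ,
    (∀ z ∈ K, z.re = c → Complex.exp (n z) = 1) →
    (∀ z ∈ K, z.re = c → ∀ z' ∈ K, z'.re = c → |z.im - z'.im| < δ → n z = n z') →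
    (∃ C, Complex.exp C = 1 ∧ ∀ z ∈ K, z.re = c → a + k * (δ / 2) ≤ z.im → n z = C) →
    DiffOn K c n := by
  induction k with
  | zero =>
    rintro n hn hu ⟨C, hC, hCn⟩
    refine ⟨fun _ => C, fun _ => 0, continuousOn_const, continuousOn_const, fun _ _ => hC,
      fun _ _ => by simp, ?_⟩
    intro z hz hzc
    rw [hCn z hz hzc (by simpa using ha z hz)]; simp
  | succ k ih =>
    rintro n hn hu ⟨C, hC, hCn⟩
    push_cast at hCn
    by_cases hq : ∃ q ∈ K, q.re = c ∧ a + k * (δ/2) ≤ q.im ∧ q.im < a + (k+1) * (δ/2)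
    · obtain ⟨q, hqK, hqc, hq1, hq2⟩ := hq
      by_cases hν : n q = C
      · refine ih n hn hu ⟨C, hC, ?_⟩
        intro z hz hzc hz1
        by_cases hz2 : a + (k+1) * (δ/2) ≤ z.im
        · exact hCn z hz hzc hz2
        · rw [← hν]
          push Not at hz2
          apply hu z hz hzc q hqK hqc
          rw [abs_lt]; constructor <;> linarith
      · set t : ℝ := a + (k+1) * (δ/2) with ht
        have hp : (⟨c, t⟩ : ℂ) ∉ K := by
          intro hpK
          apply hν
          rw [← hCn _ hpK rfl le_rfl]
          apply hu _ hqK hqc _ hpK rfl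
          rw [abs_lt]; constructor <;> simp <;> linarith
        have hCν : Complex.exp (C - n q) = 1 := by
          rw [Complex.exp_sub, hC, hn q hqK hqc, div_one]
        have hnot : ∀ z ∈ K, z.re = c → ∀ z' ∈ K, z'.re = c → |z.im - z'.im| < δ →
            z.im < t → t ≤ z'.im → False := by
          intro z hz hzc z' hz' hzc' hd h1 h2
          apply hν
          rw [← hCn z' hz' hzc' h2, ← hu z hz hzc z' hz' hzc' hd]
          apply hu q hqK hqc z hz hzc
          rw [abs_lt] at hd ⊢
          constructor <;> linarith
        refine (ih (fun z => n z + if z.im < t then 0 else n q - C) ?_ ?_ ⟨n q, hn q hqK hqc, ?_⟩).add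
          (diffOn_jump hK hp hCν) ?_
        · intro z hz hzc
          rw [Complex.exp_add, hn z hz hzc]
          split_ifs
          · simp
          · rw [← neg_sub, Complex.exp_neg, hCν]; simp
        · intro z hz hzc z' hz' hzc' hd
          have h1 := hnot z hz hzc z' hz' hzc' hd
          have h2 := hnot z' hz' hzc' z hz hzc (by rwa [abs_sub_comm])
          simp only [hu z hz hzc z' hz' hzc' hd]
          congr 1
          by_cases hh : z.im < t
          · have : z'.im < t := by
              by_contra h3; exact h1 hh (not_lt.mp h3)
            simp [hh, this]
          · have : ¬ z'.im < t := by
              intro h3; exact h2 h3 (not_lt.mp hh)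
            simp [hh, this]
        · intro z hz hzc hz1
          by_cases hz2 : z.im < t
          · simp only [hz2, if_true, add_zero]
            apply hu z hz hzc q hqK hqc
            rw [abs_lt]; constructor <;> linarith
          · simp only [hz2, if_false]
            rw [hCn z hz hzc (not_lt.mp hz2)]; ring
        · intro z hz hzc
          split_ifs <;> ring
    · refine ih n hn hu ⟨C, hC, ?_⟩
      intro z hz hzc hz1
      apply hCn z hz hzc
      by_contra h
      exact hq ⟨z, hz, hzc, hz1, not_le.mp h⟩

lemma isClosed_re_le (c : ℝ) : IsClosed {z : ℂ | z.re ≤ c} :=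
  isClosed_le Complex.continuous_re continuous_const
lemma isClosed_le_re (c : ℝ) : IsClosed {z : ℂ | c ≤ z.re} :=
  isClosed_le continuous_const Complex.continuous_re
lemma isClosed_im_le (c : ℝ) : IsClosed {z : ℂ | z.im ≤ c} :=
  isClosed_le Complex.continuous_im continuous_const
lemma isClosed_le_im (c : ℝ) : IsClosed {z : ℂ | c ≤ z.im} :=
  isClosed_le continuous_const Complex.continuous_im

lemma hasLog_glue {K : Set ℂ} (hKc : IsCompact K) (hK : FullSet K) {u : ℂ → ℂ} (c : ℝ)
    (h1 : HasLog (K ∩ {z | z.re ≤ c}) u) (h2 : HasLog (K ∩ {z | c ≤ z.re}) u) : HasLog K u := by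
  obtain ⟨L1, hL1, hL1e⟩ := h1
  obtain ⟨L2, hL2, hL2e⟩ := h2
  have key : DiffOn K c (fun z => L2 z - L1 z) := by
    set Tt := K ∩ ({z | z.re ≤ c} ∩ {z : ℂ | c ≤ z.re}) with hTt
    have hTc : IsCompact Tt := hKc.inter_right ((isClosed_re_le c).inter (isClosed_le_re c))
    have hcont : ContinuousOn (fun z => L2 z - L1 z) Tt :=
      (hL2.mono (fun z hz => ⟨hz.1, hz.2.2⟩)).sub (hL1.mono (fun z hz => ⟨hz.1, hz.2.1⟩))
    have hunif := hTc.uniformContinuousOn_of_continuous hcont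
    rw [Metric.uniformContinuousOn_iff] at hunif
    obtain ⟨δ, hδ, hu⟩ := hunif 1 one_pos
    obtain ⟨R, hR⟩ := hKc.isBounded.subset_closedBall 0
    have hRb : ∀ z ∈ K, |z.im| ≤ R := fun z hz => by
      have := hR hz
      rw [mem_closedBall_zero_iff] at this
      exact (Complex.abs_im_le_norm z).trans this
    have hexp : ∀ z ∈ K, z.re = c → Complex.exp (L2 z - L1 z) = 1 := by
      intro z hz hzc
      have e2 := hL2e z ⟨hz, hzc.ge⟩
      have e1 := hL1e z ⟨hz, hzc.le⟩
      rw [Complex.exp_sub, e2, ← e1, div_self (Complex.exp_ne_zero _)]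
    obtain ⟨k, hk⟩ := exists_nat_gt ((2 * R + 1) / (δ/2))
    refine diffOn_of_unif (a := -R) hδ hK (fun z hz => (abs_le.mp (hRb z hz)).1) k _ hexp ?_
      ⟨0, by simp, ?_⟩
    · intro z hz hzc z' hz' hzc' hd
      apply exp_eq_close
      · rw [hexp z hz hzc, hexp z' hz' hzc']
      · rw [← dist_eq_norm]
        apply hu z ⟨hz, hzc.le, hzc.ge⟩ z' ⟨hz', hzc'.le, hzc'.ge⟩
        rw [Complex.dist_of_re_eq (hzc.trans hzc'.symm), Real.dist_eq]
        exact hd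
    · intro z hz hzc hz1
      exfalso
      rw [div_lt_iff₀ (by positivity)] at hk
      have := (abs_le.mp (hRb z hz)).2
      linarith
  obtain ⟨D1, D2, hD1, hD2, e1, e2, h⟩ := key
  refine ⟨fun z => if z.re ≤ c then L1 z + D1 z else L2 z + D2 z, ?_, ?_⟩
  · have hU : K = (K ∩ {z | z.re ≤ c}) ∪ (K ∩ {z | c ≤ z.re}) := by
      ext z; simp only [mem_union, mem_inter_iff, mem_ofPred_eq]
      have := le_total z.re c
      tauto
    rw [hU]
    refine ContinuousOn.union_of_isClosed ?_ ?_ (hKc.isClosed.inter (isClosed_re_le c))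
      (hKc.isClosed.inter (isClosed_le_re c))
    · refine (hL1.add hD1).congr ?_
      intro z hz
      have : z.re ≤ c := hz.2
      simp [this]
    · refine (hL2.add hD2).congr ?_
      intro z hz
      have hc : c ≤ z.re := hz.2
      by_cases hz2 : z.re ≤ c
      · simp only [hz2, if_true, Pi.add_apply]
        linear_combination h z hz.1 (le_antisymm hz2 hc)
      · simp [hz2]
  · intro z hz
    by_cases hz2 : z.re ≤ c
    · simp only [hz2, if_true]
      rw [Complex.exp_add, hL1e z ⟨hz, hz2⟩, e1 z ⟨hz, hz2⟩, mul_one]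
    · simp only [hz2, if_false]
      have := (not_le.mp hz2).le
      rw [Complex.exp_add, hL2e z ⟨hz, this⟩, e2 z ⟨hz, this⟩, mul_one]

lemma HasLog.comp {S S' : Set ℂ} {u : ℂ → ℂ} (h : HasLog S u) {g : ℂ → ℂ} (hg : Continuous g)
    (hm : ∀ z ∈ S', g z ∈ S) : HasLog S' (fun z => u (g z)) := by
  obtain ⟨L, hL, he⟩ := h
  exact ⟨fun z => L (g z), hL.comp hg.continuousOn hm, fun z hz => he _ (hm z hz)⟩

lemma hasLog_glue_im {K : Set ℂ} (hKc : IsCompact K) (hK : FullSet K) {u : ℂ → ℂ} (c : ℝ)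
    (h1 : HasLog (K ∩ {z | z.im ≤ c}) u) (h2 : HasLog (K ∩ {z | c ≤ z.im}) u) : HasLog K u := by
  set g : ℂ → ℂ := fun z => Complex.I * z with hg
  set g' : ℂ → ℂ := fun z => -Complex.I * z with hg'
  have hgc : Continuous g := by fun_prop
  have hgc' : Continuous g' := by fun_prop
  have hgg' : ∀ z, g (g' z) = z := by
    intro z; simp only [hg, hg']; linear_combination (-z) * Complex.I_mul_I
  have hg'g : ∀ z, g' (g z) = z := by
    intro z; simp only [hg, hg']; linear_combination (-z) * Complex.I_mul_I
  have hcomp : IsCompact (g ⁻¹' K) := by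
    have : g ⁻¹' K = g' '' K := by
      ext z; constructor
      · intro hz; exact ⟨g z, hz, hg'g z⟩
      · rintro ⟨w, hw, rfl⟩; simpa [hgg'] using hw
    rw [this]; exact hKc.image hgc'
  have hfull : FullSet (g ⁻¹' K) := by
    intro p hp
    have h := (hK (g p) hp).comp (S' := g ⁻¹' K) hgc (fun z hz => hz)
    refine (h.mul (hasLog_const _ (c := -Complex.I) (by simp))).congr ?_
    intro z _
    simp only [hg]
    linear_combination (z - p) * Complex.I_mul_I
  have := hasLog_glue hcomp hfull (u := fun z => u (g z)) c
    (h2 := ?_) (h1 := ?_)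
  · refine (this.comp (S' := K) hgc' (fun z hz => by simpa [hgg'] using hz)).congr ?_
    intro z _; rw [hgg']
  · exact h1.comp hgc (fun z hz => ⟨hz.1, by simpa [hg] using hz.2⟩)
  · exact h2.comp hgc (fun z hz => ⟨hz.1, by simpa [hg] using hz.2⟩)

lemma hasLog_strips_re {K : Set ℂ} (hKc : IsCompact K) (hK : FullSet K) {u : ℂ → ℂ} {h : ℝ}
    (hh : 0 < h) (hs : ∀ a, HasLog (K ∩ {z | a ≤ z.re} ∩ {z | z.re ≤ a + h}) u) : HasLog K u := by
  obtain ⟨R, hR⟩ := hKc.isBounded.subset_closedBall 0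
  have hRb : ∀ z ∈ K, |z.re| ≤ R := fun z hz => by
    have := hR hz
    rw [mem_closedBall_zero_iff] at this
    exact (Complex.abs_re_le_norm z).trans this
  have main : ∀ k : ℕ, HasLog (K ∩ {z | z.re ≤ -R + (k+1) * h}) u := by
    intro k
    induction k with
    | zero =>
      refine (hs (-R)).mono ?_
      intro z hz
      refine ⟨⟨hz.1, (abs_le.mp (hRb z hz.1)).1⟩, ?_⟩
      have := hz.2
      simpa using this
    | succ k ih =>
      refine hasLog_glue (hKc.inter_right (isClosed_re_le _)) (hK.re_le _) (-R + (k+1)*h) ?_ ?_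
      · exact ih.mono (fun z hz => ⟨hz.1.1, hz.2⟩)
      · refine (hs (-R + (k+1) * h)).mono ?_
        intro z hz
        refine ⟨⟨hz.1.1, hz.2⟩, ?_⟩
        have := hz.1.2
        simp at this ⊢; linarith
  obtain ⟨k, hk⟩ := exists_nat_gt ((2 * R) / h)
  refine (main k).mono ?_
  intro z hz
  refine ⟨hz, ?_⟩
  rw [div_lt_iff₀ hh] at hk
  have := (abs_le.mp (hRb z hz)).2
  simp; linarith

lemma hasLog_strips_im {K : Set ℂ} (hKc : IsCompact K) (hK : FullSet K) {u : ℂ → ℂ} {h : ℝ}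
    (hh : 0 < h) (hs : ∀ a, HasLog (K ∩ {z | a ≤ z.im} ∩ {z | z.im ≤ a + h}) u) : HasLog K u := by
  obtain ⟨R, hR⟩ := hKc.isBounded.subset_closedBall 0
  have hRb : ∀ z ∈ K, |z.im| ≤ R := fun z hz => by
    have := hR hz
    rw [mem_closedBall_zero_iff] at this
    exact (Complex.abs_im_le_norm z).trans this
  have main : ∀ k : ℕ, HasLog (K ∩ {z | z.im ≤ -R + (k+1) * h}) u := by
    intro k
    induction k with
    | zero =>
      refine (hs (-R)).mono ?_
      intro z hz
      refine ⟨⟨hz.1, (abs_le.mp (hRb z hz.1)).1⟩, ?_⟩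
      have := hz.2
      simpa using this
    | succ k ih =>
      refine hasLog_glue_im (hKc.inter_right (isClosed_im_le _)) (hK.im_le _) (-R + (k+1)*h) ?_ ?_
      · exact ih.mono (fun z hz => ⟨hz.1.1, hz.2⟩)
      · refine (hs (-R + (k+1) * h)).mono ?_
        intro z hz
        refine ⟨⟨hz.1.1, hz.2⟩, ?_⟩
        have := hz.1.2
        simp at this ⊢; linarith
  obtain ⟨k, hk⟩ := exists_nat_gt ((2 * R) / h)
  refine (main k).mono ?_
  intro z hz
  refine ⟨hz, ?_⟩
  rw [div_lt_iff₀ hh] at hk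
  have := (abs_le.mp (hRb z hz)).2
  simp; linarith

/-- Every nonvanishing continuous function on a full compact set has a continuous logarithm. -/
lemma FullSet.hasLog {K : Set ℂ} (hKc : IsCompact K) (hK : FullSet K) {u : ℂ → ℂ}
    (hu : ContinuousOn u K) (h0 : ∀ z ∈ K, u z ≠ 0) : HasLog K u := by
  rcases K.eq_empty_or_nonempty with rfl | hne
  · exact ⟨fun _ => 0, by simp, by simp⟩
  obtain ⟨zm, hzm, hmin⟩ := hKc.exists_isMinOn hne hu.norm
  set m := ‖u zm‖ with hm
  have hmpos : 0 < m := norm_pos_iff.mpr (h0 zm hzm)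
  have hunif := hKc.uniformContinuousOn_of_continuous hu
  rw [Metric.uniformContinuousOn_iff] at hunif
  obtain ⟨δ, hδ, hud⟩ := hunif m hmpos
  have hh : 0 < δ / 3 := by positivity
  refine hasLog_strips_im hKc hK hh (fun b => ?_)
  have hKc' := (hKc.inter_right (isClosed_le_im b)).inter_right (isClosed_im_le (b + δ / 3))
  refine hasLog_strips_re hKc' ((hK.le_im b).im_le _) hh (fun a => ?_)
  set S := K ∩ {z | b ≤ z.im} ∩ {z | z.im ≤ b + δ / 3} ∩ {z | a ≤ z.re} ∩ {z | z.re ≤ a + δ / 3}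
    with hS
  rcases S.eq_empty_or_nonempty with hSe | ⟨z0, hz0⟩
  · rw [hSe]; exact ⟨fun _ => 0, by simp, by simp⟩
  have hz0K : z0 ∈ K := hz0.1.1.1.1
  have hu0 := h0 z0 hz0K
  refine hasLog_of_re_pos' (u z0)⁻¹ (inv_ne_zero hu0) (hu.mono (fun z hz => hz.1.1.1.1)) ?_
  intro z hz
  obtain ⟨⟨⟨⟨hzK, z1⟩, z2⟩, z3⟩, z4⟩ := hz
  obtain ⟨⟨⟨⟨-, w1⟩, w2⟩, w3⟩, w4⟩ := hz0
  simp only [mem_ofPred_eq] at z1 z2 z3 z4 w1 w2 w3 w4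
  have hd : dist z z0 < δ := by
    rw [dist_eq_norm]
    refine (Complex.norm_le_abs_re_add_abs_im _).trans_lt ?_
    have h1 : |(z - z0).re| ≤ δ / 3 := by
      rw [abs_le, Complex.sub_re]; constructor <;> linarith
    have h2 : |(z - z0).im| ≤ δ / 3 := by
      rw [abs_le, Complex.sub_im]; constructor <;> linarith
    linarith
  have h1 := hud z hzK z0 hz0K hd
  have h2 : m ≤ ‖u z0‖ := hmin hz0K
  have h3 : ‖u z * (u z0)⁻¹ - 1‖ < 1 := by
    rw [show u z * (u z0)⁻¹ - 1 = (u z - u z0) / u z0 by field_simp, norm_div, div_lt_one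
      (by linarith), ← dist_eq_norm]
    linarith
  have h4 := (abs_lt.mp ((Complex.abs_re_le_norm _).trans_lt h3)).1
  simp only [Complex.sub_re, Complex.one_re] at h4
  linarith



/-! ## Part D: global logarithms on components of the complement of a closed connected set -/

def Kset (E : Set ℂ) (R δ : ℝ) : Set ℂ := closedBall 0 R ∩ {z | δ ≤ infDist z E}

lemma isCompact_Kset (E : Set ℂ) (R δ : ℝ) : IsCompact (Kset E R δ) :=
  (isCompact_closedBall 0 R).inter_right
    (isClosed_le continuous_const (continuous_infDist_pt E))

lemma fullSet_Kset {E : Set ℂ} (hE : IsPreconnected E) (hub : ¬ Bornology.IsBounded E)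
    (R : ℝ) {δ : ℝ} (hδ : 0 < δ) : FullSet (Kset E R δ) := by
  set K := Kset E R δ with hK
  have hEne : E.Nonempty := by
    by_contra h
    rw [not_nonempty_iff_eq_empty] at h
    rw [h] at hub
    exact hub Bornology.isBounded_empty
  have hbig : ∀ p : ℂ, R < ‖p‖ → HasLog K (fun z => z - p) := by
    intro p hp
    rcases K.eq_empty_or_nonempty with h | ⟨z0, hz0⟩
    · rw [h]; exact ⟨fun _ => 0, by simp, by simp⟩
    have hp0 : p ≠ 0 := by
      rintro rfl
      have := mem_closedBall_zero_iff.mp hz0.1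
      simp at hp
      linarith [norm_nonneg z0]
    refine hasLog_of_re_pos' (-p⁻¹) (by simpa using hp0) (by fun_prop) ?_
    intro z hz
    have hz1 := mem_closedBall_zero_iff.mp hz.1
    have e : (z - p) * -p⁻¹ = 1 - z / p := by field_simp; ring
    rw [e]
    have : ‖z / p‖ < 1 := by
      rw [norm_div, div_lt_one (norm_pos_iff.mpr hp0)]; linarith
    have := (abs_lt.mp ((Complex.abs_re_le_norm _).trans_lt this)).2
    simp only [Complex.sub_re, Complex.one_re]; linarith
  have hstep : ∀ q ∈ E, ∀ p : ℂ, dist p q < δ → HasLog K (fun z => z - q) →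
      HasLog K (fun z => z - p) := by
    intro q hq p hd h
    have hfar : ∀ z ∈ K, δ ≤ ‖z - q‖ := by
      intro z hz
      rw [← dist_eq_norm]
      exact le_trans hz.2 (infDist_le_dist_of_mem hq)
    have h0 : ∀ z ∈ K, z - q ≠ 0 := fun z hz => norm_pos_iff.mp (hδ.trans_le (hfar z hz))
    have h2 : HasLog K (fun z => 1 + (q - p) / (z - q)) := by
      apply hasLog_of_re_pos
      · exact continuousOn_const.add (continuousOn_const.div (by fun_prop) h0)
      · intro z hz
        have : ‖(q - p) / (z - q)‖ < 1 := by
          rw [norm_div, div_lt_one (norm_pos_iff.mpr (h0 z hz))]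
          rw [dist_comm, dist_eq_norm] at hd
          linarith [hfar z hz]
        have := (abs_lt.mp ((Complex.abs_re_le_norm _).trans_lt this)).1
        simp only [Complex.add_re, Complex.one_re]; linarith
    refine (h.mul h2).congr ?_
    intro z hz
    have := h0 z hz
    field_simp; ring
  have hallE : ∀ q ∈ E, HasLog K (fun z => z - q) := by
    intro q hq
    obtain ⟨q0, hq0E, hq0⟩ : ∃ q0 ∈ E, R < ‖q0‖ := by
      by_contra h
      push Not at h
      exact hub ((isBounded_closedBall (x := (0:ℂ)) (r := R)).subset
        (fun z hz => by simpa using h z hz))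
    have := hE.induction₂ (fun x y => HasLog K (fun z => z - x) ↔ HasLog K (fun z => z - y))
      (fun x hx => ?_) (fun x y z _ _ _ h1 h2 => h1.trans h2)
      (fun x y _ _ h => h.symm) hq0E hq
    · exact this.mp (hbig q0 hq0)
    · filter_upwards [inter_mem_nhdsWithin E (ball_mem_nhds x hδ)] with y hy
      exact ⟨hstep x hx y hy.2, hstep y hy.1 x (by rw [dist_comm]; exact hy.2)⟩
  intro p hp
  by_cases h1 : R < ‖p‖
  · exact hbig p h1
  · have h2 : infDist p E < δ := by
      by_contra h
      exact hp ⟨by simpa using h1, not_lt.mp h⟩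
    obtain ⟨q, hqE, hq⟩ := (infDist_lt_iff hEne).mp h2
    exact hstep q hqE p hq (hallE q hqE)

lemma compact_subset_Kset {E : Set ℂ} (hEc : IsClosed E) (hne : E.Nonempty) {C : Set ℂ}
    (hC : IsCompact C) (hCE : C ⊆ Eᶜ) : ∃ n : ℕ, C ⊆ Kset E n (1 / (n + 1)) := by
  rcases C.eq_empty_or_nonempty with rfl | hCne
  · exact ⟨0, by simp⟩
  obtain ⟨zm, hzm, hmin⟩ := hC.exists_isMinOn hCne (continuous_infDist_pt E).continuousOn
  have hpos : 0 < infDist zm E := (hEc.notMem_iff_infDist_pos hne).mp (hCE hzm)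
  obtain ⟨n1, hn1⟩ := exists_nat_one_div_lt hpos
  obtain ⟨R, hR⟩ := hC.isBounded.subset_closedBall 0
  obtain ⟨n2, hn2⟩ := exists_nat_ge R
  refine ⟨max n1 n2, fun z hz => ⟨?_, ?_⟩⟩
  · apply closedBall_subset_closedBall _ (hR hz)
    refine hn2.trans ?_
    exact_mod_cast le_max_right _ _
  · have hh : infDist zm E ≤ infDist z E := hmin hz
    rw [mem_ofPred_eq]
    refine le_trans ?_ hh
    refine le_trans ?_ hn1.le
    apply one_div_le_one_div_of_le (by positivity)
    have : (n1 : ℝ) ≤ (max n1 n2 : ℕ) := by exact_mod_cast le_max_left _ _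
    linarith

lemma Kset_mono (E : Set ℂ) {n m : ℕ} (h : n ≤ m) :
    Kset E n (1 / (n + 1)) ⊆ Kset E m (1 / (m + 1)) := by
  have h' : (n : ℝ) ≤ m := by exact_mod_cast h
  rintro z ⟨h1, h2⟩
  rw [mem_ofPred_eq] at h2
  refine ⟨closedBall_subset_closedBall h' h1, ?_⟩
  rw [mem_ofPred_eq]
  refine le_trans ?_ h2
  apply one_div_le_one_div_of_le (by positivity); linarith

lemma hasLog_component {E : Set ℂ} (hEc : IsClosed E) (hE : IsPreconnected E)
    (hub : ¬ Bornology.IsBounded E) (h0E : (0:ℂ) ∉ E) {u : ℂ → ℂ}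
    (hu : ContinuousOn u (connectedComponentIn Eᶜ 0))
    (hu0 : ∀ z ∈ connectedComponentIn Eᶜ 0, u z ≠ 0) :
    HasLog (connectedComponentIn Eᶜ 0) u := by
  classical
  set W := connectedComponentIn Eᶜ 0 with hW
  have hEne : E.Nonempty := by
    by_contra h
    rw [not_nonempty_iff_eq_empty] at h
    rw [h] at hub
    exact hub Bornology.isBounded_empty
  have hWo : IsOpen W := hEc.isOpen_compl.connectedComponentIn
  have hWs : W ⊆ Eᶜ := connectedComponentIn_subset _ _
  have h0W : (0:ℂ) ∈ W := mem_connectedComponentIn h0E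
  have hWc : IsConnected W := isConnected_connectedComponentIn_iff.mpr h0E
  have hWp : IsPathConnected W := (hWo.isConnected_iff_isPathConnected).mp hWc
  have hWcl : closure W ∩ Eᶜ ⊆ W := by
    rintro z ⟨hz, hzE⟩
    have hp : IsPreconnected (insert z W) :=
      hWc.isPreconnected.subset_closure (subset_insert _ _)
        (insert_subset hz subset_closure)
    exact hp.subset_connectedComponentIn (mem_insert_of_mem _ h0W)
      (insert_subset hzE hWs) (mem_insert _ _)
  -- extension by one
  set u' : ℂ → ℂ := fun z => if z ∈ W then u z else 1 with hu'
  have hu'c : ContinuousOn u' Eᶜ := by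
    intro z hz
    apply ContinuousAt.continuousWithinAt
    by_cases hzW : z ∈ W
    · refine ((hu z hzW).continuousAt (hWo.mem_nhds hzW)).congr ?_
      filter_upwards [hWo.mem_nhds hzW] with y hy
      simp [hu', hy]
    · have hzc : z ∉ closure W := fun h => hzW (hWcl ⟨h, hz⟩)
      refine (continuousAt_const (y := (1:ℂ))).congr ?_
      filter_upwards [isClosed_closure.isOpen_compl.mem_nhds hzc] with y hy
      have : y ∉ W := fun h => hy (subset_closure h)
      simp [hu', this]
  have hu'0 : ∀ z, u' z ≠ 0 := by
    intro z
    by_cases h : z ∈ W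
    · simpa [hu', h] using hu0 z h
    · simp [hu', h]
  set K : ℕ → Set ℂ := fun n => Kset E n (1 / (n + 1)) with hK
  have hKE : ∀ n, K n ⊆ Eᶜ := by
    intro n z hz hzE
    have h1 := hz.2
    have h2 : infDist z E = 0 := infDist_zero_of_mem hzE
    simp only [mem_ofPred_eq, h2] at h1
    have : (0:ℝ) < 1 / ((n:ℝ) + 1) := by positivity
    linarith
  have hlog : ∀ n, HasLog (K n) u' := fun n =>
    (fullSet_Kset hE hub n (by positivity)).hasLog (isCompact_Kset _ _ _)
      (hu'c.mono (hKE n)) (fun z _ => hu'0 z)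
  choose Ln hLn hLne using hlog
  set M : ℕ → ℂ → ℂ := fun n z => Ln n z - Ln n 0 + Complex.log (u 0) with hM
  have hMc : ∀ n, ContinuousOn (M n) (K n) := fun n =>
    ((hLn n).sub continuousOn_const).add continuousOn_const
  set Good : ℕ → ℂ → Prop := fun n z => ∃ C, IsPreconnected C ∧ 0 ∈ C ∧ z ∈ C ∧ C ⊆ K n ∧ C ⊆ W
    with hGood
  have hGmono : ∀ n m z, n ≤ m → Good n z → Good m z := by
    rintro n m z h ⟨C, h1, h2, h3, h4, h5⟩
    exact ⟨C, h1, h2, h3, h4.trans (Kset_mono E h), h5⟩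
  have hGle : ∀ n m z, n ≤ m → Good n z → M n z = M m z := by
    rintro n m z h ⟨C, h1, h2, h3, h4, h5⟩
    have := log_diff_const h1 (g := Ln n) (h := Ln m) ((hLn n).mono h4)
      ((hLn m).mono (h4.trans (Kset_mono E h)))
      (fun x hx => by rw [hLne n x (h4 hx), hLne m x (Kset_mono E h (h4 hx))]) h2 h3
    simp only [hM]
    linear_combination -this
  have hGeq : ∀ n m z, Good n z → Good m z → M n z = M m z := by
    intro n m z h1 h2
    rw [hGle n (max n m) z (le_max_left _ _) h1, hGle m (max n m) z (le_max_right _ _) h2]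
  have hloc : ∀ z ∈ W, ∃ n, ∀ᶠ y in 𝓝 z, Good n y ∧ y ∈ K n := by
    intro z hz
    obtain ⟨ε, hε, hball⟩ := nhds_basis_closedBall.mem_iff.mp (hWo.mem_nhds hz)
    obtain ⟨γ, hγ⟩ := hWp.joinedIn 0 h0W z hz
    set C : Set ℂ := range γ ∪ closedBall z ε with hC
    have hCW : C ⊆ W := union_subset (by rintro _ ⟨t, rfl⟩; exact hγ t) hball
    have hCc : IsCompact C := (isCompact_range γ.continuous).union (isCompact_closedBall z ε)
    have hCp : IsPreconnected C := (isPreconnected_range γ.continuous).union z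
      ⟨1, γ.target⟩ (mem_closedBall_self hε.le) (convex_closedBall z ε).isPreconnected
    obtain ⟨n, hn⟩ := compact_subset_Kset hEc hEne hCc (hCW.trans hWs)
    refine ⟨n, ?_⟩
    filter_upwards [closedBall_mem_nhds z hε] with y hy
    exact ⟨⟨C, hCp, Or.inl ⟨0, γ.source⟩, Or.inr hy, hn, hCW⟩, hn (Or.inr hy)⟩
  have hex : ∀ z, ∃ n, z ∈ W → Good n z := by
    intro z
    by_cases hz : z ∈ W
    · obtain ⟨n, hn⟩ := hloc z hz
      exact ⟨n, fun _ => hn.self_of_nhds.1⟩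
    · exact ⟨0, fun h => absurd h hz⟩
  choose N hN using hex
  refine ⟨fun z => M (N z) z, ?_, ?_⟩
  · intro z hz
    obtain ⟨n, hn⟩ := hloc z hz
    apply ContinuousAt.continuousWithinAt
    have h1 : ContinuousAt (M n) z := by
      apply (hMc n).continuousAt
      filter_upwards [hn] with y hy using hy.2
    refine h1.congr ?_
    filter_upwards [hn, hWo.mem_nhds hz] with y hy hyW
    exact hGeq _ _ _ hy.1 (hN y hyW)
  · intro z hz
    obtain ⟨C, h1, h2, h3, h4, h5⟩ := hN z hz
    simp only [hM]
    rw [Complex.exp_add, Complex.exp_sub, hLne _ _ (h4 h3), hLne _ _ (h4 h2),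
      Complex.exp_log (hu0 0 h0W)]
    simp only [hu', if_pos hz, if_pos h0W]
    have := hu0 0 h0W
    field_simp

lemma holo_sqrt_of_hasLog {W : Set ℂ} (hWo : IsOpen W) {u : ℂ → ℂ} (hu : DifferentiableOn ℂ u W)
    (hL : HasLog W u) : ∃ s : ℂ → ℂ, DifferentiableOn ℂ s W ∧ ∀ z ∈ W, s z ^ 2 = u z := by
  obtain ⟨L, hLc, hLe⟩ := hL
  set s : ℂ → ℂ := fun z => Complex.exp (L z / 2) with hs
  have hsq : ∀ z ∈ W, s z ^ 2 = u z := by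
    intro z hz
    rw [← hLe z hz, hs, ← Complex.exp_nat_mul]; congr 1; push_cast; ring
  have hsc : ContinuousOn s W := (hLc.div_const 2).cexp
  refine ⟨s, ?_, hsq⟩
  intro z hz
  apply DifferentiableAt.differentiableWithinAt
  have hd := ((hu z hz).differentiableAt (hWo.mem_nhds hz)).hasDerivAt
  have hs0 : ∀ y, s y ≠ 0 := fun y => Complex.exp_ne_zero _
  suffices h : HasDerivAt s (deriv u z / (s z + s z)) z from h.differentiableAt
  rw [hasDerivAt_iff_tendsto_slope] at hd ⊢
  have hct : ContinuousAt s z := hsc.continuousAt (hWo.mem_nhds hz)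
  have hlim : Tendsto (fun y => slope u z y / (s y + s z)) (𝓝[≠] z) (𝓝 (deriv u z / (s z + s z))) := by
    apply hd.div
    · exact (hct.tendsto.mono_left nhdsWithin_le_nhds).add tendsto_const_nhds
    · rw [← two_mul]; exact mul_ne_zero two_ne_zero (hs0 z)
  refine hlim.congr' ?_
  have hne : ∀ᶠ y in 𝓝 z, s y + s z ≠ 0 := by
    have : ContinuousAt (fun y => s y + s z) z := hct.add continuousAt_const
    apply this.eventually_ne
    rw [← two_mul]; exact mul_ne_zero two_ne_zero (hs0 z)
  filter_upwards [nhdsWithin_le_nhds (hWo.mem_nhds hz), nhdsWithin_le_nhds hne,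
    self_mem_nhdsWithin] with y hy h1 h2
  have h3 : y - z ≠ 0 := sub_ne_zero.mpr h2
  rw [slope_def_field, slope_def_field, ← hsq y hy, ← hsq z hz]
  field_simp
  ring



/-! ## Part E: the Riemann mapping theorem -/

/-- Moebius transformation of the disc -/
noncomputable def mob (w z : ℂ) : ℂ := (z - w) / (1 - (starRingEnd ℂ) w * z)

lemma mob_den_ne {w z : ℂ} (hw : ‖w‖ < 1) (hz : ‖z‖ < 1) : 1 - (starRingEnd ℂ) w * z ≠ 0 := by
  intro h
  have h1 : (starRingEnd ℂ) w * z = 1 := by linear_combination -h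
  have h2 : ‖w‖ * ‖z‖ = 1 := by
    have := congrArg norm h1
    simpa using this
  nlinarith [norm_nonneg w, norm_nonneg z]

lemma mob_norm_lt {w z : ℂ} (hw : ‖w‖ < 1) (hz : ‖z‖ < 1) : ‖mob w z‖ < 1 := by
  have hd := mob_den_ne hw hz
  rw [mob, norm_div, div_lt_one (norm_pos_iff.mpr hd)]
  apply lt_of_pow_lt_pow_left₀ 2 (norm_nonneg _)
  have e : ‖1 - (starRingEnd ℂ) w * z‖ ^ 2 - ‖z - w‖ ^ 2 = (1 - ‖w‖^2) * (1 - ‖z‖^2) := by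
    simp only [← Complex.normSq_eq_norm_sq, Complex.normSq_apply]
    simp
    ring
  have h1 : 0 < 1 - ‖w‖^2 := by nlinarith [norm_nonneg w]
  have h2 : 0 < 1 - ‖z‖^2 := by nlinarith [norm_nonneg z]
  nlinarith [mul_pos h1 h2]

lemma mob_inj {w z z' : ℂ} (hw : ‖w‖ < 1) (hz : ‖z‖ < 1) (hz' : ‖z'‖ < 1)
    (h : mob w z = mob w z') : z = z' := by
  rw [mob, mob, div_eq_div_iff (mob_den_ne hw hz) (mob_den_ne hw hz')] at h
  have h2 : (1 - (starRingEnd ℂ) w * w) * (z - z') = 0 := by linear_combination h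
  rcases mul_eq_zero.mp h2 with h3 | h3
  · exact absurd h3 (mob_den_ne hw hw)
  · exact sub_eq_zero.mp h3

lemma mob_hasDerivAt {w z : ℂ} (hw : ‖w‖ < 1) (hz : ‖z‖ < 1) :
    HasDerivAt (mob w) ((1 - (starRingEnd ℂ) w * w) / (1 - (starRingEnd ℂ) w * z) ^ 2) z := by
  have hd := mob_den_ne hw hz
  have h1 : HasDerivAt (fun z => z - w) 1 z := (hasDerivAt_id z).sub_const w
  have h2 : HasDerivAt (fun z => 1 - (starRingEnd ℂ) w * z) (-((starRingEnd ℂ) w * 1)) z :=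
    ((hasDerivAt_id z).const_mul _).const_sub 1
  have := h1.div h2 hd
  refine this.congr_deriv ?_
  congr 1
  ring

lemma mob_zero (w : ℂ) : mob w 0 = -w := by simp [mob]
lemma mob_self (w : ℂ) : mob w w = 0 := by simp [mob]

/-- the family used in the Riemann mapping theorem -/
structure RFam (W : Set ℂ) (F : ℂ → ℂ) : Prop where
  diff : DifferentiableOn ℂ F W
  inj : InjOn F W
  maps : MapsTo F W (ball 0 1)
  zero : F 0 = 0

lemma rfam_equi {W : Set ℂ} {F : ℂ → ℂ} (hF : RFam W F) {z0 : ℂ} {r : ℝ} (hr : 0 < r)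
    (hb : ball z0 r ⊆ W) {z : ℂ} (hz : z ∈ ball z0 r) :
    dist (F z) (F z0) ≤ 2 / r * dist z z0 := by
  refine Complex.dist_le_div_mul_dist_of_mapsTo_ball (hF.diff.mono hb) ?_ hz
  intro y hy
  have h1 := mem_ball_zero_iff.mp (hF.maps (hb hy))
  have h2 := mem_ball_zero_iff.mp (hF.maps (hb (mem_ball_self hr)))
  rw [mem_closedBall, dist_eq_norm]
  linarith [norm_sub_le (F y) (F z0)]

lemma rfam_deriv_bound {W : Set ℂ} {r : ℝ} (hr : 0 < r) (hb : ball 0 r ⊆ W) {F : ℂ → ℂ}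
    (hF : RFam W F) : ‖deriv F 0‖ ≤ 1 / r := by
  refine Complex.norm_deriv_le_div_of_mapsTo_ball (hF.diff.mono hb) ?_ hr
  intro y hy
  rw [hF.zero]
  exact ball_subset_closedBall (hF.maps (hb hy))

lemma rfam_limit {W : Set ℂ} (hWo : IsOpen W) (hWc : IsPreconnected W) (h0 : (0:ℂ) ∈ W)
    {F : ℕ → ℂ → ℂ} (hF : ∀ n, RFam W (F n)) {s : ℝ} (hs : 0 < s)
    (hlim : Tendsto (fun n => ‖deriv (F n) 0‖) atTop (𝓝 s)) :
    ∃ G, RFam W G ∧ ‖deriv G 0‖ = s := by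
  set U : Ultrafilter ℕ := hyperfilter ℕ with hU
  have hUle : (U : Filter ℕ) ≤ atTop := Nat.hyperfilter_le_atTop
  have hex : ∀ z, ∃ g, z ∈ W → ‖g‖ ≤ 1 ∧ Tendsto (fun n => F n z) U (𝓝 g) := by
    intro z
    by_cases hz : z ∈ W
    · have := (isCompact_closedBall (0:ℂ) 1).ultrafilter_le_nhds (U.map (fun n => F n z))
        (by
          rw [Ultrafilter.coe_map, le_principal_iff, mem_map]
          exact Filter.univ_mem' fun n => ball_subset_closedBall ((hF n).maps hz))
      obtain ⟨g, hg, hg2⟩ := this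
      exact ⟨g, fun _ => ⟨by simpa using hg, hg2⟩⟩
    · exact ⟨0, fun h => absurd h hz⟩
  choose G hG using hex
  have hequiG : ∀ z0 r, 0 < r → ball z0 r ⊆ W → ∀ z ∈ ball z0 r,
      dist (G z) (G z0) ≤ 2 / r * dist z z0 := by
    intro z0 r hr hb z hz
    have h1 := ((hG z (hb hz)).2).dist ((hG z0 (hb (mem_ball_self hr))).2)
    exact le_of_tendsto h1 (Eventually.of_forall fun n => rfam_equi (hF n) hr hb hz)
  have hloc : TendstoLocallyUniformlyOn F G U W := by
    rw [Metric.tendstoLocallyUniformlyOn_iff]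
    intro ε hε z0 hz0
    obtain ⟨r, hr, hb⟩ := Metric.isOpen_iff.mp hWo z0 hz0
    have hη : 0 < min r (ε * r / 6) := lt_min hr (by positivity)
    refine ⟨ball z0 (min r (ε * r / 6)), mem_nhdsWithin_of_mem_nhds (ball_mem_nhds z0 hη), ?_⟩
    have h1 := (hG z0 hz0).2
    rw [Metric.tendsto_nhds] at h1
    filter_upwards [h1 (ε/3) (by positivity)] with n hn y hy
    have hyr : y ∈ ball z0 r := ball_subset_ball (min_le_left _ _) hy
    have hy2 : dist y z0 < ε * r / 6 := lt_of_lt_of_le hy (min_le_right _ _)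
    have e1 := hequiG z0 r hr hb y hyr
    have e2 := rfam_equi (hF n) hr hb hyr
    have e3 : 2 / r * dist y z0 < ε / 3 := by
      calc 2 / r * dist y z0 < 2 / r * (ε * r / 6) := by gcongr
        _ = ε / 3 := by field_simp; norm_num
    have t1 := dist_triangle (G y) (G z0) (F n y)
    have t2 := dist_triangle (G z0) (F n z0) (F n y)
    rw [dist_comm] at hn
    rw [dist_comm (F n y)] at e2
    linarith
  have hFd : ∀ᶠ n in (U : Filter ℕ), DifferentiableOn ℂ (F n) W :=
    Eventually.of_forall fun n => (hF n).diff
  have hGd : DifferentiableOn ℂ G W := hloc.differentiableOn hFd hWo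
  have hderiv : ‖deriv G 0‖ = s := by
    have h1 := ((hloc.deriv hFd hWo).tendsto_at h0).norm
    exact tendsto_nhds_unique h1 (hlim.mono_left hUle)
  have hG0 : G 0 = 0 := by
    have h1 := (hG 0 h0).2
    simp only [(hF _).zero] at h1
    exact tendsto_nhds_unique h1 tendsto_const_nhds
  have hGan : AnalyticOnNhd ℂ G W := hGd.analyticOnNhd hWo
  have hnc : ¬ ∃ w, ∀ z ∈ W, G z = w := by
    rintro ⟨w, hw⟩
    have : deriv G 0 = 0 := by
      have h1 : G =ᶠ[𝓝 0] fun _ => w := by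
        filter_upwards [hWo.mem_nhds h0] with z hz using hw z hz
      rw [h1.deriv_eq]; simp
    rw [this] at hderiv
    simp at hderiv; linarith
  refine ⟨G, ⟨hGd, ?_, ?_, hG0⟩, hderiv⟩
  · intro a ha b hb hab
    by_contra hne
    have hev : ∀ᶠ z in 𝓝[≠] b, G z ≠ G b := by
      rcases (hGan b hb).eventually_eq_or_eventually_ne (analyticAt_const (v := G b)) with h | h
      · exact absurd ⟨G b, hGan.eqOn_of_preconnected_of_eventuallyEq analyticOnNhd_const hWc hb h⟩ hnc
      · exact h
    rw [eventually_nhdsWithin_iff, Metric.eventually_nhds_iff_ball] at hev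
    obtain ⟨r1, hr1, hr1b⟩ := hev
    obtain ⟨r2, hr2, hr2b⟩ := Metric.isOpen_iff.mp hWo b hb
    have hdab : 0 < dist a b := dist_pos.mpr hne
    set r := min (min r1 r2) (dist a b) / 2 with hr
    have hrpos : 0 < r := by positivity
    have hrr1 : r < r1 := by
      have : min (min r1 r2) (dist a b) ≤ r1 := (min_le_left _ _).trans (min_le_left _ _)
      linarith
    have hrr2 : r < r2 := by
      have : min (min r1 r2) (dist a b) ≤ r2 := (min_le_left _ _).trans (min_le_right _ _)
      linarith
    have hrd : r < dist a b := by
      have : min (min r1 r2) (dist a b) ≤ dist a b := min_le_right _ _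
      linarith
    have hcbW : closedBall b r ⊆ W := (closedBall_subset_ball hrr2).trans hr2b
    have hsne : (sphere b r).Nonempty := NormedSpace.sphere_nonempty.mpr hrpos.le
    obtain ⟨zm, hzm, hmin⟩ := (isCompact_sphere b r).exists_isMinOn hsne
      (f := fun z => ‖G z - G b‖)
      (((hGd.continuousOn.mono (sphere_subset_closedBall.trans hcbW)).sub continuousOn_const).norm)
    set ε := ‖G zm - G b‖ with hε
    have hεpos : 0 < ε := by
      apply norm_pos_iff.mpr
      apply sub_ne_zero.mpr
      apply hr1b zm
      · rw [mem_ball, mem_sphere.mp hzm]; exact hrr1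
      · rintro rfl
        simp at hzm; linarith
    have hunif : TendstoUniformlyOn F G U (closedBall b r) :=
      (tendstoLocallyUniformlyOn_iff_forall_isCompact hWo).mp hloc _ hcbW (isCompact_closedBall b r)
    rw [Metric.tendstoUniformlyOn_iff] at hunif
    have ha' := Metric.tendsto_nhds.mp (hG a ha).2
    obtain ⟨n, hn1, hn2⟩ := ((hunif (ε/8) (by positivity)).and (ha' (ε/8) (by positivity))).exists
    have hnb := hn1 b (mem_closedBall_self hrpos.le)
    have hsub : ball (F n b) (3 * ε / 4 / 2) ⊆ F n '' closedBall b r := by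
      apply DiffContOnCl.ball_subset_image_closedBall _ hrpos
      · intro z hz
        have h1 := hn1 z (sphere_subset_closedBall hz)
        have h2 : ε ≤ ‖G z - G b‖ := hmin hz
        rw [← dist_eq_norm] at h2 ⊢
        have t1 := dist_triangle (G z) (F n z) (G b)
        have t2 := dist_triangle (F n z) (F n b) (G b)
        rw [dist_comm] at hnb
        linarith
      · have hev2 : ∀ᶠ z in 𝓝[≠] b, F n z ≠ F n b := by
          filter_upwards [self_mem_nhdsWithin, nhdsWithin_le_nhds (hWo.mem_nhds hb)] with z hz hzW h
          exact hz ((hF n).inj hzW hb h)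
        exact (hev2.frequently).filter_mono nhdsWithin_le_nhds
      · apply DifferentiableOn.diffContOnCl
        rw [closure_ball b hrpos.ne']
        exact (hF n).diff.mono hcbW
    have hmem : F n a ∈ ball (F n b) (3 * ε / 4 / 2) := by
      rw [mem_ball]
      have t1 := dist_triangle (F n a) (G a) (F n b)
      rw [hab] at t1 hn2
      linarith
    obtain ⟨y, hy, hya⟩ := hsub hmem
    have : y = a := (hF n).inj (hcbW hy) ha hya
    rw [this, mem_closedBall] at hy
    linarith
  · intro z hz
    have hopen := ((hGan.is_constant_or_isOpen hWc).resolve_left hnc) W le_rfl hWo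
    have hsub : G '' W ⊆ closedBall 0 1 := by
      rintro _ ⟨y, hy, rfl⟩
      simpa using (hG y hy).1
    have := interior_maximal hsub hopen
    rw [interior_closedBall _ one_ne_zero] at this
    exact this ⟨z, hz, rfl⟩

lemma rfam_improve {W : Set ℂ} (hWo : IsOpen W) (h0 : (0:ℂ) ∈ W)
    (hsqrt : ∀ u : ℂ → ℂ, DifferentiableOn ℂ u W → (∀ z ∈ W, u z ≠ 0) →
      ∃ s : ℂ → ℂ, DifferentiableOn ℂ s W ∧ ∀ z ∈ W, s z ^ 2 = u z)
    {G : ℂ → ℂ} (hG : RFam W G) (hd : deriv G 0 ≠ 0) {w : ℂ} (hw : w ∈ ball (0:ℂ) 1)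
    (hwG : w ∉ G '' W) : ∃ H, RFam W H ∧ ‖deriv G 0‖ < ‖deriv H 0‖ := by
  have hw1 : ‖w‖ < 1 := mem_ball_zero_iff.mp hw
  have hGn : ∀ z ∈ W, ‖G z‖ < 1 := fun z hz => mem_ball_zero_iff.mp (hG.maps hz)
  have hGd : ∀ z ∈ W, HasDerivAt G (deriv G z) z := fun z hz =>
    ((hG.diff z hz).differentiableAt (hWo.mem_nhds hz)).hasDerivAt
  have hu : ∀ z ∈ W, HasDerivAt (fun y => mob w (G y)) _ z := fun z hz =>
    (mob_hasDerivAt hw1 (hGn z hz)).comp z (hGd z hz)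
  have hune : ∀ z ∈ W, mob w (G z) ≠ 0 := by
    intro z hz h
    apply hwG
    refine ⟨z, hz, ?_⟩
    rw [← mob_self w] at h
    exact mob_inj hw1 (hGn z hz) hw1 h
  obtain ⟨s, hsd, hs2⟩ := hsqrt _ (fun z hz => (hu z hz).differentiableAt.differentiableWithinAt) hune
  have hsn : ∀ z ∈ W, ‖s z‖ < 1 := by
    intro z hz
    have h1 := mob_norm_lt hw1 (hGn z hz)
    rw [← hs2 z hz, norm_pow] at h1
    exact (sq_lt_one_iff₀ (norm_nonneg _)).mp h1
  set b := s 0 with hb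
  have hb1 : ‖b‖ < 1 := hsn 0 h0
  have hb2 : b ^ 2 = -w := by rw [hb, hs2 0 h0, hG.zero, mob_zero]
  have hw0 : w ≠ 0 := by
    rintro rfl
    exact hwG ⟨0, h0, hG.zero⟩
  have hb0 : b ≠ 0 := by
    intro h
    rw [h] at hb2
    apply hw0
    linear_combination hb2
  have hsd' : ∀ z ∈ W, HasDerivAt s (deriv s z) z := fun z hz =>
    ((hsd z hz).differentiableAt (hWo.mem_nhds hz)).hasDerivAt
  have hH : ∀ z ∈ W, HasDerivAt (fun y => mob b (s y)) _ z := fun z hz =>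
    (mob_hasDerivAt hb1 (hsn z hz)).comp z (hsd' z hz)
  refine ⟨fun y => mob b (s y), ⟨fun z hz => (hH z hz).differentiableAt.differentiableWithinAt,
    ?_, ?_, ?_⟩, ?_⟩
  · intro x hx y hy hxy
    have h1 := mob_inj hb1 (hsn x hx) (hsn y hy) hxy
    have h2 : mob w (G x) = mob w (G y) := by rw [← hs2 x hx, ← hs2 y hy, h1]
    exact hG.inj hx hy (mob_inj hw1 (hGn x hx) (hGn y hy) h2)
  · intro z hz
    exact mem_ball_zero_iff.mpr (mob_norm_lt hb1 (hsn z hz))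
  · exact mob_self b
  · have e1 : (2 * b) * deriv s 0 = (1 - (starRingEnd ℂ) w * w) * deriv G 0 := by
      have h1 := (hu 0 h0)
      have h2 : HasDerivAt (fun y => s y ^ 2) _ 0 := (hsd' 0 h0).pow 2
      have h3 : (fun y => s y ^ 2) =ᶠ[𝓝 0] (fun y => mob w (G y)) := by
        filter_upwards [hWo.mem_nhds h0] with z hz using hs2 z hz
      have h4 := (h2.congr_of_eventuallyEq h3.symm).unique h1
      simp [hG.zero] at h4
      rw [← hb] at h4
      exact h4
    have e2 : deriv (fun y => mob b (s y)) 0 * (1 - (starRingEnd ℂ) b * b) = deriv s 0 := by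
      rw [(hH 0 h0).deriv, ← hb]
      have := mob_den_ne hb1 hb1
      field_simp
    have nb : ‖(1 - (starRingEnd ℂ) b * b)‖ = 1 - ‖b‖^2 := by
      rw [← Complex.normSq_eq_conj_mul_self, ← Complex.ofReal_one, ← Complex.ofReal_sub,
        Complex.norm_real, Complex.normSq_eq_norm_sq, Real.norm_eq_abs, abs_of_nonneg]
      nlinarith [norm_nonneg b]
    have nw : ‖(1 - (starRingEnd ℂ) w * w)‖ = 1 - ‖w‖^2 := by
      rw [← Complex.normSq_eq_conj_mul_self, ← Complex.ofReal_one, ← Complex.ofReal_sub,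
        Complex.norm_real, Complex.normSq_eq_norm_sq, Real.norm_eq_abs, abs_of_nonneg]
      nlinarith [norm_nonneg w]
    have nwb : ‖w‖ = ‖b‖^2 := by rw [← norm_pow, hb2, norm_neg]
    have n1 := congrArg norm e1
    have n2 := congrArg norm e2
    simp only [norm_mul] at n1 n2
    rw [nw, nwb] at n1
    rw [nb] at n2
    set D := ‖deriv (fun y => mob b (s y)) 0‖ with hD
    set g := ‖deriv G 0‖ with hg
    have hgpos : 0 < g := norm_pos_iff.mpr hd
    have hβ : 0 < ‖b‖ := norm_pos_iff.mpr hb0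
    set β := ‖b‖ with hβdef
    rw [← n2] at n1
    simp at n1
    have hfac : 0 < 1 - β^2 := by nlinarith
    have n3 : 2 * β * D = (1 + β^2) * g := by
      have : (1 - β^2) * (2 * β * D - (1 + β^2) * g) = 0 := by linear_combination n1
      rcases mul_eq_zero.mp this with h | h
      · linarith
      · linarith
    have h5 : 0 < (1 - β)^2 := by
      have : 0 < 1 - β := by linarith
      positivity
    by_contra hcon
    push Not at hcon
    nlinarith [mul_le_mul_of_nonneg_left hcon hβ.le, mul_pos h5 hgpos]

/-- Riemann mapping theorem for bounded domains on which square roots exist -/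
lemma riemann_map {W : Set ℂ} (hWo : IsOpen W) (hWc : IsPreconnected W) (h0 : (0:ℂ) ∈ W)
    (hWb : Bornology.IsBounded W)
    (hsqrt : ∀ u : ℂ → ℂ, DifferentiableOn ℂ u W → (∀ z ∈ W, u z ≠ 0) →
      ∃ s : ℂ → ℂ, DifferentiableOn ℂ s W ∧ ∀ z ∈ W, s z ^ 2 = u z) :
    ∃ G : ℂ → ℂ, RFam W G ∧ G '' W = ball 0 1 ∧ deriv G 0 ≠ 0 := by
  obtain ⟨R, hRpos, hR⟩ := hWb.subset_ball_lt 0 0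
  obtain ⟨r, hr, hrb⟩ := Metric.isOpen_iff.mp hWo 0 h0
  have hF0 : RFam W (fun z => z / R) := by
    refine ⟨by fun_prop, ?_, ?_, by simp⟩
    · intro x _ y _ hxy
      have : (R:ℂ) ≠ 0 := by exact_mod_cast hRpos.ne'
      simp only at hxy
      field_simp at hxy
      exact hxy
    · intro z hz
      have := mem_ball_zero_iff.mp (hR hz)
      simp [abs_of_pos hRpos]
      rw [div_lt_one hRpos]; exact this
  have hd0 : 0 < ‖deriv (fun z : ℂ => z / R) 0‖ := by
    have : deriv (fun z : ℂ => z / R) 0 = 1 / R := by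
      simp
    rw [this]
    apply norm_pos_iff.mpr
    have : (R:ℂ) ≠ 0 := by exact_mod_cast hRpos.ne'
    simpa using this
  set A : Set ℝ := {d | ∃ F, RFam W F ∧ ‖deriv F 0‖ = d} with hA
  have hAne : A.Nonempty := ⟨_, _, hF0, rfl⟩
  have hAb : BddAbove A := ⟨1 / r, by
    rintro d ⟨F, hF, rfl⟩
    exact rfam_deriv_bound hr hrb hF⟩
  have hspos : 0 < sSup A := hd0.trans_le (le_csSup hAb ⟨_, hF0, rfl⟩)
  obtain ⟨d, -, hdl, hdA⟩ := exists_seq_tendsto_sSup hAne hAb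
  choose F hF hFd using hdA
  obtain ⟨G, hG, hGs⟩ := rfam_limit hWo hWc h0 hF hspos (by simpa [hFd] using hdl)
  have hGd : deriv G 0 ≠ 0 := by
    rw [← norm_pos_iff, hGs]; exact hspos
  refine ⟨G, hG, ?_, hGd⟩
  apply Subset.antisymm
  · rintro _ ⟨z, hz, rfl⟩; exact hG.maps hz
  · intro w hw
    by_contra hwG
    obtain ⟨H, hH, hlt⟩ := rfam_improve hWo h0 hsqrt hG hGd hw hwG
    have := le_csSup hAb ⟨H, hH, rfl⟩
    rw [hGs] at hlt
    linarith



/-! ## Part F: an open disc `O` with `closure O ⊆ f O` -/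

lemma isPreconnected_norm_ge {r : ℝ} (hr : 0 < r) : IsPreconnected {z : ℂ | r ≤ ‖z‖} := by
  have h1 : IsPreconnected {z : ℂ | Real.log r ≤ z.re} :=
    (convex_halfSpace_re_ge (Real.log r)).isPreconnected
  have h2 := h1.image Complex.exp Complex.continuous_exp.continuousOn
  convert h2 using 1
  ext w
  constructor
  · intro hw
    rw [mem_ofPred_eq] at hw
    have hw0 : w ≠ 0 := norm_pos_iff.mp (hr.trans_le hw)
    refine ⟨Complex.log w, ?_, Complex.exp_log hw0⟩
    rw [mem_ofPred_eq, Complex.log_re]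
    exact Real.log_le_log hr hw
  · rintro ⟨z, hz, rfl⟩
    rw [mem_ofPred_eq] at hz ⊢
    rw [Complex.norm_exp, ← Real.exp_log hr]
    exact Real.exp_le_exp.mpr hz

lemma exists_far (g : ℂ ≃ₜ ℂ) (r R : ℝ) : ∃ w : ℂ, r ≤ ‖w‖ ∧ R ≤ ‖g w‖ := by
  have hc : IsCompact (g.symm '' closedBall 0 R) := (isCompact_closedBall 0 R).image g.symm.continuous
  obtain ⟨C, hC⟩ := hc.isBounded.subset_closedBall 0
  refine ⟨((|r| + |C| + 1 : ℝ) : ℂ), ?_, ?_⟩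
  · rw [Complex.norm_real, Real.norm_eq_abs, abs_of_nonneg (by positivity)]
    linarith [le_abs_self r, abs_nonneg C]
  · by_contra h
    push Not at h
    have h2 : ((|r| + |C| + 1 : ℝ) : ℂ) ∈ g.symm '' closedBall 0 R :=
      ⟨g ((|r| + |C| + 1 : ℝ) : ℂ), by simpa using h.le, g.symm_apply_apply _⟩
    have h3 := mem_closedBall_zero_iff.mp (hC h2)
    rw [Complex.norm_real, Real.norm_eq_abs, abs_of_nonneg (by positivity)] at h3
    linarith [le_abs_self C, abs_nonneg r]

lemma exists_trap (f : ℂ ≃ₜ ℂ) (h0 : f 0 = 0) {ρ : ℝ} (hρ : 1 < ρ)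
    (h3 : ∀ w, f (f (f w)) = (ρ:ℂ)^3 * w) :
    ∃ W W' : Set ℂ, f '' W' = W ∧ IsCompact (closure W') ∧ closure W' ⊆ W ∧
    IsOpen W ∧ IsPreconnected W ∧ (0:ℂ) ∈ W ∧ Bornology.IsBounded W ∧
    (∀ u : ℂ → ℂ, DifferentiableOn ℂ u W → (∀ z ∈ W, u z ≠ 0) →
      ∃ s : ℂ → ℂ, DifferentiableOn ℂ s W ∧ ∀ z ∈ W, s z ^ 2 = u z) := by
  have hρ0 : 0 < ρ := by linarith
  have hr1 : 0 < ρ⁻¹ := by positivity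
  have hr1' : ρ⁻¹ < 1 := inv_lt_one_of_one_lt₀ hρ
  have hr2 : (ρ⁻¹)^2 < ρ⁻¹ := by nlinarith
  set N : Set ℂ := ball 0 1 ∩ (f '' ball 0 ρ⁻¹ ∩ f '' (f '' ball 0 ((ρ⁻¹)^2))) with hN
  have hNo : IsOpen N := isOpen_ball.inter ((f.isOpenMap _ isOpen_ball).inter
    (f.isOpenMap _ (f.isOpenMap _ isOpen_ball)))
  have hf3 : f '' (f '' (f '' ball 0 ((ρ⁻¹)^2))) = ball 0 ρ := by
    ext w
    constructor
    · rintro ⟨_, ⟨_, ⟨x, hx, rfl⟩, rfl⟩, rfl⟩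
      rw [mem_ball_zero_iff] at hx ⊢
      rw [h3, norm_mul, norm_pow, Complex.norm_real, Real.norm_eq_abs, abs_of_pos hρ0]
      calc ρ^3 * ‖x‖ < ρ^3 * (ρ⁻¹)^2 := by gcongr
        _ = ρ := by field_simp
    · intro hw
      rw [mem_ball_zero_iff] at hw
      have hρc : (ρ:ℂ) ≠ 0 := by exact_mod_cast hρ0.ne'
      refine ⟨_, ⟨_, ⟨w / (ρ:ℂ)^3, ?_, rfl⟩, rfl⟩, ?_⟩
      · rw [mem_ball_zero_iff, norm_div, norm_pow, Complex.norm_real, Real.norm_eq_abs,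
          abs_of_pos hρ0, div_lt_iff₀ (by positivity)]
        calc ‖w‖ < ρ := hw
          _ = _ := by field_simp
      · rw [h3]; field_simp
  have hfN : f '' N = f '' ball 0 1 ∩ (f '' (f '' ball 0 ρ⁻¹) ∩ ball 0 ρ) := by
    rw [hN, image_inter f.injective, image_inter f.injective, hf3]
  have h0N : (0:ℂ) ∈ N := by
    refine ⟨by simp, ⟨0, by simp [hr1], h0⟩, ⟨0, ⟨0, ?_, h0⟩, h0⟩⟩
    rw [mem_ball_zero_iff, norm_zero]; positivity
  have h0fN : (0:ℂ) ∈ f '' N := ⟨0, h0N, h0⟩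
  have hclN : closure N ⊆ f '' N := by
    rw [hfN]
    refine subset_inter ?_ (subset_inter ?_ ?_)
    · calc closure N ⊆ closure (f '' ball 0 ρ⁻¹) := closure_mono (fun x hx => hx.2.1)
        _ = f '' closure (ball 0 ρ⁻¹) := (f.image_closure _).symm
        _ ⊆ f '' ball 0 1 := image_mono (by
            rw [closure_ball _ hr1.ne']; exact closedBall_subset_ball hr1')
    · calc closure N ⊆ closure (f '' (f '' ball 0 ((ρ⁻¹)^2))) := closure_mono (fun x hx => hx.2.2)
        _ = f '' (f '' closure (ball 0 ((ρ⁻¹)^2))) := by rw [f.image_closure, f.image_closure]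
        _ ⊆ f '' (f '' ball 0 ρ⁻¹) := image_mono (image_mono (by
            rw [closure_ball _ (by positivity)]; exact closedBall_subset_ball hr2))
    · calc closure N ⊆ closure (ball 0 1) := closure_mono (fun x hx => hx.1)
        _ ⊆ ball 0 ρ := by rw [closure_ball _ one_ne_zero]; exact closedBall_subset_ball hρ
  -- the complement
  set E : Set ℂ := (f '' N)ᶜ with hE
  have hfNo : IsOpen (f '' N) := f.isOpenMap _ hNo
  have hEc : IsClosed E := hfNo.isClosed_compl
  have hcompl : ∀ r : ℝ, (ball (0:ℂ) r)ᶜ = {z | r ≤ ‖z‖} := by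
    intro r; ext z; simp
  have hEeq : E = (f '' {z | 1 ≤ ‖z‖}) ∪ ((f '' (f '' {z | ρ⁻¹ ≤ ‖z‖})) ∪ {z | ρ ≤ ‖z‖}) := by
    rw [hE, hfN, compl_inter, compl_inter, ← hcompl, ← hcompl, ← hcompl,
      image_compl_eq f.bijective, image_compl_eq f.bijective, image_compl_eq f.bijective]
  have hEp : IsPreconnected E := by
    have p1 := (isPreconnected_norm_ge one_pos).image f f.continuous.continuousOn
    have p2 := ((isPreconnected_norm_ge hr1).image f f.continuous.continuousOn).image f
      f.continuous.continuousOn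
    have p3 := isPreconnected_norm_ge hρ0
    obtain ⟨w, hw1, hw2⟩ := exists_far (f.trans f) ρ⁻¹ ρ
    have p23 := IsPreconnected.union (f (f w)) (mem_image_of_mem f (mem_image_of_mem f hw1)) hw2 p2 p3
    obtain ⟨v, hv1, hv2⟩ := exists_far f 1 ρ
    rw [hEeq]
    exact IsPreconnected.union (f v) (mem_image_of_mem f hv1) (Or.inr hv2) p1 p23
  have hEub : ¬ Bornology.IsBounded E := by
    intro hb
    obtain ⟨C, hC⟩ := hb.subset_closedBall 0
    have hmem : ((|C| + ρ + 1 : ℝ) : ℂ) ∈ E := by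
      rw [hEeq]; right; right
      rw [mem_ofPred_eq, Complex.norm_real, Real.norm_eq_abs, abs_of_nonneg (by positivity)]
      linarith [abs_nonneg C]
    have h := mem_closedBall_zero_iff.mp (hC hmem)
    rw [Complex.norm_real, Real.norm_eq_abs, abs_of_nonneg (by positivity)] at h
    linarith [le_abs_self C]
  have hEcompl : Eᶜ = f '' N := by rw [hE, compl_compl]
  have h0E : (0:ℂ) ∉ E := by rw [hE]; simpa using h0fN
  have hNb : Bornology.IsBounded N := (isBounded_ball (x := (0:ℂ)) (r := 1)).subset (fun x hx => hx.1)
  refine ⟨connectedComponentIn (f '' N) 0, connectedComponentIn N 0, ?_, ?_, ?_,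
    hfNo.connectedComponentIn, isPreconnected_connectedComponentIn,
    mem_connectedComponentIn h0fN, ?_, ?_⟩
  · have := f.image_connectedComponentIn h0N
    rw [h0] at this
    exact this
  · exact (hNb.subset (connectedComponentIn_subset _ _)).isCompact_closure
  · exact isPreconnected_connectedComponentIn.closure.subset_connectedComponentIn
      (subset_closure (mem_connectedComponentIn h0N))
      ((closure_mono (connectedComponentIn_subset _ _)).trans hclN)
  · refine (isBounded_ball (x := (0:ℂ)) (r := ρ)).subset ((connectedComponentIn_subset _ _).trans ?_)
    rw [hfN]; exact fun x hx => hx.2.2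
  · intro u hu hu0
    have := hasLog_component hEc hEp hEub h0E (u := u)
    rw [hEcompl] at this
    exact holo_sqrt_of_hasLog hfNo.connectedComponentIn hu (this hu.continuousOn hu0)

/-- The nice disc. -/
lemma nice_disc (f : ℂ ≃ₜ ℂ) (h0 : f 0 = 0) {ρ : ℝ} (hρ : 1 < ρ)
    (h3 : ∀ w, f (f (f w)) = (ρ:ℂ)^3 * w) :
    ∃ (q : ℝ) (θ : ℂ → ℂ), 1 < q ∧ ContinuousOn θ (ball 0 q) ∧ InjOn θ (ball 0 q) ∧ θ 0 = 0 ∧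
      (∀ U ⊆ ball 0 q, IsOpen U → IsOpen (θ '' U)) ∧ Bornology.IsBounded (θ '' ball 0 q) ∧
      θ '' ball 0 q ⊆ f '' (θ '' ball 0 1) := by
  obtain ⟨W, W', hWW', hcc, hcl, hWo, hWc, h0W, hWb, hsqrt⟩ := exists_trap f h0 hρ h3
  obtain ⟨G, hG, hGW, hGd⟩ := riemann_map hWo hWc h0W hWb hsqrt
  have hGc : ContinuousOn G W := hG.diff.continuousOn
  have hopen : ∀ s ⊆ W, IsOpen s → IsOpen (G '' s) := by
    refine ((hG.diff.analyticOnNhd hWo).is_constant_or_isOpen hWc).resolve_left ?_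
    rintro ⟨w, hw⟩
    apply hGd
    have h1 : G =ᶠ[𝓝 0] fun _ => w := by
      filter_upwards [hWo.mem_nhds h0W] with z hz using hw z hz
    rw [h1.deriv_eq]; simp
  -- radius
  obtain ⟨a, ha0, ha1, haW⟩ : ∃ a : ℝ, 0 < a ∧ a < 1 ∧ ∀ z ∈ W', ‖G z‖ < a := by
    have hcomp : IsCompact (G '' closure W') := hcc.image_of_continuousOn (hGc.mono hcl)
    have hne : (G '' closure W').Nonempty := by
      have : W'.Nonempty := by
        rw [← hWW'] at h0W
        obtain ⟨x, hx, -⟩ := h0W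
        exact ⟨x, hx⟩
      exact (this.mono subset_closure).image G
    obtain ⟨m, hm, hmax⟩ := hcomp.exists_isMaxOn hne continuous_norm.continuousOn
    have hm1 : ‖m‖ < 1 := by
      obtain ⟨x, hx, rfl⟩ := hm
      exact mem_ball_zero_iff.mp (hG.maps (hcl hx))
    refine ⟨(1 + ‖m‖) / 2, by positivity, by linarith, ?_⟩
    intro z hz
    have : ‖G z‖ ≤ ‖m‖ := hmax ⟨z, subset_closure hz, rfl⟩
    linarith
  have hac : (a:ℂ) ≠ 0 := by exact_mod_cast ha0.ne'
  set T := Function.invFunOn G W with hT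
  have hsurj : SurjOn G W (ball 0 1) := by rw [SurjOn, hGW]
  have hTW : ∀ z ∈ ball (0:ℂ) 1, T z ∈ W := fun z hz => hsurj.mapsTo_invFunOn hz
  have hGT : ∀ z ∈ ball (0:ℂ) 1, G (T z) = z := fun z hz => hsurj.rightInvOn_invFunOn hz
  have hTG : ∀ z ∈ W, T (G z) = z := fun z hz => hG.inj.leftInvOn_invFunOn hz
  have hscale : ∀ z ∈ ball (0:ℂ) a⁻¹, (a:ℂ) * z ∈ ball (0:ℂ) 1 := by
    intro z hz
    rw [mem_ball_zero_iff] at hz ⊢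
    rw [norm_mul, Complex.norm_real, Real.norm_eq_abs, abs_of_pos ha0]
    calc a * ‖z‖ < a * a⁻¹ := by gcongr
      _ = 1 := mul_inv_cancel₀ ha0.ne'
  have hTc : ContinuousOn T (ball 0 1) := by
    intro z hz
    apply ContinuousAt.continuousWithinAt
    rw [ContinuousAt, _root_.tendsto_nhds]
    intro V hV hzV
    have h1 : IsOpen (G '' (V ∩ W)) := hopen _ inter_subset_right (hV.inter hWo)
    have h2 : z ∈ G '' (V ∩ W) := ⟨T z, ⟨hzV, hTW z hz⟩, hGT z hz⟩
    filter_upwards [h1.mem_nhds h2] with y hy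
    obtain ⟨x, ⟨hxV, hxW⟩, rfl⟩ := hy
    rw [mem_preimage, hTG x hxW]; exact hxV
  refine ⟨a⁻¹, fun z => T (a * z), (one_lt_inv₀ ha0).mpr ha1, ?_, ?_, ?_, ?_, ?_, ?_⟩
  · exact hTc.comp (by fun_prop) hscale
  · intro x hx y hy hxy
    have h1 : G (T (a * x)) = G (T (a * y)) := by simp only at hxy; rw [hxy]
    rw [hGT _ (hscale x hx), hGT _ (hscale y hy)] at h1
    exact mul_left_cancel₀ hac h1
  · have := hTG 0 h0W
    rw [hG.zero] at this
    simpa using this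
  · intro U hU hUo
    have : (fun z => T (a * z)) '' U = W ∩ G ⁻¹' ((fun z => (a:ℂ)⁻¹ * z) ⁻¹' U) := by
      ext w
      constructor
      · rintro ⟨z, hz, rfl⟩
        refine ⟨hTW _ (hscale z (hU hz)), ?_⟩
        simp only [mem_preimage]
        rw [hGT _ (hscale z (hU hz)), inv_mul_cancel_left₀ hac]; exact hz
      · rintro ⟨hw, hwU⟩
        refine ⟨_, hwU, ?_⟩
        simp only
        rw [mul_inv_cancel_left₀ hac, hTG w hw]
    rw [this]
    exact hGc.isOpen_inter_preimage hWo (hUo.preimage (by fun_prop))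
  · refine hWb.subset ?_
    rintro _ ⟨z, hz, rfl⟩
    exact hTW _ (hscale z hz)
  · rintro _ ⟨z, hz, rfl⟩
    have h1 := hTW _ (hscale z hz)
    rw [← hWW'] at h1
    obtain ⟨x, hx, hxe⟩ := h1
    have hxW : x ∈ W := hcl (subset_closure hx)
    refine ⟨x, ⟨(a:ℂ)⁻¹ * G x, ?_, ?_⟩, hxe⟩
    · rw [mem_ball_zero_iff, norm_mul, norm_inv, Complex.norm_real, Real.norm_eq_abs,
        abs_of_pos ha0, inv_mul_lt_iff₀ ha0, mul_one]
      exact haW x hx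
    · simp only
      rw [mul_inv_cancel_left₀ hac, hTG x hxW]



/-! ## Part G: radial homeomorphisms, twists, extensions by the identity -/

/-- piecewise linear function fixing `0`, `p ↦ q`, `b ↦ b`, identity after `b`. -/
noncomputable def plf (p q b t : ℝ) : ℝ :=
  if t ≤ p then q / p * t else if t ≤ b then q + (b - q) / (b - p) * (t - p) else t

lemma plf_cont {p q b : ℝ} (hp : 0 < p) (hpb : p < b) : Continuous (plf p q b) := by
  have hbp : b - p ≠ 0 := by linarith
  unfold plf
  refine Continuous.if_le (by fun_prop) (Continuous.if_le (by fun_prop) (by fun_prop)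
    continuous_id continuous_const ?_) continuous_id continuous_const ?_
  · rintro x rfl; field_simp; ring
  · rintro x rfl
    rw [if_pos hpb.le]; field_simp; ring

lemma plf_pos {p q b t : ℝ} (hp : 0 < p) (hpb : p < b) (hq : 0 < q) (hqb : q < b) (ht : 0 < t) :
    0 < plf p q b t := by
  unfold plf
  have : 0 < b - p := by linarith
  have : 0 < b - q := by linarith
  split_ifs with h1 h2
  · positivity
  · push Not at h1
    have : 0 < t - p := by linarith
    positivity
  · exact ht

lemma plf_inv {p q b t : ℝ} (hp : 0 < p) (hpb : p < b) (hq : 0 < q) (hqb : q < b) (ht : 0 < t) :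
    plf q p b (plf p q b t) = t := by
  have h1 : 0 < b - p := by linarith
  have h2 : 0 < b - q := by linarith
  unfold plf
  by_cases h : t ≤ p
  · rw [if_pos h, if_pos]
    · field_simp
    · calc q / p * t ≤ q / p * p := by gcongr
        _ = q := by field_simp
  · push Not at h
    rw [if_neg (not_le.mpr h)]
    have h3 : 0 < t - p := by linarith
    by_cases hb : t ≤ b
    · rw [if_pos hb, if_neg, if_pos]
      · field_simp; ring
      · calc q + (b - q) / (b - p) * (t - p) ≤ q + (b - q) / (b - p) * (b - p) := by gcongr
          _ = b := by field_simp; ring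
      · have : 0 < (b - q) / (b - p) * (t - p) := by positivity
        linarith
    · push Not at hb
      rw [if_neg (not_le.mpr hb), if_neg (by linarith), if_neg (not_le.mpr hb)]

/-- radial map -/
noncomputable def radf (p q b : ℝ) (x : ℂ) : ℂ := ((plf p q b ‖x‖ / ‖x‖ : ℝ) : ℂ) * x

lemma radf_small {p q b : ℝ} {x : ℂ} (hx : ‖x‖ ≤ p) : radf p q b x = ((q / p : ℝ) : ℂ) * x := by
  by_cases h : x = 0
  · simp [radf, h]
  · have : ‖x‖ ≠ 0 := by simpa using h
    rw [radf, plf, if_pos hx, mul_div_assoc, div_self this, mul_one]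

lemma radf_large {p q b : ℝ} (hpb : p < b) (hb : 0 < b) {x : ℂ} (hx : b ≤ ‖x‖) : radf p q b x = x := by
  have h0 : ‖x‖ ≠ 0 := by linarith
  have : plf p q b ‖x‖ = ‖x‖ := by
    unfold plf
    rw [if_neg (by linarith)]
    split_ifs with h
    · have : ‖x‖ = b := le_antisymm h hx
      have h3 : b - p ≠ 0 := by linarith
      rw [this]; field_simp; ring
    · rfl
  rw [radf, this, div_self h0]; simp

lemma radf_norm {p q b : ℝ} (hp : 0 < p) (hpb : p < b) (hq : 0 < q) (hqb : q < b) {x : ℂ} (hx : x ≠ 0) :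
    ‖radf p q b x‖ = plf p q b ‖x‖ := by
  have h0 : 0 < ‖x‖ := norm_pos_iff.mpr hx
  have := plf_pos hp hpb hq hqb h0
  rw [radf, norm_mul, Complex.norm_real, Real.norm_eq_abs, abs_of_pos (by positivity)]
  field_simp

lemma radf_inv {p q b : ℝ} (hp : 0 < p) (hpb : p < b) (hq : 0 < q) (hqb : q < b) (x : ℂ) :
    radf q p b (radf p q b x) = x := by
  by_cases hx : x = 0
  · simp [hx, radf]
  · have h0 : 0 < ‖x‖ := norm_pos_iff.mpr hx
    have h1 := plf_pos hp hpb hq hqb h0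
    rw [radf, radf_norm hp hpb hq hqb hx, plf_inv hp hpb hq hqb h0, radf, ← mul_assoc,
      ← Complex.ofReal_mul]
    have : ‖x‖ / plf p q b ‖x‖ * (plf p q b ‖x‖ / ‖x‖) = 1 := by field_simp
    rw [this]; simp

lemma radf_cont {p q b : ℝ} (hp : 0 < p) (hpb : p < b) : Continuous (radf p q b) := by
  rw [continuous_iff_continuousAt]
  intro x
  by_cases hx : x = 0
  · have : radf p q b =ᶠ[𝓝 x] fun x => ((q / p : ℝ) : ℂ) * x := by
      subst hx
      filter_upwards [ball_mem_nhds (0:ℂ) hp] with y hy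
      exact radf_small (mem_ball_zero_iff.mp hy).le
    exact (ContinuousAt.congr (by fun_prop) this.symm)
  · have h0 : ‖x‖ ≠ 0 := by simpa using hx
    have h1 := (plf_cont (q := q) hp hpb)
    unfold radf
    have : ContinuousAt (fun x : ℂ => plf p q b ‖x‖ / ‖x‖) x :=
      (h1.comp continuous_norm).continuousAt.div continuous_norm.continuousAt h0
    exact (Complex.continuous_ofReal.continuousAt.comp this).mul continuousAt_id

/-- radial homeomorphism -/
noncomputable def Rad (p q b : ℝ) (hp : 0 < p) (hpb : p < b) (hq : 0 < q) (hqb : q < b) : ℂ ≃ₜ ℂ where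
  toFun := radf p q b
  invFun := radf q p b
  left_inv := radf_inv hp hpb hq hqb
  right_inv := radf_inv hq hqb hp hpb
  continuous_toFun := radf_cont hp hpb
  continuous_invFun := radf_cont hq hqb

lemma twist_exists (a d : ℝ) (hd : 0 < d) : ∃ T : ℂ ≃ₜ ℂ,
    (∀ x, ‖T x‖ = ‖x‖) ∧ (∀ x, ‖x‖ ≤ d → T x = Complex.exp (a * Complex.I) * x) ∧
    (∀ x, 2 * d ≤ ‖x‖ → T x = x) := by
  set h : ℝ → ℝ := fun t => max 0 (min 1 (2 - t / d)) with hh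
  have hc : Continuous h := by fun_prop
  have key : ∀ a : ℝ, ∀ x : ℂ, ‖Complex.exp ((a * h ‖x‖ : ℝ) * Complex.I) * x‖ = ‖x‖ := by
    intro a x; rw [norm_mul, Complex.norm_exp_ofReal_mul_I, one_mul]
  have inv : ∀ a : ℝ, ∀ x : ℂ, Complex.exp (((-a) * h ‖Complex.exp ((a * h ‖x‖ : ℝ) * Complex.I) * x‖ : ℝ) * Complex.I)
      * (Complex.exp ((a * h ‖x‖ : ℝ) * Complex.I) * x) = x := by
    intro a x
    rw [key, ← mul_assoc, ← Complex.exp_add]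
    push_cast
    ring_nf
    simp
  have cont : ∀ a : ℝ, Continuous fun x : ℂ => Complex.exp ((a * h ‖x‖ : ℝ) * Complex.I) * x := by
    intro a
    have : Continuous fun x : ℂ => a * h ‖x‖ := by fun_prop
    fun_prop
  refine ⟨⟨⟨fun x => Complex.exp ((a * h ‖x‖ : ℝ) * Complex.I) * x,
    fun x => Complex.exp (((-a) * h ‖x‖ : ℝ) * Complex.I) * x, inv a, ?_⟩, cont a, cont (-a)⟩,
    key a, ?_, ?_⟩
  · intro x
    have := inv (-a) x
    rw [neg_neg] at this
    exact this
  · intro x hx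
    have : h ‖x‖ = 1 := by
      have h1 : ‖x‖ / d ≤ 1 := (div_le_one hd).mpr hx
      simp only [hh]
      rw [min_eq_left (by linarith), max_eq_right zero_le_one]
    change Complex.exp ((a * h ‖x‖ : ℝ) * Complex.I) * x = _
    rw [this, mul_one]
  · intro x hx
    have : h ‖x‖ = 0 := by
      have h1 : 2 ≤ ‖x‖ / d := (le_div_iff₀ hd).mpr hx
      simp only [hh]
      rw [max_eq_left]
      exact (min_le_right _ _).trans (by linarith)
    change Complex.exp ((a * h ‖x‖ : ℝ) * Complex.I) * x = _
    rw [this]; simp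

lemma conj_ext_aux {ι : ℂ → ℂ} {r : ℝ} (hc : ContinuousOn ι (closedBall 0 r))
    (hi : InjOn ι (closedBall 0 r)) (ho : IsOpen (ι '' ball 0 r)) {F : ℂ → ℂ} (hF : Continuous F)
    (hmaps : ∀ z ∈ closedBall 0 r, F z ∈ closedBall 0 r)
    (hid : ∀ z ∈ closedBall 0 r, z ∉ ball (0:ℂ) r → F z = z) :
    ∃ G : ℂ → ℂ, Continuous G ∧ (∀ z ∈ closedBall 0 r, G (ι z) = ι (F z)) ∧
      (∀ x, x ∉ ι '' ball 0 r → G x = x) := by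
  classical
  set K := closedBall (0:ℂ) r
  have hKc : IsCompact K := isCompact_closedBall 0 r
  set G : ℂ → ℂ := fun x => if x ∈ ι '' K then ι (F (Function.invFunOn ι K x)) else x with hG
  have h1 : ∀ z ∈ K, G (ι z) = ι (F z) := by
    intro z hz
    simp only [hG]
    rw [if_pos ⟨z, hz, rfl⟩, hi.leftInvOn_invFunOn hz]
  have h2 : ∀ x, x ∉ ι '' ball 0 r → G x = x := by
    intro x hx
    by_cases hxK : x ∈ ι '' K
    · obtain ⟨z, hz, rfl⟩ := hxK
      rw [h1 z hz, hid z hz (fun h => hx ⟨z, h, rfl⟩)]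
    · simp only [hG]; rw [if_neg hxK]
  refine ⟨G, ?_, h1, h2⟩
  have c1 : ContinuousOn G (ι '' K) := by
    haveI : CompactSpace K := isCompact_iff_compactSpace.mp hKc
    set e : K → ℂ := K.restrict ι
    have he : Continuous e := hc.restrict
    have hinj : Function.Injective e := injOn_iff_injective.mp hi
    have hemb := (he.isClosedEmbedding hinj)
    have hG2 : Continuous (G ∘ e) := by
      have : G ∘ e = fun z : K => ι (F z) := by
        funext z; exact h1 z z.2
      rw [this]
      exact hc.comp_continuous (hF.comp continuous_subtype_val) (fun z => hmaps z z.2)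
    have hr : range e = ι '' K := range_restrict ι K
    rw [← hr, continuousOn_iff_continuous_restrict]
    have h3 : (range e).restrict G ∘ hemb.isEmbedding.toHomeomorph = G ∘ e := by
      funext z; rfl
    exact (hemb.isEmbedding.toHomeomorph.comp_continuous_iff').mp (h3 ▸ hG2)
  have c2 : ContinuousOn G (ι '' ball 0 r)ᶜ := continuousOn_id.congr (fun x hx => h2 x hx)
  have cl1 : IsClosed (ι '' K) := (hKc.image_of_continuousOn hc).isClosed
  have := c1.union_of_isClosed c2 cl1 ho.isClosed_compl
  rw [continuousOn_univ.symm]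
  convert this using 1
  symm
  rw [eq_univ_iff_forall]
  intro x
  by_cases hx : x ∈ ι '' ball 0 r
  · left; exact image_mono ball_subset_closedBall hx
  · right; exact hx

lemma conj_ext {ι : ℂ → ℂ} {r : ℝ} (hc : ContinuousOn ι (closedBall 0 r))
    (hi : InjOn ι (closedBall 0 r)) (ho : IsOpen (ι '' ball 0 r)) (F : ℂ ≃ₜ ℂ)
    (hid : ∀ z, r ≤ ‖z‖ → F z = z) :
    ∃ G : ℂ ≃ₜ ℂ, (∀ z ∈ closedBall 0 r, G (ι z) = ι (F z)) ∧
      (∀ x, x ∉ ι '' ball 0 r → G x = x) := by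
  have hid' : ∀ z, r ≤ ‖z‖ → F.symm z = z := by
    intro z hz
    rw [F.symm_apply_eq, hid z hz]
  have maps : ∀ F : ℂ ≃ₜ ℂ, (∀ z, r ≤ ‖z‖ → F z = z) → ∀ z ∈ closedBall (0:ℂ) r, F z ∈ closedBall (0:ℂ) r := by
    intro F hid z hz
    by_contra h
    simp only [mem_closedBall_zero_iff, not_le] at h hz
    have h2 := F.injective (hid _ h.le)
    rw [h2] at h; linarith
  have idc : ∀ F : ℂ ≃ₜ ℂ, (∀ z, r ≤ ‖z‖ → F z = z) → ∀ z ∈ closedBall 0 r, z ∉ ball (0:ℂ) r → F z = z := by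
    intro F hid z hz hz2
    exact hid z (by simpa using hz2)
  obtain ⟨G, hG, hG1, hG2⟩ := conj_ext_aux hc hi ho F.continuous (maps F hid) (idc F hid)
  obtain ⟨G', hG', hG1', hG2'⟩ := conj_ext_aux hc hi ho F.symm.continuous (maps _ hid') (idc _ hid')
  refine ⟨⟨⟨G, G', ?_, ?_⟩, hG, hG'⟩, hG1, hG2⟩
  · intro x
    by_cases hx : x ∈ ι '' ball 0 r
    · obtain ⟨z, hz, rfl⟩ := hx
      have hz := ball_subset_closedBall hz
      rw [hG1 z hz, hG1' _ (maps F hid z hz), F.symm_apply_apply]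
    · rw [hG2 x hx, hG2' x hx]
  · intro x
    by_cases hx : x ∈ ι '' ball 0 r
    · obtain ⟨z, hz, rfl⟩ := hx
      have hz := ball_subset_closedBall hz
      rw [hG1' z hz, hG1 _ (maps _ hid' z hz), F.apply_symm_apply]
    · rw [hG2' x hx, hG2 x hx]



/-! ## Part H: a homeomorphism which is the identity near `0` and `f` near infinity -/

noncomputable def cm (t : ℝ) : ℝ := (2 - 1 / max 1 t) / max 1 t
noncomputable def cmi (t : ℝ) : ℝ := 1 / (max 1 t * (2 - max 1 t))
noncomputable def cpsi (x : ℂ) : ℂ := (cm ‖x‖ : ℂ) * x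
noncomputable def cpsii (x : ℂ) : ℂ := (cmi ‖x‖ : ℂ) * x

lemma max_pos' (t : ℝ) : 0 < max 1 t := lt_of_lt_of_le one_pos (le_max_left _ _)

lemma cm_pos (t : ℝ) : 0 < cm t := by
  have h := max_pos' t
  have h1 : 1 ≤ max 1 t := le_max_left _ _
  have : 1 / max 1 t ≤ 1 := (div_le_one h).mpr h1
  unfold cm
  have : 0 < 2 - 1 / max 1 t := by linarith
  positivity

lemma cpsi_norm (x : ℂ) : ‖cpsi x‖ = cm ‖x‖ * ‖x‖ := by
  rw [cpsi, norm_mul, Complex.norm_real, Real.norm_eq_abs, abs_of_pos (cm_pos _)]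

lemma cpsi_small {x : ℂ} (hx : ‖x‖ ≤ 1) : cpsi x = x := by
  rw [cpsi, cm, max_eq_left hx]; norm_num

lemma cpsii_small {x : ℂ} (hx : ‖x‖ ≤ 1) : cpsii x = x := by
  rw [cpsii, cmi, max_eq_left hx]; norm_num

lemma cpsi_norm_large {x : ℂ} (hx : 1 ≤ ‖x‖) : ‖cpsi x‖ = 2 - 1 / ‖x‖ := by
  have : ‖x‖ ≠ 0 := by linarith
  rw [cpsi_norm, cm, max_eq_right hx]; field_simp

lemma cpsi_norm_lt (x : ℂ) : ‖cpsi x‖ < 2 := by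
  rcases le_total ‖x‖ 1 with h | h
  · rw [cpsi_small h]; linarith
  · rw [cpsi_norm_large h]
    have : 0 < 1 / ‖x‖ := by positivity
    linarith

lemma cpsii_cpsi (x : ℂ) : cpsii (cpsi x) = x := by
  rcases le_total ‖x‖ 1 with h | h
  · rw [cpsi_small h, cpsii_small h]
  · have h0 : 0 < ‖x‖ := by linarith
    have h1 : 1 / ‖x‖ ≤ 1 := (div_le_one h0).mpr h
    rw [cpsii, cpsi_norm_large h, cmi, max_eq_right (by linarith), cpsi, cm, max_eq_right h,
      ← mul_assoc, ← Complex.ofReal_mul]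
    have h2 : 2 - 1 / ‖x‖ ≠ 0 := by linarith
    have : 1 / ((2 - 1 / ‖x‖) * (2 - (2 - 1 / ‖x‖))) * ((2 - 1 / ‖x‖) / ‖x‖) = 1 := by
      have h3 : 2 - (2 - 1 / ‖x‖) = 1 / ‖x‖ := by ring
      rw [h3]
      generalize 2 - 1 / ‖x‖ = y at h2
      field_simp
    rw [this]; simp

lemma cpsi_cpsii {x : ℂ} (hx : ‖x‖ < 2) : cpsi (cpsii x) = x := by
  rcases le_total ‖x‖ 1 with h | h
  · rw [cpsii_small h, cpsi_small h]
  · have h0 : 0 < ‖x‖ := by linarith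
    have h1 : 0 < 2 - ‖x‖ := by linarith
    have hn : ‖cpsii x‖ = 1 / (2 - ‖x‖) := by
      rw [cpsii, norm_mul, Complex.norm_real, Real.norm_eq_abs, cmi, max_eq_right h,
        abs_of_pos (by positivity)]
      field_simp
    have hn1 : 1 ≤ ‖cpsii x‖ := by rw [hn, one_le_div h1]; linarith
    rw [cpsi, cm, max_eq_right hn1, hn, cpsii, cmi, max_eq_right h, ← mul_assoc, ← Complex.ofReal_mul]
    have : (2 - 1 / (1 / (2 - ‖x‖))) / (1 / (2 - ‖x‖)) * (1 / (‖x‖ * (2 - ‖x‖))) = 1 := by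
      rw [one_div_one_div]
      generalize hy : 2 - ‖x‖ = y at *
      have : 2 - y = ‖x‖ := by linarith
      rw [this]
      field_simp
    rw [this]; simp

lemma cpsi_cont : Continuous cpsi := by
  have : Continuous cm := by
    unfold cm
    have h : Continuous fun t : ℝ => max 1 t := by fun_prop
    exact (continuous_const.sub (continuous_const.div h fun t => (max_pos' t).ne')).div h
      fun t => (max_pos' t).ne'
  unfold cpsi
  fun_prop

lemma cpsii_cont : ContinuousOn cpsii (ball 0 2) := by
  have h : Continuous fun x : ℂ => max 1 ‖x‖ := by fun_prop
  have : ContinuousOn (fun x : ℂ => cmi ‖x‖) (ball 0 2) := by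
    unfold cmi
    refine continuousOn_const.div (by fun_prop) ?_
    intro x hx
    have hx := mem_ball_zero_iff.mp hx
    have h2 : max 1 ‖x‖ < 2 := max_lt (by norm_num) hx
    exact mul_ne_zero (max_pos' _).ne' (by linarith)
  unfold cpsii
  exact (Complex.continuous_ofReal.comp_continuousOn this).mul continuousOn_id

lemma cpsi_dist {c : ℝ} (hc : 0 ≤ c) {x x' : ℂ} (h : ‖x' - x‖ ≤ c) :
    ‖cpsi x' - cpsi x‖ ≤ 4 * (1 + c) * (2 - ‖cpsi x‖) := by
  rcases le_or_gt ‖x‖ (1 + c) with h1 | h1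
  · have h2 : ‖cpsi x' - cpsi x‖ ≤ 4 := by
      linarith [norm_sub_le (cpsi x') (cpsi x), cpsi_norm_lt x', cpsi_norm_lt x]
    have h3 : 1 / (1 + c) ≤ 2 - ‖cpsi x‖ := by
      rcases le_total ‖x‖ 1 with h4 | h4
      · rw [cpsi_small h4]
        have : 1 / (1 + c) ≤ 1 := (div_le_one (by linarith)).mpr (by linarith)
        linarith
      · rw [cpsi_norm_large h4]
        have := one_div_le_one_div_of_le (by linarith) h1
        linarith
    calc ‖cpsi x' - cpsi x‖ ≤ 4 := h2
      _ = 4 * (1 + c) * (1 / (1 + c)) := by field_simp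
      _ ≤ _ := by gcongr
  · have hx1 : 1 ≤ ‖x‖ := by linarith
    have hd : |‖x'‖ - ‖x‖| ≤ c := (abs_norm_sub_norm_le x' x).trans h
    have hx1' : 1 ≤ ‖x'‖ := by linarith [(abs_le.mp hd).1]
    rw [cpsi_norm_large hx1]
    have e : cpsi x' - cpsi x = (cm ‖x‖ : ℂ) * (x' - x) + ((cm ‖x'‖ - cm ‖x‖ : ℝ) : ℂ) * x' := by
      rw [cpsi, cpsi]; push_cast; ring
    set t := ‖x‖ with ht
    set t' := ‖x'‖ with ht'
    have t0 : 0 < t := by linarith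
    have t0' : 0 < t' := by linarith
    have i1 : 1 / t ≤ 1 := (div_le_one t0).mpr hx1
    have i1' : 1 / t' ≤ 1 := (div_le_one t0').mpr hx1'
    have i2 : 0 < 1 / t := by positivity
    have i2' : 0 < 1 / t' := by positivity
    have b1 : |cm t| ≤ 2 / t := by
      rw [abs_of_pos (cm_pos t), cm, max_eq_right hx1]
      gcongr; linarith
    have b2 : |cm t' - cm t| * t' ≤ 2 * c / t := by
      have : cm t' - cm t = (t - t') / (t * t') * (2 - 1 / t - 1 / t') := by
        rw [cm, cm, max_eq_right hx1, max_eq_right hx1']; field_simp; ring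
      rw [this, abs_mul, abs_div, abs_of_pos (mul_pos t0 t0'), abs_sub_comm]
      have : |2 - 1 / t - 1 / t'| ≤ 2 := by rw [abs_le]; constructor <;> linarith
      calc |t' - t| / (t * t') * |2 - 1 / t - 1 / t'| * t' ≤ c / (t * t') * 2 * t' := by gcongr
        _ = 2 * c / t := by field_simp
    calc ‖cpsi x' - cpsi x‖ ≤ |cm t| * ‖x' - x‖ + |cm t' - cm t| * t' := by
          rw [e]
          refine (norm_add_le _ _).trans (le_of_eq ?_)
          rw [norm_mul, norm_mul, Complex.norm_real, Complex.norm_real, Real.norm_eq_abs,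
            Real.norm_eq_abs]
      _ ≤ 2 / t * c + 2 * c / t := by gcongr
      _ = 4 * c * (1 / t) := by ring
      _ ≤ 4 * (1 + c) * (1 / t) := by gcongr; linarith
      _ = _ := by ring

lemma compactify_aux {g : ℂ → ℂ} (hg : Continuous g) {c : ℝ} (hb : ∀ z, ‖g z - z‖ ≤ c) :
    ∃ F : ℂ → ℂ, Continuous F ∧ (∀ z, 2 ≤ ‖z‖ → F z = z) ∧ (∀ x, F (cpsi x) = cpsi (g x)) := by
  classical
  have hc : 0 ≤ c := (norm_nonneg _).trans (hb 0)
  set F : ℂ → ℂ := fun y => if ‖y‖ < 2 then cpsi (g (cpsii y)) else y with hF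
  have h1 : ∀ z, 2 ≤ ‖z‖ → F z = z := fun z hz => by simp only [hF]; rw [if_neg (not_lt.mpr hz)]
  have h2 : ∀ x, F (cpsi x) = cpsi (g x) := by
    intro x; simp only [hF]; rw [if_pos (cpsi_norm_lt x), cpsii_cpsi]
  have h3 : ∀ y, ‖F y - y‖ ≤ 4 * (1 + c) * max 0 (2 - ‖y‖) := by
    intro y
    rcases lt_or_ge ‖y‖ 2 with h | h
    · have := cpsi_dist hc (hb (cpsii y))
      rw [← h2, cpsi_cpsii h] at this
      refine this.trans ?_
      gcongr
      exact le_max_right _ _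
    · rw [h1 y h, sub_self, norm_zero]
      have : 0 ≤ max 0 (2 - ‖y‖) := le_max_left _ _
      positivity
  refine ⟨F, ?_, h1, h2⟩
  rw [continuous_iff_continuousAt]
  intro y
  rcases lt_or_ge ‖y‖ 2 with h | h
  · have hn : ball (0:ℂ) 2 ∈ 𝓝 y := isOpen_ball.mem_nhds (mem_ball_zero_iff.mpr h)
    have e : F =ᶠ[𝓝 y] fun y => cpsi (g (cpsii y)) := by
      filter_upwards [hn] with z hz
      simp only [hF]; rw [if_pos (mem_ball_zero_iff.mp hz)]
    refine ContinuousAt.congr ?_ e.symm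
    exact (cpsi_cont.comp hg).continuousAt.comp (cpsii_cont.continuousAt hn)
  · have : Tendsto (fun z => F z - z) (𝓝 y) (𝓝 0) := by
      have h4 : Tendsto (fun y : ℂ => 4 * (1 + c) * max 0 (2 - ‖y‖)) (𝓝 y) (𝓝 0) := by
        have : Continuous (fun y : ℂ => 4 * (1 + c) * max 0 (2 - ‖y‖)) := by fun_prop
        have h5 := this.tendsto y
        rwa [max_eq_left (by linarith), mul_zero] at h5
      exact squeeze_zero_norm h3 h4
    have h6 := this.add (tendsto_id (x := 𝓝 y))
    rw [ContinuousAt, h1 y h]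
    simpa using h6

lemma compactify (g : ℂ ≃ₜ ℂ) (g0 : g 0 = 0) {c : ℝ} (hb : ∀ z, ‖g z - z‖ ≤ c) :
    ∃ F : ℂ ≃ₜ ℂ, (∀ z, 2 ≤ ‖z‖ → F z = z) ∧ F =ᶠ[𝓝 0] g := by
  have hb' : ∀ z, ‖g.symm z - z‖ ≤ c := by
    intro z
    have := hb (g.symm z)
    rwa [g.apply_symm_apply, norm_sub_rev] at this
  obtain ⟨F, hF, h1, h2⟩ := compactify_aux g.continuous hb
  obtain ⟨F', hF', h1', h2'⟩ := compactify_aux g.symm.continuous hb'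
  refine ⟨⟨⟨F, F', ?_, ?_⟩, hF, hF'⟩, h1, ?_⟩
  · intro y
    rcases lt_or_ge ‖y‖ 2 with h | h
    · rw [← cpsi_cpsii h, h2, h2', g.symm_apply_apply]
    · rw [h1 y h, h1' y h]
  · intro y
    rcases lt_or_ge ‖y‖ 2 with h | h
    · rw [← cpsi_cpsii h, h2', h2, g.apply_symm_apply]
    · rw [h1' y h, h1 y h]
  · have e1 : ∀ᶠ z in 𝓝 (0:ℂ), ‖z‖ < 1 := by
      filter_upwards [ball_mem_nhds (0:ℂ) one_pos] with z hz using mem_ball_zero_iff.mp hz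
    have e2 : ∀ᶠ z in 𝓝 (0:ℂ), ‖g z‖ < 1 := by
      have : Tendsto g (𝓝 0) (𝓝 0) := by
        have := g.continuous.tendsto 0
        rwa [g0] at this
      exact this.eventually e1
    filter_upwards [e1, e2] with z h3 h4
    change F z = g z
    have := h2 z
    rwa [cpsi_small h3.le, cpsi_small h4.le] at this

lemma exp_injOn_closedBall_two : InjOn Complex.exp (closedBall 0 2) := by
  intro a ha b hb hab
  rw [mem_closedBall_zero_iff] at ha hb
  obtain ⟨n, hn⟩ := Complex.exp_eq_exp_iff_exists_int.mp hab
  have h1 : ‖a - b‖ ≤ 4 := (norm_sub_le a b).trans (by linarith)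
  have h2 : ‖a - b‖ = |(n:ℝ)| * (2 * Real.pi) := by
    rw [hn, add_sub_cancel_left, norm_mul, norm_mul, norm_mul]
    simp [abs_of_pos Real.pi_pos]
  have h3 := Real.pi_gt_three
  by_cases hn0 : n = 0
  · rw [hn, hn0]; simp
  · exfalso
    have : (1:ℝ) ≤ |(n:ℝ)| := by exact_mod_cast Int.one_le_abs hn0
    nlinarith

lemma mu_exists (a : ℂ) : ∃ μ : ℂ ≃ₜ ℂ, (∀ᶠ x in 𝓝 (0:ℂ), μ x = Complex.exp (-a) * x) ∧
    ∀ x, 1 / 2 ≤ ‖x‖ → μ x = x := by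
  obtain ⟨T, hT, hT1, hT2⟩ := twist_exists (-a.im) (1/8) (by norm_num)
  set u := Real.exp (-a.re) with hu
  have hu0 : 0 < u := Real.exp_pos _
  have hp : 0 < 1 / (4 * (1 + u)) := by positivity
  have hpb : 1 / (4 * (1 + u)) < 1 / 2 := by
    rw [div_lt_div_iff₀ (by positivity) (by norm_num)]; linarith
  have hq : 0 < u / (4 * (1 + u)) := by positivity
  have hqb : u / (4 * (1 + u)) < 1 / 2 := by
    rw [div_lt_div_iff₀ (by positivity) (by norm_num)]; linarith
  refine ⟨T.trans (Rad _ _ _ hp hpb hq hqb), ?_, ?_⟩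
  · filter_upwards [ball_mem_nhds (0:ℂ) hp, ball_mem_nhds (0:ℂ) (ε := 1/8) (by norm_num)] with x hx hx2
    rw [mem_ball_zero_iff] at hx hx2
    change radf _ _ _ (T x) = _
    rw [radf_small (by rw [hT]; exact hx.le), hT1 x hx2.le, ← mul_assoc]
    congr 1
    have : u / (4 * (1 + u)) / (1 / (4 * (1 + u))) = u := by field_simp
    rw [this, hu, Complex.ofReal_exp, ← Complex.exp_add]
    congr 1
    apply Complex.ext <;> simp
  · intro x hx
    change radf _ _ _ (T x) = _
    rw [hT2 x (by linarith), radf_large hpb (by norm_num) hx]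

lemma glue_at_zero (f h : ℂ ≃ₜ ℂ) (f0 : f 0 = 0) (h0 : h 0 = 0) (hfh : f =ᶠ[𝓝 1] h) :
    ∃ g : ℂ ≃ₜ ℂ, g =ᶠ[𝓝 0] h ∧ g =ᶠ[cocompact ℂ] f := by
  obtain ⟨δ, hδ, hball⟩ := Metric.eventually_nhds_iff_ball.mp hfh
  set q := min δ 1 with hq
  have hq0 : 0 < q := lt_min hδ one_pos
  have hq3 : q < 3 := lt_of_le_of_lt (min_le_right _ _) (by norm_num)
  set R := Rad 2 q 3 (by norm_num) (by norm_num) hq0 hq3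
  set s : ℂ ≃ₜ ℂ := (Homeomorph.subRight (1:ℂ)).trans (R.trans (Homeomorph.addRight (1:ℂ))) with hs
  have hsx : ∀ x, s x = radf 2 q 3 (x - 1) + 1 := fun x => rfl
  have hs0 : s 0 ∈ ball (1:ℂ) δ := by
    rw [hsx, radf_small (by norm_num), mem_ball_iff_norm]
    have : q ≤ δ := min_le_left _ _
    have h3 : ‖((q / 2 : ℝ) : ℂ) * (0 - 1) + 1 - 1‖ = q / 2 := by
      rw [add_sub_cancel_right, norm_mul, Complex.norm_real, Real.norm_eq_abs,
        abs_of_pos (by positivity)]; simp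
    rw [h3]; linarith
  have hsinf : ∀ᶠ x in cocompact ℂ, s x = x := by
    have : (closedBall (0:ℂ) 4)ᶜ ∈ cocompact ℂ := (isCompact_closedBall 0 4).compl_mem_cocompact
    filter_upwards [this] with x hx
    simp only [mem_compl_iff, mem_closedBall_zero_iff, not_le] at hx
    rw [hsx, radf_large (by norm_num) (by norm_num)]
    · ring
    · have := norm_sub_norm_le x 1
      rw [norm_one] at this
      linarith
  set k := f.trans h.symm with hk
  have hkE : ∀ x ∈ ball (1:ℂ) δ, k x = x := by
    intro x hx
    change h.symm (f x) = x
    rw [h.symm_apply_eq]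
    exact hball x hx
  have hk0 : k.symm 0 = 0 := by
    rw [k.symm_apply_eq]
    change 0 = h.symm (f 0)
    rw [f0]; symm; rw [h.symm_apply_eq, h0]
  refine ⟨(k.symm.trans (s.trans (k.trans s.symm))).trans f, ?_, ?_⟩
  · have : Tendsto (fun x => s (k.symm x)) (𝓝 0) (𝓝 (s 0)) := by
      have h5 := (s.continuous.comp k.symm.continuous).tendsto 0
      rw [Function.comp_apply, hk0] at h5
      exact h5
    filter_upwards [this.eventually (isOpen_ball.mem_nhds hs0)] with x hx
    change f (s.symm (k (s (k.symm x)))) = h x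
    rw [hkE _ hx, s.symm_apply_apply]
    change f (f.symm (h x)) = h x
    rw [f.apply_symm_apply]
  · have : Tendsto k.symm (cocompact ℂ) (cocompact ℂ) := k.symm.isClosedEmbedding.tendsto_cocompact
    filter_upwards [hsinf, this.eventually hsinf] with x hx hx2
    change f (s.symm (k (s (k.symm x)))) = f x
    rw [hx2, k.apply_symm_apply]
    congr 1
    rw [s.symm_apply_eq, hx]

lemma exists_fprime (f ft : ℂ ≃ₜ ℂ) {c : ℝ} (hb : ∀ z, ‖ft z - z‖ ≤ c)
    (hexp : ∀ z, f (Complex.exp z) = Complex.exp (ft z)) (f0 : f 0 = 0) :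
    ∃ g : ℂ ≃ₜ ℂ, (∀ᶠ x in 𝓝 (0:ℂ), g x = x) ∧ (∀ᶠ x in cocompact ℂ, g x = f x) := by
  set a := ft 0 with ha
  obtain ⟨F, hF1, hF2⟩ := compactify (ft.trans (Homeomorph.subRight a)) (by simp [ha])
    (c := c + ‖a‖) (by
      intro z
      change ‖ft z - a - z‖ ≤ _
      have : ft z - a - z = (ft z - z) - a := by ring
      rw [this]
      exact (norm_sub_le _ _).trans (by linarith [hb z]))
  have hop : IsOpenMap Complex.exp := Complex.isOpenMap_exp
  obtain ⟨H, hH1, hH2⟩ := conj_ext (ι := Complex.exp) (r := 2) Complex.continuous_exp.continuousOn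
    exp_injOn_closedBall_two (hop _ isOpen_ball) F hF1
  obtain ⟨μ, hμ1, hμ2⟩ := mu_exists a
  have hκ : Complex.exp a ≠ 0 := Complex.exp_ne_zero a
  have hHid : ∀ᶠ x in 𝓝 (0:ℂ), H x = x := by
    filter_upwards [ball_mem_nhds (0:ℂ) (Real.exp_pos (-2))] with x hx
    apply hH2
    rintro ⟨z, hz, rfl⟩
    rw [mem_ball_zero_iff] at hx hz
    rw [Complex.norm_exp, Real.exp_lt_exp] at hx
    have := (abs_le.mp (Complex.abs_re_le_norm z)).1
    linarith
  have hH1' : ∀ᶠ x in 𝓝 (1:ℂ), f x = Complex.exp a * H x := by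
    obtain ⟨δ, hδ, hball⟩ := Metric.eventually_nhds_iff_ball.mp hF2
    have ho : IsOpen (Complex.exp '' ball 0 (min δ 2)) := hop _ isOpen_ball
    have : (1:ℂ) ∈ Complex.exp '' ball 0 (min δ 2) := ⟨0, by simp [hδ], Complex.exp_zero⟩
    filter_upwards [ho.mem_nhds this] with x hx
    obtain ⟨z, hz, rfl⟩ := hx
    rw [mem_ball_zero_iff, lt_min_iff] at hz
    rw [hexp, hH1 z (mem_closedBall_zero_iff.mpr hz.2.le), hball z (mem_ball_zero_iff.mpr hz.1),
      ← Complex.exp_add]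
    congr 1
    change ft z = a + (ft z - a)
    ring
  have hHone : H 1 = 1 := by
    have h1 := hH1'.self_of_nhds
    have h2 := hexp 0
    rw [Complex.exp_zero, h1, ← ha] at h2
    exact mul_left_cancel₀ hκ (by rw [h2, mul_one])
  set h : ℂ ≃ₜ ℂ := H.trans (μ.trans (Homeomorph.mulLeft₀ _ hκ)) with hh
  have hhx : ∀ x, h x = Complex.exp a * μ (H x) := fun x => rfl
  have hhid : ∀ᶠ x in 𝓝 (0:ℂ), h x = x := by
    filter_upwards [hHid, hμ1] with x h1 h2
    rw [hhx, h1, h2, ← mul_assoc, ← Complex.exp_add]; simp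
  obtain ⟨g, hg1, hg2⟩ := glue_at_zero f h f0 hhid.self_of_nhds (by
    have : Tendsto H (𝓝 1) (𝓝 1) := by
      have := H.continuous.tendsto 1
      rwa [hHone] at this
    have hn : ∀ᶠ x in 𝓝 (1:ℂ), 1 / 2 ≤ ‖x‖ := by
      have : Tendsto (fun x : ℂ => ‖x‖) (𝓝 1) (𝓝 ‖(1:ℂ)‖) := continuous_norm.tendsto 1
      exact this.eventually (Ici_mem_nhds (by norm_num))
    filter_upwards [hH1', this.eventually hn] with x h1 h2
    rw [h1, hhx, hμ2 _ h2])
  refine ⟨g, ?_, hg2⟩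
  filter_upwards [hg1, hhid] with x h1 h2
  rw [h1, h2]



/-! ## Part I: the fundamental annulus -/

lemma exists_fprime_in (f g : ℂ ≃ₜ ℂ) {l : ℝ} (hl : 1 < l) (hcomm : ∀ x, f (l * x) = l * f x)
    (hg1 : ∀ᶠ x in 𝓝 (0:ℂ), g x = x) (hg2 : ∀ᶠ x in cocompact ℂ, g x = f x)
    {O : Set ℂ} (hO : IsOpen O) (h0 : (0:ℂ) ∈ O) :
    ∃ g : ℂ ≃ₜ ℂ, (∀ᶠ x in 𝓝 (0:ℂ), g x = x) ∧ ∀ x, x ∉ O → g x = f x := by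
  have hl0 : 0 < l := by linarith
  have hlc : (l:ℂ) ≠ 0 := by exact_mod_cast hl0.ne'
  obtain ⟨r, hr, hrO⟩ := Metric.isOpen_iff.mp hO 0 h0
  obtain ⟨R, hR⟩ : ∃ R : ℝ, ∀ x, R < ‖x‖ → g x = f x := by
    obtain ⟨K, hK, hKs⟩ := mem_cocompact.mp hg2
    obtain ⟨R, hR⟩ := hK.isBounded.subset_closedBall 0
    refine ⟨R, fun x hx => hKs ?_⟩
    intro hxK
    have := mem_closedBall_zero_iff.mp (hR hxK)
    linarith
  obtain ⟨n, hn⟩ := pow_unbounded_of_one_lt (R / r) hl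
  have hcn : ∀ x, f ((l:ℂ)^n * x) = (l:ℂ)^n * f x := by
    clear hn
    induction n with
    | zero => simp
    | succ n ih => intro x; rw [pow_succ', mul_assoc, hcomm, ih, mul_assoc]
  have hln : (l:ℂ)^n ≠ 0 := pow_ne_zero _ hlc
  set m := Homeomorph.mulLeft₀ ((l:ℂ)^n) hln
  have hm : ∀ x, m x = (l:ℂ)^n * x := fun x => rfl
  refine ⟨m.trans (g.trans m.symm), ?_, ?_⟩
  · have : Tendsto m (𝓝 0) (𝓝 0) := by
      have := m.continuous.tendsto 0
      rwa [hm, mul_zero] at this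
    filter_upwards [this.eventually hg1] with x hx
    change m.symm (g (m x)) = x
    rw [hx, m.symm_apply_apply]
  · intro x hx
    change m.symm (g (m x)) = f x
    rw [m.symm_apply_eq, hR, hm, hm, hcn]
    have : r ≤ ‖x‖ := by
      by_contra h
      push Not at h
      exact hx (hrO (mem_ball_zero_iff.mpr h))
    rw [hm, norm_mul, norm_pow, Complex.norm_real, Real.norm_eq_abs, abs_of_pos hl0]
    rw [div_lt_iff₀ hr] at hn
    calc R < l^n * r := hn
      _ ≤ _ := by gcongr

lemma annulus (f g : ℂ ≃ₜ ℂ) {q : ℝ} {θ : ℂ → ℂ} (hq : 1 < q) (hθc : ContinuousOn θ (ball 0 q))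
    (hθi : InjOn θ (ball 0 q)) (hθ0 : θ 0 = 0)
    (hθo : ∀ U ⊆ ball (0:ℂ) q, IsOpen U → IsOpen (θ '' U))
    (hθf : θ '' ball 0 q ⊆ f '' (θ '' ball 0 1))
    (hg1 : ∀ᶠ x in 𝓝 (0:ℂ), g x = x) (hg2 : ∀ x, x ∉ θ '' ball 0 1 → g x = f x) :
    ∃ k : ℂ → ℂ, ContinuousOn k (closedBall 0 q) ∧ InjOn k (closedBall 0 q) ∧ k 0 = 0 ∧
      IsOpen (k '' ball 0 1) ∧ k '' ball 0 q = f '' (k '' ball 0 1) ∧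
      ∀ w : ℂ, ‖w‖ = 1 → k (q * w) = f (k w) := by
  have hq0 : 0 < q := by linarith
  have hqc : (q:ℂ) ≠ 0 := by exact_mod_cast hq0.ne'
  set O := θ '' ball 0 1 with hO
  have hOo : IsOpen O := hθo _ (ball_subset_ball hq.le) isOpen_ball
  have h0O : (0:ℂ) ∈ O := ⟨0, by simp, hθ0⟩
  -- g and f have the same image of O
  have hgO : g '' O = f '' O := by
    have : g '' Oᶜ = f '' Oᶜ := by
      apply image_congr
      intro x hx; exact hg2 x hx
    rw [image_compl_eq g.bijective, image_compl_eq f.bijective] at this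
    exact compl_injective this
  -- χ
  have hex : ∀ z ∈ ball (0:ℂ) q, ∃ y ∈ ball (0:ℂ) 1, g (θ y) = θ z := by
    intro z hz
    have : θ z ∈ g '' O := hgO ▸ hθf ⟨z, hz, rfl⟩
    obtain ⟨_, ⟨y, hy, rfl⟩, h⟩ := this
    exact ⟨y, hy, h⟩
  choose! χ hχ1 hχ2 using hex
  have hsub : ball (0:ℂ) 1 ⊆ ball 0 q := ball_subset_ball hq.le
  have hχi : InjOn χ (ball 0 q) := by
    intro x hx y hy hxy
    apply hθi hx hy
    rw [← hχ2 x hx, ← hχ2 y hy, hxy]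
  have hχu : ∀ z ∈ ball (0:ℂ) q, ∀ y ∈ ball (0:ℂ) 1, g (θ y) = θ z → χ z = y := by
    intro z hz y hy h
    apply hθi (hsub (hχ1 z hz)) (hsub hy)
    apply g.injective
    rw [hχ2 z hz, h]
  have hχo : ∀ U ⊆ ball (0:ℂ) q, IsOpen U → IsOpen (χ '' U) := by
    intro U hU hUo
    have : χ '' U = ball 0 1 ∩ (fun y => g (θ y)) ⁻¹' (θ '' U) := by
      ext y
      constructor
      · rintro ⟨z, hz, rfl⟩
        exact ⟨hχ1 z (hU hz), ⟨z, hz, (hχ2 z (hU hz)).symm⟩⟩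
      · rintro ⟨hy, z, hz, h⟩
        exact ⟨z, hz, hχu z (hU hz) y hy h.symm⟩
    rw [this]
    exact (g.continuous.comp_continuousOn (hθc.mono hsub)).isOpen_inter_preimage isOpen_ball (hθo U hU hUo)
  have hχc : ContinuousOn χ (ball 0 q) := by
    rw [continuousOn_open_iff isOpen_ball]
    intro V hV
    have : ball 0 q ∩ χ ⁻¹' V = ball 0 q ∩ θ ⁻¹' (g '' (θ '' (V ∩ ball 0 1))) := by
      ext z
      constructor
      · rintro ⟨hz, hzV⟩
        exact ⟨hz, _, ⟨χ z, ⟨hzV, hχ1 z hz⟩, rfl⟩, hχ2 z hz⟩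
      · rintro ⟨hz, _, ⟨y, ⟨hyV, hy⟩, rfl⟩, h⟩
        refine ⟨hz, ?_⟩
        rw [mem_preimage, hχu z hz y hy h]; exact hyV
    rw [this]
    exact hθc.isOpen_inter_preimage isOpen_ball (g.isOpenMap _ (hθo _ (inter_subset_right.trans hsub)
      (hV.inter isOpen_ball)))
  -- χ is the identity near 0
  obtain ⟨e, he0, he⟩ : ∃ e : ℝ, 0 < e ∧ ∀ z ∈ ball (0:ℂ) e, g (θ z) = θ z := by
    have h1 : ContinuousAt θ 0 := hθc.continuousAt (ball_mem_nhds 0 hq0)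
    have h2 : Tendsto θ (𝓝 0) (𝓝 0) := by rw [ContinuousAt, hθ0] at h1; exact h1
    exact Metric.eventually_nhds_iff_ball.mp (h2.eventually hg1)
  set ε := min (e / 2) (1 / 2) with hε
  have hε0 : 0 < ε := lt_min (by linarith) (by norm_num)
  have hεe : ε < e := lt_of_le_of_lt (min_le_left _ _) (by linarith)
  have hε1 : ε < 1 := lt_of_le_of_lt (min_le_right _ _) (by norm_num)
  have hχid : ∀ z : ℂ, ‖z‖ ≤ ε → χ z = z := by
    intro z hz
    have hz1 : z ∈ ball (0:ℂ) 1 := mem_ball_zero_iff.mpr (by linarith)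
    exact hχu z (hsub hz1) z hz1 (he z (mem_ball_zero_iff.mpr (by linarith)))
  set b := (1 + q) / 2 with hb
  have hb1 : 1 < b := by linarith
  have hbq : b < q := by linarith
  have hbsub : closedBall (0:ℂ) b ⊆ ball 0 q := closedBall_subset_ball hbq
  obtain ⟨S, hS1, hS2⟩ := conj_ext (ι := χ) (r := b) (hχc.mono hbsub) (hχi.mono hbsub)
    (hχo _ (ball_subset_closedBall.trans hbsub) isOpen_ball)
    (Rad 1 ε b one_pos hb1 hε0 (by linarith)) (fun z hz => radf_large hb1 (by linarith) hz)
  have hS3 : ∀ z : ℂ, ‖z‖ ≤ 1 → S (χ z) = ε * z := by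
    intro z hz
    rw [hS1 z (mem_closedBall_zero_iff.mpr (by linarith))]
    change χ (radf 1 ε b z) = _
    rw [radf_small hz, div_one]
    apply hχid
    rw [norm_mul, Complex.norm_real, Real.norm_eq_abs, abs_of_pos hε0]
    nlinarith
  have hS4 : ∀ x : ℂ, 1 ≤ ‖x‖ → S x = x := by
    intro x hx
    apply hS2
    rintro ⟨z, hz, rfl⟩
    have := mem_ball_zero_iff.mp (hχ1 z (hbsub (ball_subset_closedBall hz)))
    linarith
  have hiq : 1 / q < 1 := (div_lt_one hq0).mpr hq
  set T := Rad (1/q) ε 1 (by positivity) hiq hε0 hε1 with hT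
  set kt := T.trans S.symm with hkt
  have hkt1 : ∀ z : ℂ, 1 ≤ ‖z‖ → kt z = z := by
    intro z hz
    change S.symm (radf (1/q) ε 1 z) = z
    rw [radf_large hiq one_pos hz, S.symm_apply_eq, hS4 z hz]
  have hkt2 : ∀ z : ℂ, ‖z‖ ≤ 1 → kt (z / q) = χ z := by
    intro z hz
    change S.symm (radf (1/q) ε 1 (z / q)) = χ z
    rw [radf_small, S.symm_apply_eq, hS3 z hz]
    · push_cast; field_simp
    · rw [norm_div, Complex.norm_real, Real.norm_eq_abs, abs_of_pos hq0]
      gcongr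
  have hkt3 : ∀ z : ℂ, ‖z‖ < 1 ↔ ‖kt z‖ < 1 := by
    intro z
    constructor
    · intro h
      by_contra h2
      push Not at h2
      have := kt.injective (hkt1 _ h2)
      rw [this] at h2; linarith
    · intro h
      by_contra h2
      push Not at h2
      rw [hkt1 z h2] at h; linarith
  have hkt4 : ∀ z : ℂ, ‖z‖ ≤ 1 → kt z ∈ closedBall (0:ℂ) 1 := by
    intro z hz
    rw [mem_closedBall_zero_iff]
    rcases hz.lt_or_eq with h | h
    · exact ((hkt3 z).mp h).le
    · rw [hkt1 z h.ge]; exact hz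
  have hdiv : ∀ w : ℂ, ‖w / q‖ = ‖w‖ / q := by
    intro w; rw [norm_div, Complex.norm_real, Real.norm_eq_abs, abs_of_pos hq0]
  have hdiv1 : ∀ w ∈ closedBall (0:ℂ) q, ‖w / q‖ ≤ 1 := by
    intro w hw
    rw [hdiv, div_le_one hq0]; exact mem_closedBall_zero_iff.mp hw
  have hc1 : closedBall (0:ℂ) 1 ⊆ ball 0 q := closedBall_subset_ball hq
  set k : ℂ → ℂ := fun w => g (θ (kt (w / q))) with hk
  have hk1 : ∀ w : ℂ, ‖w‖ ≤ 1 → k w = θ w := by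
    intro w hw
    simp only [hk]
    rw [hkt2 w hw, hχ2 w (hc1 (mem_closedBall_zero_iff.mpr hw))]
  have hkO : k '' ball 0 1 = O := by
    rw [hO]
    apply image_congr
    intro w hw
    exact hk1 w (mem_ball_zero_iff.mp hw).le
  refine ⟨k, ?_, ?_, ?_, ?_, ?_, ?_⟩
  · refine g.continuous.comp_continuousOn (hθc.comp (kt.continuous.comp (by fun_prop)).continuousOn ?_)
    intro w hw
    exact hc1 (hkt4 _ (hdiv1 w hw))
  · intro x hx y hy hxy
    have h1 := hθi (hc1 (hkt4 _ (hdiv1 x hx))) (hc1 (hkt4 _ (hdiv1 y hy))) (g.injective hxy)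
    have h2 := kt.injective h1
    field_simp at h2
    exact h2
  · rw [hk1 0 (by simp), hθ0]
  · rw [hkO]; exact hOo
  · rw [hkO, ← hgO, hO]
    ext x
    constructor
    · rintro ⟨w, hw, rfl⟩
      refine ⟨_, ⟨kt (w / q), ?_, rfl⟩, rfl⟩
      rw [mem_ball_zero_iff, ← hkt3, hdiv, div_lt_one hq0]
      exact mem_ball_zero_iff.mp hw
    · rintro ⟨_, ⟨y, hy, rfl⟩, rfl⟩
      refine ⟨q * kt.symm y, ?_, ?_⟩
      · rw [mem_ball_zero_iff] at hy ⊢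
        rw [← kt.apply_symm_apply y, ← hkt3] at hy
        rw [norm_mul, Complex.norm_real, Real.norm_eq_abs, abs_of_pos hq0]
        nlinarith
      · simp only [hk]
        rw [mul_div_cancel_left₀ _ hqc, kt.apply_symm_apply]
  · intro w hw
    rw [hk1 w hw.le]
    simp only [hk]
    rw [mul_div_cancel_left₀ _ hqc, hkt1 w hw.ge]
    apply hg2
    rintro ⟨z, hz, h⟩
    have := hθi (hsub hz) (hc1 (mem_closedBall_zero_iff.mpr hw.le)) h
    rw [this, mem_ball_zero_iff] at hz
    linarith



/-! ## Part J: the quotient is a torus -/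

/-- reparametrization of the closed annulus to the half-open one -/
noncomputable def red (q : ℝ) (w : ℂ) : ℂ := if ‖w‖ < q then w else w / q

lemma fund_domain (f : ℂ ≃ₜ ℂ) (f0 : f 0 = 0) {ρ : ℝ} (hρ : 1 < ρ)
    (h3 : ∀ w, f (f (f w)) = (ρ:ℂ)^3 * w) {O : Set ℂ} (hO : IsOpen O) (h0 : (0:ℂ) ∈ O)
    (hOb : Bornology.IsBounded O) (hOf : O ⊆ f '' O) :
    (∀ x, x ≠ 0 → ∃ n : ℤ, ((f.toEquiv : Equiv.Perm ℂ) ^ n) x ∈ f '' O \ O) ∧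
    (∀ n : ℤ, ∀ x ∈ f '' O \ O, ((f.toEquiv : Equiv.Perm ℂ) ^ n) x ∈ f '' O \ O → n = 0) := by
  set P : Equiv.Perm ℂ := f.toEquiv with hP
  have hPf : ∀ x, P x = f x := fun x => rfl
  have hfO : ∀ x, x ∈ f '' O ↔ P⁻¹ x ∈ O := by
    intro x
    constructor
    · rintro ⟨y, hy, rfl⟩
      have : P⁻¹ (P y) = y := P.symm_apply_apply y
      rw [← hPf, this]; exact hy
    · intro h
      exact ⟨P⁻¹ x, h, P.apply_symm_apply x⟩
  have hz : ∀ (m n : ℤ) x, (P ^ (m + n)) x = (P ^ m) ((P ^ n) x) := by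
    intro m n x; rw [zpow_add, Equiv.Perm.mul_apply]
  have hstep : ∀ (n : ℤ) x, (P ^ n) x ∈ O → (P ^ (n - 1)) x ∈ O := by
    intro n x hx
    have := (hfO _).mp (hOf hx)
    rw [← zpow_neg_one, ← hz] at this
    rw [show n - 1 = -1 + n by ring]; exact this
  have hmono : ∀ (k : ℕ) (n : ℤ) x, (P ^ n) x ∈ O → (P ^ (n - k)) x ∈ O := by
    intro k
    induction k with
    | zero => intro n x h; simpa using h
    | succ k ih =>
      intro n x h
      have := hstep _ x (ih n x h)
      rw [show n - ((k + 1 : ℕ) : ℤ) = n - k - 1 by push_cast; ring]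
      exact this
  have hmono' : ∀ (m n : ℤ) x, m ≤ n → (P ^ n) x ∈ O → (P ^ m) x ∈ O := by
    intro m n x hmn h
    have := hmono (n - m).toNat n x h
    rwa [Int.toNat_of_nonneg (by linarith), sub_sub_cancel] at this
  have hρ0 : 0 < ρ := by linarith
  have hl : 1 < ρ ^ 3 := one_lt_pow₀ hρ (by norm_num)
  have hp3 : ∀ (k : ℕ) x, (P ^ (3 * k : ℤ)) x = ((ρ:ℂ)^3)^k * x := by
    intro k
    induction k with
    | zero => intro x; simp
    | succ k ih =>
      intro x
      rw [show (3 * ((k + 1 : ℕ) : ℤ)) = 3 * k + 3 by push_cast; ring, hz, ih]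
      have : (P ^ (3:ℤ)) x = (ρ:ℂ)^3 * x := by
        rw [show (3:ℤ) = 1 + (1 + 1) by norm_num, hz, hz, zpow_one, hPf, hPf, hPf, h3]
      rw [this]; ring
  have hρc : (ρ:ℂ) ≠ 0 := by exact_mod_cast hρ0.ne'
  have hp3' : ∀ (k : ℕ) x, (P ^ (-(3 * k) : ℤ)) x = (((ρ:ℂ)^3)^k)⁻¹ * x := by
    intro k x
    rw [zpow_neg, Equiv.Perm.inv_eq_iff_eq, hp3]
    field_simp
  have hnorm : ∀ k : ℕ, ‖((ρ:ℂ)^3)^k‖ = (ρ^3)^k := by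
    intro k; rw [norm_pow, norm_pow, Complex.norm_real, Real.norm_eq_abs, abs_of_pos hρ0]
  constructor
  · intro x hx
    have hxp : 0 < ‖x‖ := norm_pos_iff.mpr hx
    obtain ⟨C, hC⟩ := hOb.subset_closedBall 0
    obtain ⟨r, hr, hrO⟩ := Metric.isOpen_iff.mp hO 0 h0
    have ex1 : ∃ n : ℤ, (P ^ n) x ∈ O := by
      obtain ⟨k, hk⟩ := pow_unbounded_of_one_lt (‖x‖ / r) hl
      refine ⟨-(3 * k), hrO ?_⟩
      rw [hp3', mem_ball_zero_iff, norm_mul, norm_inv, hnorm]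
      rw [div_lt_iff₀ hr] at hk
      rw [inv_mul_lt_iff₀ (by positivity)]; exact hk
    have ex2 : ∃ n : ℤ, (P ^ n) x ∉ O := by
      obtain ⟨k, hk⟩ := pow_unbounded_of_one_lt (C / ‖x‖) hl
      refine ⟨3 * k, fun h => ?_⟩
      have := mem_closedBall_zero_iff.mp (hC h)
      rw [hp3, norm_mul, hnorm] at this
      rw [div_lt_iff₀ hxp] at hk
      linarith
    obtain ⟨n2, hn2⟩ := ex2
    obtain ⟨N, hN, hNmax⟩ := Int.exists_greatest_of_bdd (P := fun n : ℤ => (P ^ n) x ∈ O)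
      ⟨n2, fun z hz2 => by
        by_contra h
        push Not at h
        exact hn2 (hmono' _ _ x h.le hz2)⟩ ex1
    refine ⟨1 + N, ?_, ?_⟩
    · rw [hfO, ← zpow_neg_one, ← hz]; simpa using hN
    · intro h
      have := hNmax _ h
      linarith
  · intro n x hx hnx
    have a1 := (hfO _).mp hx.1
    have a2 := (hfO _).mp hnx.1
    rw [← zpow_neg_one] at a1 a2
    rw [← hz] at a2
    by_contra hne
    rcases lt_or_gt_of_ne hne with h | h
    · exact hnx.2 (hmono' n (-1) x (by linarith [Int.le_sub_one_of_lt h]) a1)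
    · exact hx.2 (by simpa using hmono' 0 (-1 + n) x (by linarith [Int.add_one_le_of_lt h]) a2)

lemma torus_of_annulus {M : Type} [TopologicalSpace M] [T2Space M] (Q : ℂ → M)
    (hQc : ContinuousOn Q {0}ᶜ) (hQs : ∀ m, ∃ x, x ≠ 0 ∧ Q x = m) (f : ℂ ≃ₜ ℂ) (f0 : f 0 = 0)
    (hQ : ∀ x y, x ≠ 0 → y ≠ 0 → (Q x = Q y ↔ ∃ n : ℤ, ((f.toEquiv : Equiv.Perm ℂ) ^ n) x = y))
    {ρ : ℝ} (hρ : 1 < ρ) (h3 : ∀ w, f (f (f w)) = (ρ:ℂ)^3 * w) {q : ℝ} (hq : 1 < q) {k : ℂ → ℂ}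
    (hkc : ContinuousOn k (closedBall 0 q)) (hki : InjOn k (closedBall 0 q)) (hk0 : k 0 = 0)
    (hko : IsOpen (k '' ball 0 1)) (hkf : k '' ball 0 q = f '' (k '' ball 0 1))
    (hkq : ∀ w : ℂ, ‖w‖ = 1 → k (q * w) = f (k w)) :
    Nonempty (M ≃ₜ Circle × Circle) := by
  have hq0 : 0 < q := by linarith
  have hlq : 0 < Real.log q := Real.log_pos hq
  have hqc : (q:ℂ) ≠ 0 := by exact_mod_cast hq0.ne'
  have hbsub : ball (0:ℂ) q ⊆ closedBall 0 q := ball_subset_closedBall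
  have hsub1 : ball (0:ℂ) 1 ⊆ ball 0 q := ball_subset_ball hq.le
  obtain ⟨hfd1, hfd2⟩ := fund_domain f f0 hρ h3 hko ⟨0, by simp, hk0⟩
    (((isCompact_closedBall (0:ℂ) q).image_of_continuousOn hkc).isBounded.subset
      (image_mono (hsub1.trans hbsub))) (by rw [← hkf]; exact image_mono hsub1)
  set D : Set ℂ := {w | 1 ≤ ‖w‖ ∧ ‖w‖ < q} with hD
  have hkD : k '' D = f '' (k '' ball 0 1) \ (k '' ball 0 1) := by
    rw [← hkf]
    ext x
    constructor
    · rintro ⟨w, ⟨h1, h2⟩, rfl⟩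
      have hwq : w ∈ ball (0:ℂ) q := mem_ball_zero_iff.mpr h2
      refine ⟨⟨w, hwq, rfl⟩, ?_⟩
      rintro ⟨v, hv, hvw⟩
      have := hki (hbsub (hsub1 hv)) (hbsub hwq) hvw
      rw [this, mem_ball_zero_iff] at hv
      linarith
    · rintro ⟨⟨w, hw, rfl⟩, h⟩
      refine ⟨w, ⟨?_, mem_ball_zero_iff.mp hw⟩, rfl⟩
      by_contra h1
      push Not at h1
      exact h ⟨w, mem_ball_zero_iff.mpr h1, rfl⟩
  -- compact annulus
  set A : Set ℂ := {w | 1 ≤ ‖w‖ ∧ ‖w‖ ≤ q} with hA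
  have hAc : IsCompact A := by
    have : A = closedBall 0 q ∩ {w | 1 ≤ ‖w‖} := by
      ext w; simp [hA, and_comm]
    rw [this]
    exact (isCompact_closedBall 0 q).inter_right (isClosed_le continuous_const continuous_norm)
  have hAcs : CompactSpace A := isCompact_iff_compactSpace.mp hAc
  have hAq : A ⊆ closedBall 0 q := fun w hw => mem_closedBall_zero_iff.mpr hw.2
  have hA0 : ∀ w ∈ A, w ≠ 0 := by
    rintro w hw rfl
    have := hw.1
    rw [norm_zero] at this
    linarith
  have hkA0 : ∀ w ∈ A, k w ≠ 0 := by
    intro w hw h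
    exact hA0 w hw (hki (hAq hw) (mem_closedBall_self hq0.le) (h.trans hk0.symm))
  have hDA : D ⊆ A := fun w hw => ⟨hw.1, hw.2.le⟩
  -- reduction
  have hred : ∀ w ∈ A, red q w ∈ D := by
    intro w hw
    unfold red
    split_ifs with h
    · exact ⟨hw.1, h⟩
    · have : ‖w‖ = q := le_antisymm hw.2 (not_lt.mp h)
      have h2 : ‖w / q‖ = 1 := by
        rw [norm_div, Complex.norm_real, Real.norm_eq_abs, abs_of_pos hq0, this, div_self hq0.ne']
      exact ⟨h2.ge, by rw [h2]; exact hq⟩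
  have hredQ : ∀ w ∈ A, Q (k w) = Q (k (red q w)) := by
    intro w hw
    have hrw := hred w hw
    unfold red at hrw ⊢
    split_ifs with h
    · rfl
    · rw [if_neg h] at hrw
      have : ‖w‖ = q := le_antisymm hw.2 (not_lt.mp h)
      have h2 : ‖w / q‖ = 1 := by
        rw [norm_div, Complex.norm_real, Real.norm_eq_abs, abs_of_pos hq0, this, div_self hq0.ne']
      have h3 := hkq _ h2
      rw [mul_div_cancel₀ _ hqc] at h3
      symm
      rw [hQ _ _ (hkA0 _ (hDA hrw)) (hkA0 _ hw)]
      exact ⟨1, by rw [zpow_one]; exact h3.symm⟩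
  have hQD : ∀ w ∈ D, ∀ w' ∈ D, Q (k w) = Q (k w') → w = w' := by
    intro w hw w' hw' h
    rw [hQ _ _ (hkA0 _ (hDA hw)) (hkA0 _ (hDA hw'))] at h
    obtain ⟨n, hn⟩ := h
    have m1 : k w ∈ f '' (k '' ball 0 1) \ (k '' ball 0 1) := hkD ▸ ⟨w, hw, rfl⟩
    have m2 : k w' ∈ f '' (k '' ball 0 1) \ (k '' ball 0 1) := hkD ▸ ⟨w', hw', rfl⟩
    have := hfd2 n _ m1 (by rw [hn]; exact m2)
    rw [this, zpow_zero] at hn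
    exact hki (hAq (hDA hw)) (hAq (hDA hw')) hn
  -- the two maps
  set α : A → M := fun w => Q (k w) with hα
  set β : A → Circle × Circle := fun w =>
    (⟨(w:ℂ) / ‖(w:ℂ)‖, by
      have : ‖(w:ℂ)‖ ≠ 0 := norm_ne_zero_iff.mpr (hA0 w w.2)
      rw [Submonoid.unitSphere, ← SetLike.mem_coe]
      change _ ∈ sphere (0:ℂ) 1
      rw [mem_sphere_zero_iff_norm, norm_div, Complex.norm_real, norm_norm, div_self this]⟩,
     Circle.exp (2 * Real.pi * (Real.log ‖(w:ℂ)‖ / Real.log q))) with hβ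
  have hαc : Continuous α := by
    have h1 : Continuous fun w : A => k w :=
      (hkc.mono hAq).comp_continuous continuous_subtype_val (fun w => w.2)
    exact hQc.comp_continuous h1 (fun w => hkA0 w w.2)
  have hαs : Function.Surjective α := by
    intro m
    obtain ⟨x, hx, rfl⟩ := hQs m
    obtain ⟨n, hn⟩ := hfd1 x hx
    rw [← hkD] at hn
    obtain ⟨w, hw, hkw⟩ := hn
    refine ⟨⟨w, hDA hw⟩, ?_⟩
    symm
    simp only [hα]
    rw [hQ _ _ hx (hkA0 _ (hDA hw))]
    exact ⟨n, hkw.symm⟩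
  have hβc : Continuous β := by
    refine Continuous.prodMk ?_ ?_
    · refine Continuous.subtype_mk ?_ _
      refine continuous_subtype_val.div (by fun_prop) ?_
      intro w
      exact_mod_cast norm_ne_zero_iff.mpr (hA0 w w.2)
    · refine Circle.exp.continuous.comp (continuous_const.mul (Continuous.div_const ?_ _))
      exact (continuous_norm.comp continuous_subtype_val).log
        (fun w => norm_ne_zero_iff.mpr (hA0 w w.2))
  have hβs : Function.Surjective β := by
    rintro ⟨u, v⟩
    obtain ⟨t, ht0, ht1, rfl⟩ : ∃ t : ℝ, 0 ≤ t ∧ t ≤ 1 ∧ Circle.exp (2 * Real.pi * t) = v := by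
      obtain ⟨s, rfl⟩ := Circle.exp_surjective v
      refine ⟨Int.fract (s / (2 * Real.pi)), Int.fract_nonneg _, (Int.fract_lt_one _).le, ?_⟩
      rw [Circle.exp_eq_exp]
      refine ⟨-⌊s / (2 * Real.pi)⌋, ?_⟩
      have hpi := Real.pi_pos
      rw [Int.fract]; push_cast; field_simp; ring
    have hn : ‖((q ^ t : ℝ) : ℂ) * u‖ = q ^ t := by
      rw [norm_mul, Complex.norm_real, Circle.norm_coe, mul_one, Real.norm_eq_abs,
        abs_of_pos (Real.rpow_pos_of_pos hq0 t)]
    refine ⟨⟨((q ^ t : ℝ) : ℂ) * u, ?_, ?_⟩, ?_⟩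
    · rw [hn]; exact Real.one_le_rpow hq.le ht0
    · rw [hn]
      calc q ^ t ≤ q ^ (1:ℝ) := Real.rpow_le_rpow_of_exponent_le hq.le ht1
        _ = q := Real.rpow_one q
    · simp only [hβ]
      refine Prod.ext ?_ ?_
      · apply Circle.ext
        change ((q ^ t : ℝ) : ℂ) * u / ‖((q ^ t : ℝ) : ℂ) * u‖ = u
        rw [hn]
        have : ((q ^ t : ℝ) : ℂ) ≠ 0 := by exact_mod_cast (Real.rpow_pos_of_pos hq0 t).ne'
        field_simp
      · change Circle.exp (2 * Real.pi * (Real.log ‖((q ^ t : ℝ) : ℂ) * u‖ / Real.log q)) = _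
        rw [hn, Real.log_rpow hq0, mul_div_assoc, div_self hlq.ne', mul_one]
  -- same fibres
  have hβ1 : ∀ w w' : A, (β w = β w' ↔ (w:ℂ) / ‖(w:ℂ)‖ = (w':ℂ) / ‖(w':ℂ)‖ ∧
      ∃ m : ℤ, Real.log ‖(w:ℂ)‖ / Real.log q = Real.log ‖(w':ℂ)‖ / Real.log q + m) := by
    intro w w'
    rw [hβ, Prod.ext_iff]
    refine and_congr ?_ ?_
    · rw [Circle.ext_iff]
    · rw [Circle.exp_eq_exp]
      refine exists_congr fun m => ?_
      have hpi := Real.pi_pos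
      constructor
      · intro h
        have : 2 * Real.pi * (Real.log ‖(w:ℂ)‖ / Real.log q) =
          2 * Real.pi * (Real.log ‖(w':ℂ)‖ / Real.log q + m) := by rw [h]; ring
        exact mul_left_cancel₀ (by positivity) this
      · intro h
        rw [h]; ring
  have hlogD : ∀ w ∈ D, 0 ≤ Real.log ‖w‖ / Real.log q ∧ Real.log ‖w‖ / Real.log q < 1 := by
    intro w hw
    refine ⟨div_nonneg (Real.log_nonneg hw.1) hlq.le, ?_⟩
    rw [div_lt_one hlq]
    exact Real.log_lt_log (by linarith [hw.1]) hw.2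
  have hβD : ∀ w w' : A, (w:ℂ) ∈ D → (w':ℂ) ∈ D → β w = β w' → w = w' := by
    intro w w' hw hw' h
    rw [hβ1] at h
    obtain ⟨h1, m, hm⟩ := h
    obtain ⟨a1, a2⟩ := hlogD _ hw
    obtain ⟨b1, b2⟩ := hlogD _ hw'
    have hm0 : m = 0 := by
      have l1 : (-1:ℝ) < m := by linarith
      have l2 : (m:ℝ) < 1 := by linarith
      have l1' : (-1:ℤ) < m := by exact_mod_cast l1
      have l2' : m < 1 := by exact_mod_cast l2
      omega
    rw [hm0, Int.cast_zero, add_zero, div_left_inj' hlq.ne'] at hm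
    have p1 : 0 < ‖(w:ℂ)‖ := by linarith [hw.1]
    have p2 : 0 < ‖(w':ℂ)‖ := by linarith [hw'.1]
    have hn := Real.log_injOn_pos p1 p2 hm
    rw [hn] at h1
    have p3 : ((‖(w':ℂ)‖ : ℝ) : ℂ) ≠ 0 := by exact_mod_cast p2.ne'
    exact Subtype.ext ((div_left_inj' p3).mp h1)
  have hβred : ∀ w : A, β w = β ⟨red q w, hDA (hred w w.2)⟩ := by
    intro w
    rw [hβ1]
    have hw := w.2
    change _ = red q w / ‖red q w‖ ∧ ∃ m : ℤ, _ = Real.log ‖red q w‖ / Real.log q + m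
    unfold red
    split_ifs with h
    · exact ⟨rfl, 0, by simp⟩
    · have h1 : ‖(w:ℂ)‖ = q := le_antisymm hw.2 (not_lt.mp h)
      have h2 : ‖(w:ℂ) / q‖ = 1 := by
        rw [norm_div, Complex.norm_real, Real.norm_eq_abs, abs_of_pos hq0, h1, div_self hq0.ne']
      rw [h2, h1]
      refine ⟨by simp, 1, by simp [hlq.ne']⟩
  have hker : Setoid.ker α = Setoid.ker β := by
    ext w w'
    rw [Setoid.ker_def, Setoid.ker_def]
    have key1 : α w = α w' ↔ red q w = red q w' := by
      simp only [hα]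
      rw [hredQ w w.2, hredQ w' w'.2]
      exact ⟨hQD _ (hred w w.2) _ (hred w' w'.2), fun h => by rw [h]⟩
    have key2 : β w = β w' ↔ red q w = red q w' := by
      rw [hβred w, hβred w']
      constructor
      · intro h
        exact congrArg Subtype.val (hβD ⟨red q w, _⟩ ⟨red q w', _⟩ (hred w w.2) (hred w' w'.2) h)
      · intro h
        congr 1
        exact Subtype.ext h
    rw [key1, key2]
  have qα : IsQuotientMap α := hαc.isClosedMap.isQuotientMap hαc hαs
  have qβ : IsQuotientMap β := hβc.isClosedMap.isQuotientMap hβc hβs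
  have e1 := IsQuotientMap.homeomorph (f := ⟨α, hαc⟩) qα
  have e2 := IsQuotientMap.homeomorph (f := ⟨β, hβc⟩) qβ
  change Quotient (Setoid.ker α) ≃ₜ M at e1
  change Quotient (Setoid.ker β) ≃ₜ _ at e2
  rw [hker] at e1
  exact ⟨e1.symm.trans e2⟩



/-! ## Part K: from the strip to the punctured plane -/

lemma exp_cont_of_comp {M : Type*} [TopologicalSpace M] (Q : ℂ → M)
    (hQ : Continuous fun z => Q (Complex.exp z)) : ContinuousOn Q {0}ᶜ := by
  intro w hw
  apply ContinuousAt.continuousWithinAt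
  have hw0 : w ≠ 0 := hw
  rw [ContinuousAt, _root_.tendsto_nhds]
  intro V hV hwV
  have h1 : IsOpen (Complex.exp '' ((fun z => Q (Complex.exp z)) ⁻¹' V)) :=
    Complex.isOpenMap_exp _ (hV.preimage hQ)
  have h2 : w ∈ Complex.exp '' ((fun z => Q (Complex.exp z)) ⁻¹' V) :=
    ⟨Complex.log w, by rw [mem_preimage, Complex.exp_log hw0]; exact hwV, Complex.exp_log hw0⟩
  filter_upwards [h1.mem_nhds h2] with y hy
  obtain ⟨z, hz, rfl⟩ := hy
  exact hz

lemma per_int {g : ℂ → ℂ} (hper : ∀ z, g (z + 2 * Real.pi * Complex.I) = g z + 2 * Real.pi * Complex.I) :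
    ∀ (n : ℤ) z, g (z + n * (2 * Real.pi * Complex.I)) = g z + n * (2 * Real.pi * Complex.I) := by
  intro n
  induction n using Int.induction_on with
  | zero => intro z; simp
  | succ n ih =>
    intro z
    have := hper (z + n * (2 * Real.pi * Complex.I))
    rw [Int.cast_natCast] at ih
    rw [ih] at this
    push_cast
    rw [add_mul, one_mul, ← add_assoc, this]; ring
  | pred n ih =>
    intro z
    have := hper (z + (-(n:ℂ) - 1) * (2 * Real.pi * Complex.I))
    have ih := ih z
    push_cast at ih ⊢
    have e : z + (-(n:ℂ) - 1) * (2 * Real.pi * Complex.I) + 2 * Real.pi * Complex.I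
      = z + -(n:ℂ) * (2 * Real.pi * Complex.I) := by ring
    rw [e, ih] at this
    linear_combination -this

lemma wplane_aux {g : ℂ → ℂ} (hg : Continuous g)
    (hper : ∀ z, g (z + 2 * Real.pi * Complex.I) = g z + 2 * Real.pi * Complex.I)
    {c : ℝ} (hb : ∀ z, ‖g z - z‖ ≤ c) :
    ∃ G : ℂ → ℂ, Continuous G ∧ G 0 = 0 ∧ ∀ z, G (Complex.exp z) = Complex.exp (g z) := by
  classical
  set G : ℂ → ℂ := fun w => if w = 0 then 0 else Complex.exp (g (Complex.log w)) with hG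
  have h0 : G 0 = 0 := by simp [hG]
  have h1 : ∀ z, G (Complex.exp z) = Complex.exp (g z) := by
    intro z
    simp only [hG]
    rw [if_neg (Complex.exp_ne_zero z)]
    obtain ⟨n, hn⟩ := Complex.exp_eq_exp_iff_exists_int.mp (Complex.exp_log (Complex.exp_ne_zero z))
    rw [hn, per_int hper, Complex.exp_eq_exp_iff_exists_int]
    exact ⟨n, rfl⟩
  have hcont : ContinuousOn G {0}ᶜ := by
    apply exp_cont_of_comp
    simp only [h1]
    fun_prop
  have hbound : ∀ w, ‖G w‖ ≤ Real.exp c * ‖w‖ := by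
    intro w
    by_cases hw : w = 0
    · rw [hw, h0]; simp
    · rw [← Complex.exp_log hw, h1, Complex.norm_exp, Complex.norm_exp, ← Real.exp_add]
      apply Real.exp_le_exp.mpr
      have := (Complex.abs_re_le_norm (g (Complex.log w) - Complex.log w)).trans (hb _)
      rw [Complex.sub_re] at this
      linarith [(abs_le.mp this).2]
  refine ⟨G, ?_, h0, h1⟩
  rw [continuous_iff_continuousAt]
  intro w
  by_cases hw : w = 0
  · rw [hw, ContinuousAt, h0]
    refine squeeze_zero_norm hbound ?_
    have : Continuous fun w : ℂ => Real.exp c * ‖w‖ := by fun_prop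
    have h2 := this.tendsto 0
    simpa using h2
  · exact hcont.continuousAt (isOpen_compl_singleton.mem_nhds hw)

lemma wplane (ft : ℂ ≃ₜ ℂ)
    (hper : ∀ z, ft (z + 2 * Real.pi * Complex.I) = ft z + 2 * Real.pi * Complex.I)
    {c : ℝ} (hb : ∀ z, ‖ft z - z‖ ≤ c) :
    ∃ f : ℂ ≃ₜ ℂ, f 0 = 0 ∧ ∀ z, f (Complex.exp z) = Complex.exp (ft z) := by
  have hper' : ∀ z, ft.symm (z + 2 * Real.pi * Complex.I) = ft.symm z + 2 * Real.pi * Complex.I := by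
    intro z
    rw [ft.symm_apply_eq, hper, ft.apply_symm_apply]
  have hb' : ∀ z, ‖ft.symm z - z‖ ≤ c := by
    intro z
    have := hb (ft.symm z)
    rwa [ft.apply_symm_apply, norm_sub_rev] at this
  obtain ⟨G, hG, hG0, hG1⟩ := wplane_aux ft.continuous hper hb
  obtain ⟨G', hG', hG0', hG1'⟩ := wplane_aux ft.symm.continuous hper' hb'
  refine ⟨⟨⟨G, G', ?_, ?_⟩, hG, hG'⟩, hG0, hG1⟩
  · intro w
    by_cases hw : w = 0
    · rw [hw, hG0, hG0']
    · rw [← Complex.exp_log hw, hG1, hG1', ft.symm_apply_apply]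
  · intro w
    by_cases hw : w = 0
    · rw [hw, hG0', hG0]
    · rw [← Complex.exp_log hw, hG1', hG1, ft.apply_symm_apply]

lemma torus_of_strip {M : Type} [TopologicalSpace M] [T2Space M] (π : ℂ → M)
    (hπc : Continuous π) (hπs : Function.Surjective π) (ft : ℂ ≃ₜ ℂ)
    (hper : ∀ z, ft (z + 2 * Real.pi * Complex.I) = ft z + 2 * Real.pi * Complex.I)
    {c : ℝ} (hb : ∀ z, ‖ft z - z‖ ≤ c) (h3 : ∀ z, ft (ft (ft z)) = z + 1)
    (hπ : ∀ z z', π z = π z' ↔ ∃ n m : ℤ,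
      z' = ((ft.toEquiv : Equiv.Perm ℂ) ^ n) z + m * (2 * Real.pi * Complex.I)) :
    Nonempty (M ≃ₜ Circle × Circle) := by
  obtain ⟨f, f0, hf⟩ := wplane ft hper hb
  set ρ := Real.exp (1 / 3) with hρdef
  have hρ : 1 < ρ := Real.one_lt_exp_iff.mpr (by norm_num)
  have hρ3 : (ρ:ℂ)^3 = Complex.exp 1 := by
    rw [hρdef, Complex.ofReal_exp, ← Complex.exp_nat_mul]; push_cast; norm_num
  have hf3 : ∀ w, f (f (f w)) = (ρ:ℂ)^3 * w := by
    intro w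
    by_cases hw : w = 0
    · rw [hw, f0, f0, f0, mul_zero]
    · rw [← Complex.exp_log hw, hf, hf, hf, h3, hρ3, ← Complex.exp_add, add_comm]
  obtain ⟨q, θ, hq, hθc, hθi, hθ0, hθo, -, hθf⟩ := nice_disc f f0 hρ hf3
  obtain ⟨g, hg1, hg2⟩ := exists_fprime f ft hb hf f0
  have hl : 1 < ρ ^ 3 := one_lt_pow₀ hρ (by norm_num)
  obtain ⟨g, hg1, hg2⟩ := exists_fprime_in f g hl (by
      intro x
      push_cast
      rw [← hf3, ← hf3]) hg1 hg2 (O := θ '' ball 0 1)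
    (hθo _ (ball_subset_ball hq.le) isOpen_ball) ⟨0, by simp, hθ0⟩
  obtain ⟨k, hkc, hki, hk0, hko, hkf, hkq⟩ := annulus f g hq hθc hθi hθ0 hθo hθf hg1 hg2
  -- the map Q
  set Q : ℂ → M := fun w => π (Complex.log w) with hQ
  have hQe : ∀ z, Q (Complex.exp z) = π z := by
    intro z
    obtain ⟨n, hn⟩ := Complex.exp_eq_exp_iff_exists_int.mp (Complex.exp_log (Complex.exp_ne_zero z))
    simp only [hQ]
    symm
    rw [hπ]
    exact ⟨0, n, by simpa using hn⟩
  have hQc : ContinuousOn Q {0}ᶜ := by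
    apply exp_cont_of_comp
    simp only [hQe]
    exact hπc
  have hpowN : ∀ (n : ℕ) z, ((f.toEquiv : Equiv.Perm ℂ) ^ n) (Complex.exp z) =
      Complex.exp (((ft.toEquiv : Equiv.Perm ℂ) ^ n) z) := by
    intro n
    induction n with
    | zero => intro z; simp
    | succ n ih =>
      intro z
      rw [pow_succ, pow_succ, Equiv.Perm.mul_apply, Equiv.Perm.mul_apply]
      have : (f.toEquiv : Equiv.Perm ℂ) (Complex.exp z) = Complex.exp ((ft.toEquiv : Equiv.Perm ℂ) z) :=
        hf z
      rw [this, ih]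
  have hpow : ∀ (n : ℤ) z, ((f.toEquiv : Equiv.Perm ℂ) ^ n) (Complex.exp z) =
      Complex.exp (((ft.toEquiv : Equiv.Perm ℂ) ^ n) z) := by
    intro n z
    obtain ⟨n, rfl | rfl⟩ := n.eq_nat_or_neg
    · rw [zpow_natCast, zpow_natCast, hpowN]
    · rw [zpow_neg, zpow_natCast, zpow_neg, zpow_natCast, Equiv.Perm.inv_eq_iff_eq, hpowN]
      congr 1
      exact (Equiv.apply_symm_apply _ _).symm
  refine torus_of_annulus Q hQc ?_ f f0 ?_ hρ hf3 hq hkc hki hk0 hko hkf hkq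
  · intro m
    obtain ⟨z, rfl⟩ := hπs m
    exact ⟨Complex.exp z, Complex.exp_ne_zero z, hQe z⟩
  · intro x y hx hy
    rw [← Complex.exp_log hx, ← Complex.exp_log hy, hQe, hQe, hπ]
    refine exists_congr fun n => ?_
    rw [hpow, eq_comm, Complex.exp_eq_exp_iff_exists_int]



/-! ## Part L: lifting to the plane -/

noncomputable def p0 (z : ℂ) : Circle × Circle :=
  (Circle.exp (2 * Real.pi * z.re), Circle.exp (2 * Real.pi * z.im))

/-- lattice point -/
def lat (a b : ℤ) : ℂ := a + b * Complex.I

lemma lat_re (a b : ℤ) : (lat a b).re = a := by simp [lat]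
lemma lat_im (a b : ℤ) : (lat a b).im = b := by simp [lat]
lemma lat_inj {a b c d : ℤ} (h : lat a b = lat c d) : a = c ∧ b = d := by
  have h1 := congrArg Complex.re h
  have h2 := congrArg Complex.im h
  rw [lat_re, lat_re] at h1
  rw [lat_im, lat_im] at h2
  exact ⟨by exact_mod_cast h1, by exact_mod_cast h2⟩
lemma lat_add (a b c d : ℤ) : lat a b + lat c d = lat (a + c) (b + d) := by
  simp only [lat]; push_cast; ring

lemma p0_cont : Continuous p0 := by
  unfold p0
  refine Continuous.prodMk ?_ ?_
  · exact Circle.exp.continuous.comp (continuous_const.mul Complex.continuous_re)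
  · exact Circle.exp.continuous.comp (continuous_const.mul Complex.continuous_im)

lemma circ_eq {s t : ℝ} : Circle.exp (2 * Real.pi * s) = Circle.exp (2 * Real.pi * t) ↔
    ∃ m : ℤ, t = s + m := by
  rw [eq_comm, Circle.exp_eq_exp]
  refine exists_congr fun m => ?_
  have hpi := Real.pi_pos
  constructor
  · intro h
    have : 2 * Real.pi * t = 2 * Real.pi * (s + m) := by rw [h]; ring
    exact mul_left_cancel₀ (by positivity) this
  · intro h
    rw [h]; ring

lemma p0_eq {z z' : ℂ} : p0 z = p0 z' ↔ ∃ a b : ℤ, z' = z + lat a b := by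
  rw [p0, p0, Prod.ext_iff]
  simp only
  rw [circ_eq, circ_eq]
  constructor
  · rintro ⟨⟨a, ha⟩, ⟨b, hb⟩⟩
    exact ⟨a, b, Complex.ext (by rw [Complex.add_re, lat_re, ha]) (by rw [Complex.add_im, lat_im, hb])⟩
  · rintro ⟨a, b, rfl⟩
    exact ⟨⟨a, by rw [Complex.add_re, lat_re]⟩, ⟨b, by rw [Complex.add_im, lat_im]⟩⟩

lemma p0_surj : Function.Surjective p0 := by
  rintro ⟨u, v⟩
  obtain ⟨s, rfl⟩ := Circle.exp_surjective u
  obtain ⟨t, rfl⟩ := Circle.exp_surjective v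
  have hpi := Real.pi_pos.ne'
  refine ⟨⟨s / (2 * Real.pi), t / (2 * Real.pi)⟩, ?_⟩
  rw [p0]
  simp only
  congr 2 <;> field_simp

lemma lift_circle {g : ℂ → Circle} (hg : Continuous g) :
    ∃ L : ℂ → ℝ, Continuous L ∧ ∀ z, Circle.exp (2 * Real.pi * L z) = g z := by
  obtain ⟨L, hL, hLe⟩ := logC (u := fun z => (g z : ℂ)) (by fun_prop) (fun z => Circle.coe_ne_zero _)
  have hpi := Real.pi_pos.ne'
  refine ⟨fun z => (L z).im / (2 * Real.pi), by fun_prop, ?_⟩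
  intro z
  have h1 : 2 * Real.pi * ((L z).im / (2 * Real.pi)) = (L z).im := by field_simp
  rw [h1]
  apply Circle.ext
  rw [Circle.coe_exp, ← hLe z]
  congr 1
  have h2 : (L z).re = 0 := by
    have := congrArg norm (hLe z)
    rw [Complex.norm_exp, Circle.norm_coe, Real.exp_eq_one_iff] at this
    exact this
  apply Complex.ext <;> simp [h2]

lemma lift_torus {g : ℂ → Circle × Circle} (hg : Continuous g) :
    ∃ L : ℂ → ℂ, Continuous L ∧ ∀ z, p0 (L z) = g z := by
  obtain ⟨L1, h1, e1⟩ := lift_circle (continuous_fst.comp hg)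
  obtain ⟨L2, h2, e2⟩ := lift_circle (continuous_snd.comp hg)
  refine ⟨fun z => L1 z + L2 z * Complex.I, by fun_prop, ?_⟩
  intro z
  rw [p0]
  simp only [Complex.add_re, Complex.ofReal_re, Complex.re_ofReal_mul, Complex.I_re, mul_zero, add_zero,
    Complex.add_im, Complex.ofReal_im, Complex.im_ofReal_mul, Complex.I_im, mul_one, zero_add]
  rw [e1, e2]
  rfl

lemma int_const {h : ℂ → ℝ} (hc : Continuous h) (hi : ∀ z, ∃ m : ℤ, h z = m) (x y : ℂ) : h x = h y := by
  have := log_diff_const (X := ℂ) (S := univ) isPreconnected_univ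
    (g := fun z => 2 * Real.pi * Complex.I * h z) (h := fun _ => 0)
    (by fun_prop) (by fun_prop) (fun z _ => by
      obtain ⟨m, hm⟩ := hi z
      simp only [hm]
      rw [Complex.exp_zero, Complex.exp_eq_one_iff]
      exact ⟨m, by push_cast; ring⟩) (mem_univ x) (mem_univ y)
  simp only [sub_zero] at this
  have h2 : (2 * Real.pi * Complex.I : ℂ) ≠ 0 := by simp [Real.pi_ne_zero]
  exact_mod_cast mul_left_cancel₀ h2 this

lemma lift_unique {g h : ℂ → ℂ} (hg : Continuous g) (hh : Continuous h)
    (he : ∀ z, p0 (g z) = p0 (h z)) : ∃ a b : ℤ, ∀ z, h z = g z + lat a b := by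
  obtain ⟨a, b, hab⟩ := p0_eq.mp (he 0)
  refine ⟨a, b, fun z => ?_⟩
  have hd : ∀ z, ∃ a b : ℤ, h z - g z = lat a b := by
    intro z
    obtain ⟨a, b, hab⟩ := p0_eq.mp (he z)
    exact ⟨a, b, by rw [hab]; ring⟩
  have h1 := int_const (h := fun z => (h z - g z).re) (by fun_prop) (fun z => by
    obtain ⟨a, b, hab⟩ := hd z
    exact ⟨a, by rw [hab, lat_re]⟩) z 0
  have h2 := int_const (h := fun z => (h z - g z).im) (by fun_prop) (fun z => by
    obtain ⟨a, b, hab⟩ := hd z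
    exact ⟨b, by rw [hab, lat_im]⟩) z 0
  have h3 : h z - g z = h 0 - g 0 := Complex.ext h1 h2
  rw [hab] at h3
  linear_combination h3

lemma shift_int {g : ℂ → ℂ} {u v : ℂ} (hper : ∀ z, g (z + u) = g z + v) :
    ∀ (n : ℤ) z, g (z + n * u) = g z + n * v := by
  intro n
  induction n using Int.induction_on with
  | zero => intro z; simp
  | succ n ih =>
    intro z
    have := hper (z + n * u)
    rw [Int.cast_natCast] at ih
    rw [ih] at this
    push_cast
    rw [add_mul, one_mul, ← add_assoc, this]; ring
  | pred n ih =>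
    intro z
    have := hper (z + (-(n:ℂ) - 1) * u)
    have ih := ih z
    push_cast at ih ⊢
    have e : z + (-(n:ℂ) - 1) * u + u = z + -(n:ℂ) * u := by ring
    rw [e, ih] at this
    linear_combination -this

lemma int_matrix {a b c d x y : ℤ}
    (e11 : a * (a * a + b * c) + b * (c * a + d * c) = 1)
    (e12 : a * (a * b + b * d) + b * (c * b + d * d) = 0)
    (e21 : c * (a * a + b * c) + d * (c * a + d * c) = 0)
    (e22 : c * (a * b + b * d) + d * (c * b + d * d) = 1)
    (h1 : a * x + b * y = x) (h2 : c * x + d * y = y) (hxy : ¬ (x = 0 ∧ y = 0)) :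
    a = 1 ∧ b = 0 ∧ c = 0 ∧ d = 1 := by
  have hD3 : (a * d - b * c) ^ 3 = 1 := by
    have : (a * d - b * c) ^ 3 = (a * (a * a + b * c) + b * (c * a + d * c)) *
      (c * (a * b + b * d) + d * (c * b + d * d)) - (a * (a * b + b * d) + b * (c * b + d * d)) *
      (c * (a * a + b * c) + d * (c * a + d * c)) := by ring
    rw [this, e11, e12, e21, e22]; ring
  have hD : a * d - b * c = 1 := by
    generalize a * d - b * c = D at hD3
    have : (D - 1) * (D ^ 2 + D + 1) = 0 := by linear_combination hD3
    rcases mul_eq_zero.mp this with h | h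
    · linarith
    · nlinarith [sq_nonneg (2 * D + 1)]
  have ht : a + d = 2 := by
    have k1 : ((a - 1) * (d - 1) - b * c) * x = 0 := by linear_combination (d - 1) * h1 - b * h2
    have k2 : ((a - 1) * (d - 1) - b * c) * y = 0 := by linear_combination (a - 1) * h2 - c * h1
    have k : (a - 1) * (d - 1) - b * c = 0 := by
      by_contra hne
      exact hxy ⟨(mul_eq_zero.mp k1).resolve_left hne, (mul_eq_zero.mp k2).resolve_left hne⟩
    linear_combination hD - k
  have hd : d = 2 - a := by linarith
  subst hd
  have hb : b = 0 := by
    have : 3 * b = 0 := by linear_combination e12 + b * hD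
    linarith
  have hc : c = 0 := by
    have : 3 * c = 0 := by linear_combination e21 + c * hD
    linarith
  subst hb hc
  have : (a - 1) ^ 2 = 0 := by linear_combination -hD
  have ha : a = 1 := by
    have := pow_eq_zero_iff (two_ne_zero) |>.mp this
    linarith
  subst ha
  exact ⟨rfl, rfl, rfl, by norm_num⟩

/-- Any lift can be normalised. -/
lemma good_lift (ψ : Circle × Circle → Circle × Circle) (hψ : Continuous ψ)
    (hψ3 : ∀ x, ψ (ψ (ψ x)) = x) (hfix : ∀ x, ψ x ≠ x) :
    ∃ (f : ℂ → ℂ) (x y : ℤ), Continuous f ∧ (∀ z, p0 (f z) = ψ (p0 z)) ∧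
      (∀ z, f (f (f z)) = z + lat x y) ∧ (∀ z (m n : ℤ), f (z + lat m n) = f z + lat m n) ∧
      |x| ≤ 1 ∧ |y| ≤ 1 ∧ ¬ (x = 0 ∧ y = 0) := by
  obtain ⟨f, hf, hfp⟩ := lift_torus (hψ.comp p0_cont)
  replace hfp : ∀ z, p0 (f z) = ψ (p0 z) := hfp
  have nofix : ∀ g : ℂ → ℂ, Continuous g → (∀ z, p0 (g z) = ψ (p0 z)) → ¬ ∀ z, g (g (g z)) = z := by
    intro g hg hgp h3
    refine no_free_order_three g hg h3 ?_
    intro z hz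
    apply hfix (p0 z)
    rw [← hgp, hz]
  have hper : ∀ z a b, p0 (z + lat a b) = p0 z := fun z a b => (p0_eq.mpr ⟨a, b, rfl⟩).symm
  obtain ⟨a, c, h1⟩ := lift_unique (g := f) (h := fun z => f (z + lat 1 0)) hf (by fun_prop) (fun z => by
    rw [hfp, hfp, hper])
  obtain ⟨b, d, h2⟩ := lift_unique (g := f) (h := fun z => f (z + lat 0 1)) hf (by fun_prop) (fun z => by
    rw [hfp, hfp, hper])
  obtain ⟨x, y, hv⟩ := lift_unique (g := fun z => z) (h := fun z => f (f (f z))) (by fun_prop) (by fun_prop)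
    (fun z => by rw [hfp, hfp, hfp, hψ3])
  have hA : ∀ z (m n : ℤ), f (z + lat m n) = f z + lat (a * m + b * n) (c * m + d * n) := by
    intro z m n
    have s1 := shift_int h1 m z
    have s2 := shift_int h2 n (z + m * lat 1 0)
    rw [s1] at s2
    have e1 : z + lat m n = z + m * lat 1 0 + n * lat 0 1 := by
      simp only [lat]; push_cast; ring
    rw [e1, s2]
    simp only [lat]; push_cast; ring
  have hA3 : ∀ m n : ℤ, lat m n = lat (a * (a * (a * m + b * n) + b * (c * m + d * n)) + b * (c * (a * m + b * n) + d * (c * m + d * n)))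
      (c * (a * (a * m + b * n) + b * (c * m + d * n)) + d * (c * (a * m + b * n) + d * (c * m + d * n))) := by
    intro m n
    have := hv (lat m n)
    have h0 := hv 0
    have e : f (f (f (0 + lat m n))) = f (f (f 0)) + lat (a * (a * (a * m + b * n) + b * (c * m + d * n)) + b * (c * (a * m + b * n) + d * (c * m + d * n)))
      (c * (a * (a * m + b * n) + b * (c * m + d * n)) + d * (c * (a * m + b * n) + d * (c * m + d * n))) := by
      rw [hA, hA, hA]
    rw [zero_add] at e
    linear_combination e + h0 - this
  have hAv : lat x y = lat (a * x + b * y) (c * x + d * y) := by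
    have e1 : f (f (f (f 0))) = f 0 + lat x y := hv (f 0)
    have e2 : f (f (f 0)) = 0 + lat x y := hv 0
    rw [e2, hA] at e1
    exact (add_left_cancel e1).symm
  have hv0 : ¬ (x = 0 ∧ y = 0) := by
    rintro ⟨rfl, rfl⟩
    exact nofix f hf hfp (fun z => by rw [hv z]; simp [lat])
  obtain ⟨i1, i2⟩ := lat_inj (hA3 1 0)
  obtain ⟨i3, i4⟩ := lat_inj (hA3 0 1)
  obtain ⟨i5, i6⟩ := lat_inj hAv
  obtain ⟨rfl, rfl, rfl, rfl⟩ := int_matrix (a := a) (b := b) (c := c) (d := d) (x := x) (y := y)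
    (by linear_combination -i1) (by linear_combination -i3)
    (by linear_combination -i2) (by linear_combination -i4) i5.symm i6.symm hv0
  have hA' : ∀ z (m n : ℤ), f (z + lat m n) = f z + lat m n := by
    intro z m n
    rw [hA]; simp
  obtain ⟨w1, hw1⟩ : ∃ w : ℤ, |x + 3 * w| ≤ 1 := by
    refine ⟨-((x + 1) / 3), ?_⟩
    rw [abs_le]; omega
  obtain ⟨w2, hw2⟩ : ∃ w : ℤ, |y + 3 * w| ≤ 1 := by
    refine ⟨-((y + 1) / 3), ?_⟩
    rw [abs_le]; omega
  set g : ℂ → ℂ := fun z => f z + lat w1 w2 with hg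
  have hgc : Continuous g := by fun_prop
  have hgp : ∀ z, p0 (g z) = ψ (p0 z) := by
    intro z
    simp only [hg]
    rw [hper, hfp]
  have hg3 : ∀ z, g (g (g z)) = z + lat (x + 3 * w1) (y + 3 * w2) := by
    intro z
    simp only [hg]
    rw [hA', hA', hA', hv]
    simp only [lat]; push_cast; ring
  refine ⟨g, x + 3 * w1, y + 3 * w2, hgc, hgp, hg3, ?_, hw1, hw2, ?_⟩
  · intro z m n
    simp only [hg]
    rw [hA']; ring
  · rintro ⟨z1, z2⟩
    rw [z1, z2] at hg3
    exact nofix g hgc hgp (fun z => by rw [hg3 z]; simp [lat])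

/-! ## Part M: final assembly -/

lemma basis_change (x y : ℤ) (hx : |x| ≤ 1) (hy : |y| ≤ 1) (hxy : ¬ (x = 0 ∧ y = 0)) :
    ∃ C : ℂ ≃ₜ ℂ, (∀ a b, C (a + b) = C a + C b) ∧ C 1 = lat x y ∧
      ∀ ζ, (∃ a b : ℤ, C ζ = lat a b) ↔
        ∃ n m : ℤ, ζ = n + m * (2 * Real.pi * Complex.I) := by
  have hpi : Real.pi ≠ 0 := Real.pi_ne_zero
  by_cases hx0 : x = 0
  · have hy1 : y * y = 1 := by
      have := abs_le.1 hy
      have h0 : y ≠ 0 := fun h => hxy ⟨hx0, h⟩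
      have : y = 1 ∨ y = -1 := by omega
      rcases this with h | h <;> simp [h]
    have hyr : (y : ℝ) * y = 1 := by exact_mod_cast hy1
    refine ⟨{ toFun := fun z => ⟨z.im / (2 * Real.pi), z.re * y⟩
              invFun := fun z => ⟨y * z.im, 2 * Real.pi * z.re⟩
              left_inv := ?_
              right_inv := ?_
              continuous_toFun := ?_
              continuous_invFun := ?_ }, ?_, ?_, ?_⟩
    · intro z
      apply Complex.ext
      · simp only []
        linear_combination z.re * hyr
      · simp only []
        field_simp
    · intro z
      apply Complex.ext
      · simp only []
        field_simp
      · simp only []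
        linear_combination z.im * hyr
    · exact Complex.equivRealProdCLM.symm.continuous.comp
        (f := fun z : ℂ => (z.im / (2 * Real.pi), z.re * (y : ℝ))) (by fun_prop)
    · exact Complex.equivRealProdCLM.symm.continuous.comp
        (f := fun z : ℂ => ((y : ℝ) * z.im, 2 * Real.pi * z.re)) (by fun_prop)
    · intro a b
      apply Complex.ext
      · change (a + b).im / (2 * Real.pi) = a.im / (2 * Real.pi) + b.im / (2 * Real.pi)
        simp only [Complex.add_re, Complex.add_im]; ring
      · change (a + b).re * (y : ℝ) = a.re * (y : ℝ) + b.re * (y : ℝ)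
        simp only [Complex.add_re, Complex.add_im]; ring
    · apply Complex.ext
      · change (1 : ℂ).im / (2 * Real.pi) = _
        rw [lat_re]; simp [hx0]
      · change (1 : ℂ).re * (y : ℝ) = _
        rw [lat_im]; simp
    · intro ζ
      constructor
      · rintro ⟨a, b, h⟩
        have h1 : ζ.im / (2 * Real.pi) = a := by rw [← lat_re a b, ← h]; rfl
        have h2 : ζ.re * y = b := by rw [← lat_im a b, ← h]; rfl
        refine ⟨b * y, a, Complex.ext ?_ ?_⟩
        · simp
          linear_combination -ζ.re * hyr + y * h2
        · field_simp at h1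
          simp; linear_combination h1
      · rintro ⟨n, m, rfl⟩
        refine ⟨m, n * y, Complex.ext ?_ ?_⟩
        · rw [lat_re]
          change ((n : ℂ) + m * (2 * Real.pi * Complex.I)).im / (2 * Real.pi) = _
          simp
          try field_simp
        · rw [lat_im]
          change ((n : ℂ) + m * (2 * Real.pi * Complex.I)).re * (y : ℝ) = _
          simp
  · have hx1 : x * x = 1 := by
      have := abs_le.1 hx
      have : x = 1 ∨ x = -1 := by omega
      rcases this with h | h <;> simp [h]
    have hxr : (x : ℝ) * x = 1 := by exact_mod_cast hx1
    refine ⟨{ toFun := fun z => ⟨z.re * x, z.re * y + z.im / (2 * Real.pi)⟩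
              invFun := fun z => ⟨x * z.re, 2 * Real.pi * (z.im - x * y * z.re)⟩
              left_inv := ?_
              right_inv := ?_
              continuous_toFun := ?_
              continuous_invFun := ?_ }, ?_, ?_, ?_⟩
    · intro z
      apply Complex.ext
      · simp only []
        linear_combination z.re * hxr
      · simp only []
        field_simp
        linear_combination -(2 * Real.pi * y * z.re) * hxr
    · intro z
      apply Complex.ext
      · simp only []
        linear_combination z.re * hxr
      · simp only []
        field_simp
        ring
    · exact Complex.equivRealProdCLM.symm.continuous.comp
        (f := fun z : ℂ => (z.re * (x : ℝ), z.re * (y : ℝ) + z.im / (2 * Real.pi))) (by fun_prop)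
    · exact Complex.equivRealProdCLM.symm.continuous.comp
        (f := fun z : ℂ => ((x : ℝ) * z.re, 2 * Real.pi * (z.im - x * y * z.re))) (by fun_prop)
    · intro a b
      apply Complex.ext
      · change (a + b).re * (x : ℝ) = a.re * (x : ℝ) + b.re * (x : ℝ)
        simp only [Complex.add_re, Complex.add_im]; ring
      · change (a + b).re * (y : ℝ) + (a + b).im / (2 * Real.pi) = (a.re * (y : ℝ) + a.im / (2 * Real.pi)) + (b.re * (y : ℝ) + b.im / (2 * Real.pi))
        simp only [Complex.add_re, Complex.add_im]; ring
    · apply Complex.ext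
      · change (1 : ℂ).re * (x : ℝ) = _
        rw [lat_re]; simp
      · change (1 : ℂ).re * (y : ℝ) + (1 : ℂ).im / (2 * Real.pi) = _
        rw [lat_im]; simp
    · intro ζ
      constructor
      · rintro ⟨a, b, h⟩
        have h1 : ζ.re * x = a := by rw [← lat_re a b, ← h]; rfl
        have h2 : ζ.re * y + ζ.im / (2 * Real.pi) = b := by rw [← lat_im a b, ← h]; rfl
        have h3 : ζ.re = x * a := by linear_combination -ζ.re * hxr + x * h1
        refine ⟨x * a, b - x * a * y, Complex.ext ?_ ?_⟩
        · simp [h3]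
        · rw [h3] at h2
          field_simp at h2
          simp; linear_combination h2
      · rintro ⟨n, m, rfl⟩
        refine ⟨n * x, n * y + m, Complex.ext ?_ ?_⟩
        · rw [lat_re]
          change ((n : ℂ) + m * (2 * Real.pi * Complex.I)).re * (x : ℝ) = _
          simp
        · rw [lat_im]
          change ((n : ℂ) + m * (2 * Real.pi * Complex.I)).re * (y : ℝ) + ((n : ℂ) + m * (2 * Real.pi * Complex.I)).im / (2 * Real.pi) = _
          simp
          try field_simp

lemma bdd_of_periodic (h : ℂ → ℂ) (hc : Continuous h) (h1 : ∀ z, h (z + 1) = h z)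
    (h2 : ∀ z, h (z + 2 * Real.pi * Complex.I) = h z) : ∃ c, ∀ z, ‖h z‖ ≤ c := by
  have hpi : Real.pi ≠ 0 := Real.pi_ne_zero
  obtain ⟨c, hcb⟩ := (isCompact_closedBall (0 : ℂ) (1 + 2 * Real.pi)).exists_bound_of_continuousOn
    hc.continuousOn
  refine ⟨c, fun z => ?_⟩
  have e1 := shift_int (g := h) (u := 1) (v := 0) (fun z => by rw [h1, add_zero])
  have e2 := shift_int (g := h) (u := 2 * Real.pi * Complex.I) (v := 0)
    (fun z => by rw [h2, add_zero])
  set n : ℤ := -⌊z.re⌋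
  set m : ℤ := -⌊z.im / (2 * Real.pi)⌋
  have e : h z = h ((z + n * 1) + m * (2 * Real.pi * Complex.I)) := by
    rw [e2, e1]; simp
  rw [e]
  apply hcb
  rw [mem_closedBall_zero_iff]
  refine (Complex.norm_le_abs_re_add_abs_im _).trans ?_
  have a1 : |((z + n * 1) + m * (2 * Real.pi * Complex.I)).re| ≤ 1 := by
    have : ((z + n * 1) + m * (2 * Real.pi * Complex.I)).re = Int.fract z.re := by
      rw [← Int.self_sub_floor]; simp [n, -Int.self_sub_floor]; ring
    rw [this, abs_of_nonneg (Int.fract_nonneg _)]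
    exact (Int.fract_lt_one _).le
  have a2 : |((z + n * 1) + m * (2 * Real.pi * Complex.I)).im| ≤ 2 * Real.pi := by
    have : ((z + n * 1) + m * (2 * Real.pi * Complex.I)).im
        = Int.fract (z.im / (2 * Real.pi)) * (2 * Real.pi) := by
      rw [← Int.self_sub_floor]; simp [m, -Int.self_sub_floor]; field_simp; ring
    have hp := Real.pi_pos
    rw [this, abs_of_nonneg (mul_nonneg (Int.fract_nonneg _) (by positivity))]
    have := (Int.fract_lt_one (z.im / (2 * Real.pi))).le
    nlinarith
  linarith

theorem quotient_torus {M : Type} [TopologicalSpace M] [T2Space M]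
    (ψ : Circle × Circle → Circle × Circle) (hψ : Continuous ψ)
    (hψ3 : ∀ x, ψ (ψ (ψ x)) = x) (hfix : ∀ x, ψ x ≠ x)
    (mk : Circle × Circle → M) (hmc : Continuous mk) (hms : Function.Surjective mk)
    (hmk : ∀ x y, mk x = mk y ↔ (y = x ∨ y = ψ x ∨ y = ψ (ψ x))) :
    Nonempty (M ≃ₜ Circle × Circle) := by
  obtain ⟨f, x, y, hfc, hfp, hf3, hfl, hx, hy, hxy⟩ := good_lift ψ hψ hψ3 hfix
  obtain ⟨C, Cadd, C1, Clat⟩ := basis_change x y hx hy hxy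
  have hneg : ∀ z, z - lat x y = z + lat (-x) (-y) := by
    intro z; simp [lat]; ring
  have hf3n : ∀ z, f (f (f (z - lat x y))) = z := by
    intro z; rw [hf3]; ring
  let F : ℂ ≃ₜ ℂ :=
    { toFun := f
      invFun := fun z => f (f (z - lat x y))
      left_inv := fun z => by
        show f (f (f z - lat x y)) = z
        rw [hneg, ← hfl, ← hneg, hf3n]
      right_inv := hf3n
      continuous_toFun := hfc
      continuous_invFun := by
        show Continuous fun z => f (f (z - lat x y))
        fun_prop }
  have hF : ∀ z, F z = f z := fun _ => rfl
  let ft : ℂ ≃ₜ ℂ := C.trans (F.trans C.symm)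
  have hft : ∀ z, C (ft z) = f (C z) := by
    intro z; simp [ft, hF]
  have hshift : ∀ w, (∃ a b : ℤ, C w = lat a b) → ∀ z, ft (z + w) = ft z + w := by
    rintro w ⟨a, b, h⟩ z
    apply C.injective
    rw [hft, Cadd, h, hfl, Cadd, hft, h]
  have s1 : ∀ z, ft (z + 1) = ft z + 1 := hshift 1 ⟨x, y, C1⟩
  have s2 : ∀ z, ft (z + 2 * Real.pi * Complex.I) = ft z + 2 * Real.pi * Complex.I :=
    hshift _ ((Clat _).2 ⟨0, 1, by simp⟩)
  have h3 : ∀ z, ft (ft (ft z)) = z + 1 := by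
    intro z
    apply C.injective
    rw [hft, hft, hft, hf3, Cadd, C1]
  obtain ⟨c, hc⟩ := bdd_of_periodic (fun z => ft z - z) (by fun_prop)
    (fun z => by simp only [s1]; ring) (fun z => by simp only [s2]; ring)
  have hpow : ∀ (n : ℤ) z, ((ft.toEquiv : Equiv.Perm ℂ) ^ (3 * n)) z = z + n := by
    intro n z
    have hP : ∀ w, ((ft.toEquiv : Equiv.Perm ℂ) ^ (3 : ℤ)) w = w + 1 := fun w => h3 w
    rw [zpow_mul]
    induction n with
    | zero => simp
    | succ k ih =>
      rw [add_comm (k : ℤ) 1, zpow_add, zpow_one, Equiv.Perm.mul_apply, ih, hP]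
      push_cast; ring
    | pred k ih =>
      rw [show (-(k : ℤ) - 1) = -1 + -(k : ℤ) by ring, zpow_add, Equiv.Perm.mul_apply, ih,
        zpow_neg, zpow_one]
      apply ((ft.toEquiv : Equiv.Perm ℂ) ^ (3 : ℤ)).injective
      refine (Equiv.apply_symm_apply _ _).trans ?_
      rw [hP]
      push_cast; ring
  refine torus_of_strip (fun z => mk (p0 (C z))) (hmc.comp (p0_cont.comp C.continuous))
    (hms.comp (p0_surj.comp C.surjective)) ft s2 hc h3 ?_
  intro z z'
  have key : ∀ j : ℕ, ∀ w, C w = f^[j] (C z) →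
      (p0 (C z') = p0 (f^[j] (C z)) ↔
        ∃ n m : ℤ, z' = w + n + m * (2 * Real.pi * Complex.I)) := by
    intro j w hw
    rw [eq_comm, p0_eq, ← hw]
    have : (∃ a b : ℤ, C z' = C w + lat a b) ↔ ∃ a b : ℤ, C (z' - w) = lat a b := by
      have e : C z' = C w + C (z' - w) := by rw [← Cadd]; congr 1; ring
      simp [e]
    rw [this, Clat]
    constructor
    · rintro ⟨n, m, h⟩
      exact ⟨n, m, by linear_combination h⟩
    · rintro ⟨n, m, h⟩
      exact ⟨n, m, by linear_combination h⟩
  have k0 := key 0 z rfl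
  have k1 := key 1 (ft z) (hft z)
  have k2 := key 2 (ft (ft z)) (by rw [hft, hft]; rfl)
  simp only [Function.iterate_succ, Function.iterate_zero, Function.comp, id] at k0 k1 k2
  rw [hmk, ← hfp, ← hfp, k0, k1, k2]
  have q0 : ∀ n : ℤ, ((ft.toEquiv : Equiv.Perm ℂ) ^ (3 * n)) z = z + n := fun n => hpow n z
  have q1 : ∀ n : ℤ, ((ft.toEquiv : Equiv.Perm ℂ) ^ (3 * n + 1)) z = ft z + n := fun n => by
    rw [zpow_add, Equiv.Perm.mul_apply, hpow]; rfl
  have q2 : ∀ n : ℤ, ((ft.toEquiv : Equiv.Perm ℂ) ^ (3 * n + 2)) z = ft (ft z) + n := fun n => by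
    rw [zpow_add, Equiv.Perm.mul_apply, hpow]; rfl
  constructor
  · rintro (⟨n, m, h⟩ | ⟨n, m, h⟩ | ⟨n, m, h⟩)
    · exact ⟨3 * n, m, by rw [q0]; exact h⟩
    · exact ⟨3 * n + 1, m, by rw [q1]; exact h⟩
    · exact ⟨3 * n + 2, m, by rw [q2]; exact h⟩
  · rintro ⟨n, m, h⟩
    have : n = 3 * (n / 3) ∨ n = 3 * (n / 3) + 1 ∨ n = 3 * (n / 3) + 2 := by omega
    rcases this with hn | hn | hn
    · left; refine ⟨n / 3, m, ?_⟩; rw [hn, q0] at h; exact h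
    · right; left; refine ⟨n / 3, m, ?_⟩; rw [hn, q1] at h; exact h
    · right; right; refine ⟨n / 3, m, ?_⟩; rw [hn, q2] at h; exact h

noncomputable def circleHomeo :
    Circle ≃ₜ Metric.sphere (0 : EuclideanSpace ℝ (Fin 2)) 1 where
  toFun z := ⟨Complex.orthonormalBasisOneI.repr (z : ℂ), by
    rw [mem_sphere_zero_iff_norm, LinearIsometryEquiv.norm_map]; exact Circle.norm_coe z⟩
  invFun w := ⟨Complex.orthonormalBasisOneI.repr.symm w, by
    refine mem_sphere_zero_iff_norm.2 ?_
    rw [LinearIsometryEquiv.norm_map]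
    exact mem_sphere_zero_iff_norm.1 w.2⟩
  left_inv z := by
    apply Circle.ext
    exact Complex.orthonormalBasisOneI.repr.symm_apply_apply _
  right_inv w := by
    apply Subtype.ext
    exact Complex.orthonormalBasisOneI.repr.apply_symm_apply _
  continuous_toFun := by
    apply Continuous.subtype_mk
    exact Complex.orthonormalBasisOneI.repr.continuous.comp continuous_subtype_val
  continuous_invFun := by
    apply Continuous.subtype_mk
    exact Complex.orthonormalBasisOneI.repr.symm.continuous.comp continuous_subtype_val

end

theorem orbit_space_of_free_Z3_action_on_torus
    -- an action of ℤ/3 by homeomorphisms: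
    (φ : ZMod 3 → (Torus2 ≃ₜ Torus2))
    (hφ_zero : φ 0 = Homeomorph.refl Torus2)
    (hφ_add : ∀ γ δ : ZMod 3, φ (γ + δ) = (φ δ).trans (φ γ))
    -- freeness:
    (hfree : ∀ γ : ZMod 3, γ ≠ 0 → ∀ x : Torus2, φ γ x ≠ x) :
    Nonempty ((Quot fun x y : Torus2 => ∃ γ : ZMod 3, φ γ x = y)
      ≃ₜ Torus2) := by
  have hadd : ∀ γ δ x, φ γ (φ δ x) = φ (γ + δ) x := by
    intro γ δ x; rw [hφ_add]; rfl
  have hzero : ∀ x, φ 0 x = x := by intro x; rw [hφ_zero]; rfl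
  let r : Torus2 → Torus2 → Prop := fun x y => ∃ γ : ZMod 3, φ γ x = y
  have hr : Equivalence r := by
    refine ⟨fun x => ⟨0, hzero x⟩, ?_, ?_⟩
    · rintro x y ⟨γ, rfl⟩
      exact ⟨-γ, by rw [hadd, neg_add_cancel, hzero]⟩
    · rintro x y z ⟨γ, rfl⟩ ⟨δ, rfl⟩
      exact ⟨δ + γ, by rw [hadd]⟩
  have hmk : ∀ x y, Quot.mk r x = Quot.mk r y ↔ r x y := fun x y => by
    rw [Quot.eq, hr.eqvGen_iff]
  have hopen : IsOpenQuotientMap (Quot.mk r) := by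
    refine ⟨Quot.mk_surjective, continuous_quot_mk, ?_⟩
    intro U hU
    rw [← isQuotientMap_quot_mk.isOpen_preimage]
    have : Quot.mk r ⁻¹' (Quot.mk r '' U) = ⋃ γ : ZMod 3, φ γ ⁻¹' U := by
      ext x
      simp only [Set.mem_preimage, Set.mem_image, Set.mem_iUnion]
      constructor
      · rintro ⟨u, hu, h⟩
        obtain ⟨γ, hγ⟩ := hr.symm ((hmk _ _).1 h)
        exact ⟨γ, by rw [hγ]; exact hu⟩
      · rintro ⟨γ, h⟩
        exact ⟨_, h, (hmk _ _).2 (hr.symm ⟨γ, rfl⟩)⟩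
    rw [this]
    exact isOpen_iUnion fun γ => hU.preimage (φ γ).continuous
  have hT2 : T2Space (Quot r) := by
    rw [t2Space_iff_of_isOpenQuotientMap hopen]
    have : {q : Torus2 × Torus2 | Quot.mk r q.1 = Quot.mk r q.2}
        = ⋃ γ : ZMod 3, {q | φ γ q.1 = q.2} := by
      ext q
      simp [hmk, r]
    rw [this]
    exact isClosed_iUnion_of_finite fun γ =>
      isClosed_eq ((φ γ).continuous.comp continuous_fst) continuous_snd
  let E : Circle × Circle ≃ₜ Torus2 := circleHomeo.prodCongr circleHomeo
  obtain ⟨H⟩ := quotient_torus (M := Quot r) (fun x => E.symm (φ 1 (E x)))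
    (E.symm.continuous.comp ((φ 1).continuous.comp E.continuous))
    (fun x => by
      simp only [Homeomorph.apply_symm_apply, hadd]
      rw [show (1 : ZMod 3) + (1 + 1) = 0 from by decide, hzero, E.symm_apply_apply])
    (fun x h => by
      apply hfree 1 (by decide) (E x)
      exact E.symm.injective (h.trans (E.symm_apply_apply x).symm))
    (fun x => Quot.mk r (E x)) (continuous_quot_mk.comp E.continuous)
    (Quot.mk_surjective.comp E.surjective)
    (fun x y => by
      rw [hmk]
      simp only [Homeomorph.apply_symm_apply, hadd]
      have e : ∀ γ, (y = E.symm (φ γ (E x)) ↔ φ γ (E x) = E y) := fun γ => by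
        rw [← E.symm_apply_eq, eq_comm]
      rw [e, e]
      constructor
      · rintro ⟨γ, h⟩
        have : γ = 0 ∨ γ = 1 ∨ γ = 1 + 1 := by
          clear h; revert γ; decide
        rcases this with rfl | rfl | rfl
        · left; rw [hzero] at h; exact (E.injective h).symm
        · right; left; exact h
        · right; right; exact h
      · rintro (rfl | h | h)
        · exact ⟨0, hzero _⟩
        · exact ⟨_, h⟩
        · exact ⟨_, h⟩)
  exact ⟨H.trans E⟩

end
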